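/- arXiv:1310.1376 — 3 statements merged into one kernel-verified Lean document; each statement's English description precedes it below -/
import Mathlib

section
/- For every finite connected series-parallel graph G, there exists a vertex v of G such that every longest path in G contains v. -/
open SimpleGraph

/-- A walk `p` is a longest path in `G` if it is a path and no path in `G` is longer. -/
def IsLongestPath {V : Type*} (G : SimpleGraph V) {a b : V} (p : G.Walk a b) : Prop :=
  p.IsPath ∧ ∀ (c d : V) (q : G.Walk c d), q.IsPath → q.length ≤ p.length

/-- The graph obtained from `G` by adding one new vertex adjacent exactly to `x` and `y`. -/
def SimpleGraph.addLink2 {V : Type u} (G : SimpleGraph V) (x y : V) :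
    SimpleGraph (Option V) :=
  SimpleGraph.fromRel (fun a b =>
    (∃ u w : V, a = some u ∧ b = some w ∧ G.Adj u w) ∨
    (a = none ∧ (b = some x ∨ b = some y)))

/-- Skeletons of 2-trees: `K₂` is a 2-tree, and adding a new vertex adjacent exactly to the
two endpoints of an edge of a 2-tree yields a 2-tree. -/
inductive IsTwoTreeSkel : (W : Type u) → SimpleGraph W → Prop
  | base : IsTwoTreeSkel (ULift (Fin 2)) ⊤
  | extend {W : Type u} {G : SimpleGraph W} {x y : W} :
      IsTwoTreeSkel W G → G.Adj x y → IsTwoTreeSkel (Option W) (G.addLink2 x y)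

/-- A graph is a 2-tree if it is isomorphic to a 2-tree skeleton. -/
def IsTwoTree {V : Type u} (G : SimpleGraph V) : Prop :=
  ∃ (W : Type u) (H : SimpleGraph W), IsTwoTreeSkel W H ∧ Nonempty (G ≃g H)

/-- A graph is series-parallel (a partial 2-tree) if it is a subgraph of a 2-tree. -/
def IsSeriesParallel {V : Type u} (G : SimpleGraph V) : Prop :=
  ∃ (W : Type u) (T : SimpleGraph W), IsTwoTree T ∧
    ∃ f : V ↪ W, ∀ a b : V, G.Adj a b → T.Adj (f a) (f b)

namespace Gallai
variable {V : Type}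

def Pth (G : SimpleGraph V) (l : List V) : Prop := l.IsChain G.Adj ∧ l.Nodup
def Lg (G : SimpleGraph V) (n : ℕ) (l : List V) : Prop := Pth G l ∧ l.length = n
def Dj (s t : List V) : Prop := ∀ v ∈ s, v ∉ t
def Tl (G : SimpleGraph V) (x : V) (t : List V) : Prop := Pth G (x :: t)
def Md (G : SimpleGraph V) (x : V) (m : List V) (y : V) : Prop := Pth G (x :: (m ++ [y]))

def P1 (x : V) (t1 t2 : List V) : List V := t1.reverse ++ x :: t2
def P2 (x y : V) (t1 m t2 : List V) : List V := t1.reverse ++ x :: (m ++ y :: t2)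

@[simp] theorem mem_P1 {x v : V} {t1 t2} : v ∈ P1 x t1 t2 ↔ v ∈ t1 ∨ v = x ∨ v ∈ t2 := by
  simp [P1]
@[simp] theorem mem_P2 {x y v : V} {t1 m t2} :
    v ∈ P2 x y t1 m t2 ↔ v ∈ t1 ∨ v = x ∨ v ∈ m ∨ v = y ∨ v ∈ t2 := by
  simp [P2]
@[simp] theorem len_P1 {x : V} {t1 t2} : (P1 x t1 t2).length = t1.length + t2.length + 1 := by
  simp [P1]; omega
@[simp] theorem len_P2 {x y : V} {t1 m t2} :
    (P2 x y t1 m t2).length = t1.length + m.length + t2.length + 2 := by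
  simp [P2]; omega

theorem Pth.rev {G : SimpleGraph V} {l : List V} (h : Pth G l) : Pth G l.reverse := by
  refine ⟨?_, List.nodup_reverse.2 h.2⟩
  rw [List.isChain_reverse]
  exact h.1.imp (fun a b hab => hab.symm)

theorem pth_rev {G : SimpleGraph V} {l : List V} : Pth G l.reverse ↔ Pth G l :=
  ⟨fun h => by simpa using h.rev, Pth.rev⟩

theorem Lg.rev {G : SimpleGraph V} {n} {l : List V} (h : Lg G n l) : Lg G n l.reverse :=
  ⟨h.1.rev, by simpa using h.2⟩

/-- splitting a path at a vertex -/
theorem pth_split {G : SimpleGraph V} {l1 l2 : List V} {c : V} :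
    Pth G (l1 ++ c :: l2) ↔ Pth G (l1 ++ [c]) ∧ Pth G (c :: l2) ∧ Dj l1 l2 := by
  unfold Pth Dj
  rw [List.isChain_split]
  simp only [List.nodup_append, List.nodup_cons]
  constructor
  · rintro ⟨⟨h1, h2⟩, h3, h4, h5⟩
    refine ⟨⟨h1, h3, by simp, ?_⟩, ⟨h2, h4⟩, ?_⟩
    · grind
    · grind
  · grind

theorem pth_P1 {G : SimpleGraph V} {x t1 t2} :
    Pth G (P1 x t1 t2) ↔ Tl G x t1 ∧ Tl G x t2 ∧ Dj t1 t2 := by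
  unfold P1 Tl
  rw [pth_split]
  have : t1.reverse ++ [x] = (x :: t1).reverse := by simp
  rw [this, pth_rev]
  simp [Dj]

theorem Tl.nmem {G : SimpleGraph V} {x t} (h : Tl G x t) : x ∉ t := by
  have := h.2; simp at this; exact this.1

theorem Md.rev {G : SimpleGraph V} {x m y} (h : Md G x m y) : Md G y m.reverse x := by
  have := Pth.rev h; simpa [Md] using this

theorem Md.ne {G : SimpleGraph V} {x m y} (h : Md G x m y) : x ≠ y := by
  have := h.2; grind
theorem Md.nx {G : SimpleGraph V} {x m y} (h : Md G x m y) : x ∉ m := by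
  have := h.2; grind
theorem Md.ny {G : SimpleGraph V} {x m y} (h : Md G x m y) : y ∉ m := by
  have := h.2; grind

theorem tl_append {G : SimpleGraph V} {x y m t} :
    Tl G x (m ++ y :: t) ↔ Md G x m y ∧ Tl G y t ∧ Dj m t ∧ x ∉ t := by
  unfold Tl Md
  rw [← List.cons_append, pth_split]
  simp [Dj]; grind

theorem md_append {G : SimpleGraph V} {x y z m t} :
    Md G x (m ++ y :: t) z ↔ Md G x m y ∧ Md G y t z ∧ Dj m t ∧ x ∉ t ∧ x ≠ z ∧ z ∉ m := by
  have : Md G x (m ++ y :: t) z ↔ Tl G x (m ++ y :: (t ++ [z])) := by simp [Md, Tl]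
  rw [this, tl_append]
  unfold Dj
  simp [Md, Tl]; grind

theorem dj_comm {s t : List V} : Dj s t ↔ Dj t s := by unfold Dj; grind
theorem Dj.symm {s t : List V} (h : Dj s t) : Dj t s := dj_comm.1 h

theorem pth_P2 {G : SimpleGraph V} {x y t1 m t2} :
    Pth G (P2 x y t1 m t2) ↔ Tl G x t1 ∧ Md G x m y ∧ Tl G y t2 ∧ Dj t1 m ∧ Dj t1 t2 ∧ Dj m t2
      ∧ y ∉ t1 ∧ x ∉ t2 := by
  have : P2 x y t1 m t2 = P1 x t1 (m ++ y :: t2) := rfl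
  rw [this, pth_P1, tl_append]
  unfold Dj
  constructor <;> intro h <;> grind

structure L1 (G : SimpleGraph V) (n : ℕ) (x : V) (t1 t2 : List V) : Prop where
  h1 : Tl G x t1
  h2 : Tl G x t2
  d : Dj t1 t2
  len : t1.length + t2.length + 1 = n

structure L2 (G : SimpleGraph V) (n : ℕ) (x y : V) (t1 m t2 : List V) : Prop where
  h1 : Tl G x t1
  hm : Md G x m y
  h2 : Tl G y t2
  d1m : Dj t1 m
  d12 : Dj t1 t2
  dm2 : Dj m t2
  y1 : y ∉ t1
  x2 : x ∉ t2
  len : t1.length + m.length + t2.length + 2 = n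

theorem L1.lg {G : SimpleGraph V} {n x t1 t2} (h : L1 G n x t1 t2) : Lg G n (P1 x t1 t2) :=
  ⟨pth_P1.2 ⟨h.h1, h.h2, h.d⟩, by simpa using h.len⟩
theorem L2.lg {G : SimpleGraph V} {n x y t1 m t2} (h : L2 G n x y t1 m t2) :
    Lg G n (P2 x y t1 m t2) :=
  ⟨pth_P2.2 ⟨h.h1, h.hm, h.h2, h.d1m, h.d12, h.dm2, h.y1, h.x2⟩, by simpa using h.len⟩

theorem L1.symm {G : SimpleGraph V} {n x t1 t2} (h : L1 G n x t1 t2) : L1 G n x t2 t1 :=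
  ⟨h.h2, h.h1, h.d.symm, by have := h.len; omega⟩
theorem dj_rev_left {s t : List V} : Dj s.reverse t ↔ Dj s t := by simp [Dj]
theorem dj_rev_right {s t : List V} : Dj s t.reverse ↔ Dj s t := by simp [Dj]
theorem L2.symm {G : SimpleGraph V} {n x y t1 m t2} (h : L2 G n x y t1 m t2) :
    L2 G n y x t2 m.reverse t1 :=
  ⟨h.h2, h.hm.rev, h.h1, dj_rev_right.2 h.dm2.symm, h.d12.symm, dj_rev_left.2 h.d1m.symm,
    h.x2, h.y1, by have := h.len; simp; omega⟩

theorem Lg.dec1 {G : SimpleGraph V} {n x S} (h : Lg G n S) (hx : x ∈ S) :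
    ∃ t1 t2, L1 G n x t1 t2 ∧ ∀ v, v ∈ S ↔ v ∈ t1 ∨ v = x ∨ v ∈ t2 := by
  obtain ⟨s, t, rfl⟩ := List.append_of_mem hx
  have e : s ++ x :: t = P1 x s.reverse t := by simp [P1]
  rw [e] at h ⊢
  obtain ⟨a, b, c⟩ := pth_P1.1 h.1
  exact ⟨_, _, ⟨a, b, c, by simpa using h.2⟩, fun v => mem_P1⟩

theorem Lg.dec2 {G : SimpleGraph V} {n x y S} (h : Lg G n S) (hx : x ∈ S) (hy : y ∈ S)
    (hxy : x ≠ y) :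
    ∃ t1 m t2, L2 G n x y t1 m t2 ∧ ∀ v, v ∈ S ↔ v ∈ t1 ∨ v = x ∨ v ∈ m ∨ v = y ∨ v ∈ t2 := by
  obtain ⟨t1, t2, h1, h2⟩ := h.dec1 hx
  wlog hy2 : y ∈ t2 generalizing t1 t2
  · have hy1 : y ∈ t1 := by
      have := (h2 y).1 hy; grind
    exact this t2 t1 h1.symm (by grind) hy1
  obtain ⟨m, t, rfl⟩ := List.append_of_mem hy2
  have e : P1 x t1 (m ++ y :: t) = P2 x y t1 m t := rfl
  have h3 := h1.lg
  rw [e] at h3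
  obtain ⟨a1, a2, a3, a4, a5, a6, a7, a8⟩ := pth_P2.1 h3.1
  refine ⟨t1, m, t, ⟨a1, a2, a3, a4, a5, a6, a7, a8, by simpa using h3.2⟩, ?_⟩
  intro v; rw [h2]; simp

structure Ctx (G : SimpleGraph V) (n : ℕ) : Prop where
  max : ∀ l, Pth G l → l.length ≤ n
  inter : ∀ P Q, Lg G n P → Lg G n Q → ∃ v, v ∈ P ∧ v ∈ Q
  nog : ∀ v, ∃ P, Lg G n P ∧ v ∉ P

variable {G : SimpleGraph V} {n : ℕ}

theorem Ctx.le1 (c : Ctx G n) {x t1 t2} (h1 : Tl G x t1) (h2 : Tl G x t2) (d : Dj t1 t2) :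
    t1.length + t2.length + 1 ≤ n := by
  simpa using c.max _ (pth_P1.2 ⟨h1, h2, d⟩)

theorem Ctx.le2 (c : Ctx G n) {x y t1 m t2} (h1 : Tl G x t1) (hm : Md G x m y) (h2 : Tl G y t2)
    (d1m : Dj t1 m) (d12 : Dj t1 t2) (dm2 : Dj m t2) (y1 : y ∉ t1) (x2 : x ∉ t2) :
    t1.length + m.length + t2.length + 2 ≤ n := by
  simpa using c.max _ (pth_P2.2 ⟨h1, hm, h2, d1m, d12, dm2, y1, x2⟩)

theorem Ctx.le3 (c : Ctx G n) {x y z t1 m k t2} (h1 : Tl G x t1) (hm : Md G x m y)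
    (hk : Md G y k z) (h2 : Tl G z t2)
    (d1m : Dj t1 m) (d1k : Dj t1 k) (d12 : Dj t1 t2) (dmk : Dj m k) (dm2 : Dj m t2)
    (dk2 : Dj k t2) (y1 : y ∉ t1) (z1 : z ∉ t1) (x2 : x ∉ t2) (y2 : y ∉ t2)
    (xk : x ∉ k) (zm : z ∉ m) (xz : x ≠ z) :
    t1.length + m.length + k.length + t2.length + 3 ≤ n := by
  have e : Md G x (m ++ y :: k) z := md_append.2 ⟨hm, hk, dmk, xk, xz, zm⟩
  have := c.le2 h1 e h2 (by unfold Dj at *; grind) d12 (by unfold Dj at *; grind) z1 x2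
  simp at this; omega

theorem Tl.take {x : V} {s t : List V} (h : Tl G x (s ++ t)) : Tl G x s := by
  unfold Tl Pth at *
  rw [← List.cons_append] at h
  exact ⟨h.1.left_of_append, h.2.of_append_left⟩

/-- Lemma A -/
theorem Ctx.lemA (c : Ctx G n) {x t1 t2 P} (hQ : L1 G n x t1 t2) (hP : Lg G n P)
    (hx : x ∉ P) (hd : Dj t1 P) : 2 * (t1.length + 1) < n := by
  classical
  obtain ⟨v, hvP, hvQ⟩ := c.inter _ _ hP hQ.lg
  have hv2 : v ∈ t2 := by
    rw [mem_P1] at hvQ; unfold Dj at hd; grind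
  have key : ∃ s w r, t2 = s ++ w :: r ∧ w ∈ P ∧ Dj s P := by
    clear hQ hvQ
    induction t2 with
    | nil => simp at hv2
    | cons a t ih =>
      by_cases ha : a ∈ P
      · exact ⟨[], a, t, rfl, ha, by simp [Dj]⟩
      · obtain ⟨s, w, r, e, hw, hs⟩ := ih (by grind)
        refine ⟨a :: s, w, r, by simp [e], hw, ?_⟩
        unfold Dj at *; grind
  obtain ⟨s, w, r, rfl, hw, hs⟩ := key
  obtain ⟨p1, p2, hP', hm⟩ := hP.dec1 hw
  have hs' := (tl_append.1 hQ.h2)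
  have hd' := hQ.d
  have h1 := c.le2 hQ.h1 hs'.1 hP'.h1 (by unfold Dj at *; grind) (by unfold Dj at *; grind)
    (by unfold Dj at *; grind) (by unfold Dj at *; grind) (by unfold Dj at *; grind)
  have h2 := c.le2 hQ.h1 hs'.1 hP'.h2 (by unfold Dj at *; grind) (by unfold Dj at *; grind)
    (by unfold Dj at *; grind) (by unfold Dj at *; grind) (by unfold Dj at *; grind)
  have := hP'.len
  omega

/-- Lemma B -/
theorem Ctx.lemB (c : Ctx G n) {x t1 t2 S S'} (hP : L1 G n x t1 t2) (hS : Lg G n S)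
    (hS' : Lg G n S') (hx : x ∉ S) (hx' : x ∉ S') (hd : Dj t1 S) (hd' : Dj t2 S') : False := by
  have h1 := c.lemA hP hS hx hd
  have h2 := c.lemA hP.symm hS' hx' hd'
  have := hP.len
  omega

/-- propagation along a path -/
theorem Pth.prop {l : List V} (h : Pth G l) (D : V → Prop)
    (hD : ∀ u v, u ∈ l → v ∈ l → G.Adj u v → D u → D v) :
    ∀ u v, u ∈ l → v ∈ l → D u → D v := by
  replace h := h.1
  induction l with
  | nil => simp
  | cons a t ih =>
    cases t with
    | nil => intro u v hu hv; simp at hu hv; subst hu; subst hv; exact id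
    | cons b t =>
      rw [List.isChain_cons_cons] at h
      have ih := ih (by grind) h.2
      have hab := hD a b (by simp) (by simp) h.1
      have hba := hD b a (by simp) (by simp) h.1.symm
      intro u v hu hv hDu
      have : ∀ w ∈ a :: b :: t, D w ↔ D b := by
        intro w hw
        rcases List.mem_cons.1 hw with rfl | hw
        · exact ⟨hab, hba⟩
        · exact ⟨ih w b hw (by simp), ih b w (by simp) hw⟩
      exact (this v hv).2 ((this u hu).1 hDu)

theorem Pth.mono {K : Type} (τ : V → K) {l : List V} (h : Pth G l)
    (hD : ∀ u v, u ∈ l → v ∈ l → G.Adj u v → τ u = τ v) :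
    ∀ u v, u ∈ l → v ∈ l → τ u = τ v := by
  intro u v hu hv
  exact (h.prop (fun w => τ u = τ w) (fun a b ha hb hab e => e.trans (hD a b ha hb hab)) u v hu hv rfl)

theorem Tl.tail {x : V} {t : List V} (h : Tl G x t) : Pth G t := ⟨List.IsChain.tail h.1, h.2.tail⟩
theorem Md.mid {x m y} (h : Md G x m y) : Pth G m := by
  have := Tl.tail h
  exact ⟨this.1.left_of_append, this.2.of_append_left⟩

/-- GOOD -/
def Good (G : SimpleGraph V) (n : ℕ) (x y : V) (C : V → Prop) : Prop :=
  (∀ S, Lg G n S → ∃ v, v ∈ S ∧ C v) ∧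
  (∀ P Q, Lg G n P → Lg G n Q → x ∈ P → y ∉ P → y ∈ Q → x ∉ Q → ∃ v, v ∈ P ∧ v ∈ Q ∧ C v)

theorem Good.symm {x y : V} {C} (h : Good G n x y C) : Good G n y x C :=
  ⟨h.1, fun P Q hP hQ a b c d => by
    obtain ⟨v, h1, h2, h3⟩ := h.2 Q P hQ hP c d a b
    exact ⟨v, h2, h1, h3⟩⟩
end Gallai

namespace Gallai
variable {V : Type} {G : SimpleGraph V} {n : ℕ}

/-- colouring invariant along edges avoiding x, y -/
def Col {K : Type} (G : SimpleGraph V) (x y : V) (τ : V → K) : Prop :=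
  ∀ u v, u ≠ x → u ≠ y → v ≠ x → v ≠ y → G.Adj u v → τ u = τ v

variable {K : Type} {x y : V} {τ : V → K}

theorem Col.symm (h : Col G x y τ) : Col G y x τ := fun u v a b c d e => h u v b a d c e

theorem Col.mono (h : Col G x y τ) {l} (hl : Pth G l) (hx : x ∉ l) (hy : y ∉ l) :
    ∀ u v, u ∈ l → v ∈ l → τ u = τ v := by
  apply hl.mono τ
  intro u v hu hv huv
  exact h u v (by grind) (by grind) (by grind) (by grind) huv

/-- decomposition of a longest path containing x, not y, with monochromatic tails,
the first containing a given vertex -/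
theorem Col.dec (h : Col G x y τ) {P v} (hP : Lg G n P) (hx : x ∈ P) (hy : y ∉ P) (hv : v ∈ P)
    (hvx : v ≠ x) :
    ∃ t1 t2, L1 G n x t1 t2 ∧ (∀ v, v ∈ P ↔ v ∈ t1 ∨ v = x ∨ v ∈ t2) ∧ v ∈ t1 ∧
      (∀ u ∈ t1, τ u = τ v) ∧ (∀ u w, u ∈ t2 → w ∈ t2 → τ u = τ w) := by
  obtain ⟨t1, t2, h1, h2⟩ := hP.dec1 hx
  wlog hv1 : v ∈ t1 generalizing t1 t2
  · exact this t2 t1 h1.symm (by grind) (by grind)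
  have a1 := h.mono h1.h1.tail h1.h1.nmem (by grind)
  have a2 := h.mono h1.h2.tail h1.h2.nmem (by grind)
  exact ⟨t1, t2, h1, h2, hv1, fun u hu => a1 u v hu hv1, a2⟩

/-- two differently coloured vertices -/
theorem Col.dec' (h : Col G x y τ) {P v w} (hP : Lg G n P) (hx : x ∈ P) (hy : y ∉ P) (hv : v ∈ P)
    (hvx : v ≠ x) (hw : w ∈ P) (hwx : w ≠ x) (hne : τ v ≠ τ w) :
    ∃ t1 t2, L1 G n x t1 t2 ∧ (∀ v, v ∈ P ↔ v ∈ t1 ∨ v = x ∨ v ∈ t2) ∧ v ∈ t1 ∧ w ∈ t2 ∧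
      (∀ u ∈ t1, τ u = τ v) ∧ (∀ u ∈ t2, τ u = τ w) := by
  obtain ⟨t1, t2, h1, h2, h3, h4, h5⟩ := h.dec hP hx hy hv hvx
  have hw2 : w ∈ t2 := by grind
  exact ⟨t1, t2, h1, h2, h3, hw2, h4, fun u hu => h5 u w hu hw2⟩

theorem Ctx.lemB' (c : Ctx G n) (hτ : Col G x y τ) {P S S' v w} (hP : Lg G n P) (hx : x ∈ P)
    (hy : y ∉ P) (hS : Lg G n S) (hS' : Lg G n S') (hxS : x ∉ S) (hxS' : x ∉ S')
    (hv : v ∈ P) (hvx : v ≠ x) (hw : w ∈ P) (hwx : w ≠ x) (hne : τ v ≠ τ w)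
    (h1 : ∀ u ∈ P, u ∈ S → u ≠ x → τ u ≠ τ v) (h2 : ∀ u ∈ P, u ∈ S' → u ≠ x → τ u ≠ τ w) : False := by
  obtain ⟨t1, t2, a1, a2, a3, a4, a5, a6⟩ := hτ.dec' hP hx hy hv hvx hw hwx hne
  exact c.lemB a1 hS hS' hxS hxS' (by unfold Dj; grind) (by unfold Dj; grind)

theorem Ctx.caseN (c : Ctx G n) (hτ : Col G x y τ) {S0} (h0 : Lg G n S0) (hx : x ∉ S0)
    (hy : y ∉ S0) : ∃ k, Good G n x y (fun v => v ≠ x ∧ v ≠ y ∧ τ v = k) := by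
  obtain ⟨s, hs, -⟩ := c.inter _ _ h0 h0
  have hm : ∀ u ∈ S0, τ u = τ s := fun u hu => hτ.mono h0.1 hx hy u s hu hs
  refine ⟨τ s, ?_, ?_⟩
  · intro S hS
    obtain ⟨v, h1, h2⟩ := c.inter _ _ hS h0
    exact ⟨v, h1, by grind, by grind, hm v h2⟩
  · intro P Q hP hQ hxP hyP hyQ hxQ
    by_contra hcon
    obtain ⟨v, hv1, hv2⟩ := c.inter _ _ hP h0
    obtain ⟨w, hw1, hw2⟩ := c.inter _ _ hP hQ
    exact c.lemB' hτ (v := v) (w := w) hP hxP hyP hQ h0 hxQ hx hv1 (by grind) hw1 (by grind)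
      (by grind) (by grind) (by grind)

theorem Ctx.subU1 (c : Ctx G n) (hτ : Col G x y τ) {P Q P' k} (hP : Lg G n P) (hQ : Lg G n Q)
    (hP' : Lg G n P') (hyP : y ∉ P) (hyQ : y ∈ Q) (hxQ : x ∉ Q) (hyP' : y ∉ P')
    (h1 : ∀ v ∈ P, v ∈ Q → τ v = k) (h2 : ∀ v ∈ P', v ∈ Q → τ v ≠ k) : False := by
  obtain ⟨v, hv1, hv2⟩ := c.inter _ _ hP hQ
  obtain ⟨w, hw1, hw2⟩ := c.inter _ _ hP' hQ
  exact c.lemB' hτ.symm (v := v) (w := w) hQ hyQ hxQ hP' hP hyP' hyP hv2 (by grind) hw2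
    (by grind) (by grind) (by grind) (by grind)

theorem Ctx.subU2 (c : Ctx G n) (hτ : Col G x y τ) {P Q P' Q' k} (hP : Lg G n P) (hQ : Lg G n Q)
    (hP' : Lg G n P') (hQ' : Lg G n Q') (hxP : x ∈ P) (hyP : y ∉ P) (hyQ : y ∈ Q) (hxQ : x ∉ Q)
    (hxP' : x ∈ P') (hyP' : y ∉ P') (hyQ' : y ∈ Q') (hxQ' : x ∉ Q')
    (h1 : ∀ v ∈ P, v ∈ Q → τ v = k) (h2 : ∀ v ∈ P', v ∈ Q' → τ v ≠ k) : False := by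
  have e1 : ∃ v, v ∈ P' ∧ v ∈ Q ∧ τ v = k := by
    by_contra hcon
    exact c.subU1 hτ hP hQ hP' hyP hyQ hxQ hyP' h1 (by grind)
  have e2 : ∃ v, v ∈ P ∧ v ∈ Q' ∧ τ v = k := by
    by_contra hcon
    exact c.subU1 (k := k) hτ.symm hQ hP hQ' hxQ hxP hyP hxQ' (by grind) (by grind)
  obtain ⟨v, v1, v2, v3⟩ := e1
  obtain ⟨w, w1, w2, w3⟩ := e2
  obtain ⟨d, d1, d2⟩ := c.inter _ _ hP' hQ'
  have d3 := h2 d d1 d2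
  obtain ⟨s, s1, s2⟩ := c.inter _ _ hP hQ
  have s3 := h1 s s1 s2
  obtain ⟨pc', pd', a1, a2, a3, a4, a5, a6⟩ := hτ.dec' hP' hxP' hyP' v1 (by grind) d1 (by grind)
    (show τ v ≠ τ d by grind)
  obtain ⟨qc', qd', b1, b2, b3, b4, b5, b6⟩ := hτ.symm.dec' hQ' hyQ' hxQ' w2 (by grind) d2 (by grind)
    (show τ w ≠ τ d by grind)
  have f2 : ∃ u, u ∈ qd' ∧ u ∈ P := by
    by_contra hcon
    exact c.lemB b1 hP' hP hyP' hyP (by unfold Dj; grind) (by unfold Dj; grind)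
  obtain ⟨u, u1, u2⟩ := f2
  have u3 := b6 u u1
  obtain ⟨pc, pd, e1, e2, e3, e4, e5, e6⟩ := hτ.dec' hP hxP hyP s1 (by grind) u2 (by grind)
    (show τ s ≠ τ u by grind)
  have g1 := c.lemA e1.symm hQ hxQ (by unfold Dj; grind)
  have g2 := c.lemA a1 hQ' hxQ' (by unfold Dj; grind)
  have g3 := c.le1 e1.h1 a1.h2 (by unfold Dj; grind)
  have := e1.len
  have := a1.len
  omega

theorem Ctx.subR (c : Ctx G n) {rx m ry p k} (hR : L2 G n x y rx m ry)
    (hk : ∀ v, (v ∈ rx ∨ v ∈ m ∨ v ∈ ry) → τ v ≠ k) (hp : Tl G x p) (hy : y ∉ p)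
    (hpk : ∀ v ∈ p, τ v = k) : p.length ≤ rx.length := by
  have := c.le2 hp hR.hm hR.h2 (by unfold Dj; grind) (by unfold Dj; grind) hR.dm2 hy hR.x2
  have := hR.len
  omega

theorem Ctx.subP (c : Ctx G n) (hτ : Col G x y τ) {P Q k} (hP : Lg G n P) (hQ : Lg G n Q)
    (hxP : x ∈ P) (hyP : y ∉ P) (hxQ : x ∉ Q)
    (h1 : ∀ v ∈ P, v ∈ Q → τ v = k) :
    ∃ t, Tl G x t ∧ y ∉ t ∧ (∀ v ∈ t, τ v = k) ∧ n ≤ 2 * t.length + 1 := by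
  obtain ⟨s, s1, s2⟩ := c.inter _ _ hP hQ
  have s3 := h1 s s1 s2
  obtain ⟨t1, t2, a1, a2, a3, a4, a5⟩ := hτ.dec hP hxP hyP s1 (by grind)
  have hl := a1.len
  by_cases h : ∃ u ∈ t2, τ u = k
  · obtain ⟨u, u1, u2⟩ := h
    rcases le_total t1.length t2.length with h | h
    · exact ⟨t2, a1.h2, by grind, fun v hv => (a5 v u hv u1).trans u2, by omega⟩
    · exact ⟨t1, a1.h1, by grind, fun v hv => (a4 v hv).trans s3, by omega⟩
  · have := c.lemA a1.symm hQ hxQ (by unfold Dj; grind)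
    exact ⟨t1, a1.h1, by grind, fun v hv => (a4 v hv).trans s3, by omega⟩

theorem Ctx.caseU (c : Ctx G n) (hxy : x ≠ y) (hτ : Col G x y τ)
    (hH : ∀ S, Lg G n S → x ∈ S ∨ y ∈ S) {P Q k} (hP : Lg G n P) (hQ : Lg G n Q)
    (hxP : x ∈ P) (hyP : y ∉ P) (hyQ : y ∈ Q) (hxQ : x ∉ Q)
    (h1 : ∀ v ∈ P, v ∈ Q → τ v = k) : Good G n x y (fun v => v ≠ x ∧ v ≠ y ∧ τ v = k) := by
  have h2 : (∀ P Q, Lg G n P → Lg G n Q → x ∈ P → y ∉ P → y ∈ Q → x ∉ Q →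
      ∃ v, v ∈ P ∧ v ∈ Q ∧ v ≠ x ∧ v ≠ y ∧ τ v = k) := by
    intro P' Q' hP' hQ' i1 i2 i3 i4
    by_contra hcon
    exact c.subU2 hτ hP hQ hP' hQ' hxP hyP hyQ hxQ i1 i2 i3 i4 h1 (by grind)
  refine ⟨?_, h2⟩
  intro R hR
  by_contra hcon
  have hx : x ∈ R := by
    by_contra hx
    have hy := (hH R hR).resolve_left hx
    have := h2 P R hP hR hxP hyP hy hx
    grind
  have hy : y ∈ R := by
    by_contra hy
    have := h2 R Q hR hQ hx hy hyQ hxQ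
    grind
  clear h2 hH
  obtain ⟨rx, m, ry, b1, b2⟩ := hR.dec2 hx hy hxy
  have nx := b1.h1.nmem
  have ny := b1.h2.nmem
  have mx := b1.hm.nx
  have my := b1.hm.ny
  have i1 := b1.y1
  have i2 := b1.x2
  obtain ⟨p, p1, p2, p3, p4⟩ := c.subP hτ hP hQ hxP hyP hxQ h1
  obtain ⟨q, q1, q2, q3, q4⟩ := c.subP (k := k) hτ.symm hQ hP hyQ hxQ hyP (by grind)
  have := c.subR (τ := τ) (k := k) b1 (by grind) p1 p2 p3
  have := c.subR (τ := τ) (k := k) b1.symm (by simp only [List.mem_reverse]; grind) q1 q2 q3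
  have := b1.len
  omega

theorem Col.two (hτ : Col G x y τ) {P Q : List V} {v w : V} (hP : Lg G n P) (hxP : x ∈ P) (hyP : y ∉ P)
    (hxQ : x ∉ Q) (hv : v ∈ P) (hvx : v ≠ x) (hw : w ∈ P) (hwx : w ≠ x) (hne : τ v ≠ τ w)
    (h : ∀ k, ∃ u, u ∈ P ∧ u ∈ Q ∧ τ u ≠ k) : ∃ u, u ∈ P ∧ u ∈ Q ∧ τ u = τ v := by
  obtain ⟨t1, t2, h1, h2, h3, h4, h5⟩ := hτ.dec' hP hxP hyP hv hvx hw hwx hne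
  obtain ⟨u, u1, u2, u3⟩ := h (τ w)
  exact ⟨u, u1, u2, by grind⟩

theorem Ctx.caseD' (c : Ctx G n) (hxy : x ≠ y) 
    (hH : ∀ S, Lg G n S → x ∈ S ∨ y ∈ S) {P Q : List V} {k : K} (hP : Lg G n P) (hQ : Lg G n Q)
    (hxP : x ∈ P) (hyP : y ∉ P) (hyQ : y ∈ Q) (hxQ : x ∉ Q)
    (h2 : ∀ P Q, Lg G n P → Lg G n Q → x ∈ P → y ∉ P → y ∈ Q → x ∉ Q →
      ∃ u, u ∈ P ∧ u ∈ Q ∧ u ≠ x ∧ u ≠ y ∧ τ u = k)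
    (hR : ∃ R, Lg G n R ∧ ∀ u ∈ R, ¬ (u ≠ x ∧ u ≠ y ∧ τ u = k)) {p q : List V}
    (p1 : Tl G x p) (p2 : y ∉ p) (p3 : ∀ u ∈ p, τ u = k) (q1 : Tl G y q) (q2 : x ∉ q)
    (q3 : ∀ u ∈ q, τ u = k) : p.length + q.length + 2 ≤ n := by
  obtain ⟨R, hR, hcon⟩ := hR
  have hx : x ∈ R := by
    by_contra hx
    have hy := (hH R hR).resolve_left hx
    have := h2 P R hP hR hxP hyP hy hx
    grind
  have hy : y ∈ R := by
    by_contra hy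
    have := h2 R Q hR hQ hx hy hyQ hxQ
    grind
  clear h2 hH
  obtain ⟨rx, m, ry, b1, b2⟩ := hR.dec2 hx hy hxy
  have nx := b1.h1.nmem
  have ny := b1.h2.nmem
  have mx := b1.hm.nx
  have my := b1.hm.ny
  have i1 := b1.y1
  have i2 := b1.x2
  have := c.subR (τ := τ) (k := k) b1 (by grind) p1 p2 p3
  have := c.subR (τ := τ) (k := k) b1.symm (by simp only [List.mem_reverse]; grind) q1 q2 q3
  have := b1.len
  omega

theorem Ctx.caseD (c : Ctx G n) (hxy : x ≠ y) (hτ : Col G x y τ)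
    (hH : ∀ S, Lg G n S → x ∈ S ∨ y ∈ S) 
    (hD : ∀ P Q, Lg G n P → Lg G n Q → x ∈ P → y ∉ P → y ∈ Q → x ∉ Q →
      ∀ k, ∃ u, u ∈ P ∧ u ∈ Q ∧ τ u ≠ k) :
    ∃ k, Good G n x y (fun v => v ≠ x ∧ v ≠ y ∧ τ v = k) := by
  obtain ⟨P, hP, hyP⟩ := c.nog y
  obtain ⟨Q, hQ, hxQ⟩ := c.nog x
  have hxP := (hH P hP).resolve_right hyP
  have hyQ := (hH Q hQ).resolve_left hxQ
  obtain ⟨v, v1, v2⟩ := c.inter _ _ hP hQ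
  obtain ⟨w, w1, w2, w3⟩ := hD P Q hP hQ hxP hyP hyQ hxQ (τ v)
  have g2 : ∀ v ∈ P, v ∈ Q → ∀ w ∈ P, w ∈ Q → τ v ≠ τ w → (∀ P Q, Lg G n P → Lg G n Q → x ∈ P → y ∉ P → y ∈ Q → x ∉ Q →
      ∃ u, u ∈ P ∧ u ∈ Q ∧ u ≠ x ∧ u ≠ y ∧ τ u = τ v) := by
    intro v v1 v2 w w1 w2 hne P' Q' hP' hQ' i1 i2 i3 i4
    obtain ⟨a, a1, a2, a3⟩ := hτ.symm.two (P := Q) (Q := P') hQ hyQ hxQ i2 v2 (by grind) w2 (by grind) hne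
      (by intro k; have := hD P' Q hP' hQ i1 i2 hyQ hxQ k; grind)
    obtain ⟨b, b1, b2, b3⟩ := hτ.symm.two (P := Q) (Q := P') hQ hyQ hxQ i2 w2 (by grind) v2 (by grind) hne.symm
      (by intro k; have := hD P' Q hP' hQ i1 i2 hyQ hxQ k; grind)
    obtain ⟨e, e1, e2, e3⟩ := hτ.two (P := P') (Q := Q') hP' i1 i2 i4 a2 (by grind) b2 (by grind) 
      (show τ a ≠ τ b by grind) (hD P' Q' hP' hQ' i1 i2 i3 i4)
    exact ⟨e, e1, e2, by grind, by grind, by grind⟩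
  have gv := g2 v v1 v2 w w1 w2 w3.symm
  have gw := g2 w w1 w2 v v1 v2 w3
  by_contra hcon
  push Not at hcon
  have fv : ∃ R, Lg G n R ∧ ∀ u ∈ R, ¬ (u ≠ x ∧ u ≠ y ∧ τ u = τ v) := by
    by_contra h'
    exact hcon (τ v) ⟨by grind, gv⟩
  have fw : ∃ R, Lg G n R ∧ ∀ u ∈ R, ¬ (u ≠ x ∧ u ≠ y ∧ τ u = τ w) := by
    by_contra h'
    exact hcon (τ w) ⟨by grind, gw⟩
  clear g2 hD hcon
  obtain ⟨pc, pd, a1, a2, a3, a4, a5, a6⟩ := hτ.dec' hP hxP hyP v1 (by grind) w1 (by grind) w3.symm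
  obtain ⟨qc, qd, b1, b2, b3, b4, b5, b6⟩ := hτ.symm.dec' hQ hyQ hxQ v2 (by grind) w2 (by grind) w3.symm
  have k1 := c.caseD' hxy hH hP hQ hxP hyP hyQ hxQ gv fv a1.h1 (by grind) a5 b1.h1 (by grind) b5
  have k2 := c.caseD' hxy hH hP hQ hxP hyP hyQ hxQ gw fw a1.h2 (by grind) a6 b1.h2 (by grind) b6
  have := a1.len
  have := b1.len
  omega

/-- Theorem 1 -/
theorem Ctx.thm1 (c : Ctx G n) (hxy : x ≠ y) (hτ : Col G x y τ) :
    ∃ k, Good G n x y (fun v => v ≠ x ∧ v ≠ y ∧ τ v = k) := by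
  by_cases hN : ∃ S, Lg G n S ∧ x ∉ S ∧ y ∉ S
  · obtain ⟨S, h1, h2, h3⟩ := hN
    exact c.caseN hτ h1 h2 h3
  have hH : ∀ S, Lg G n S → x ∈ S ∨ y ∈ S := by grind
  by_cases hD : ∀ P Q, Lg G n P → Lg G n Q → x ∈ P → y ∉ P → y ∈ Q → x ∉ Q →
      ∀ k, ∃ u, u ∈ P ∧ u ∈ Q ∧ τ u ≠ k
  · exact c.caseD hxy hτ hH hD
  · push Not at hD
    obtain ⟨P, Q, hP, hQ, h1, h2, h3, h4, k, hk⟩ := hD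
    exact ⟨k, c.caseU hxy hτ hH hP hQ h1 h2 h3 h4 hk⟩
end Gallai

namespace Gallai
variable {V : Type} {G : SimpleGraph V} {n : ℕ}

structure Tri (G : SimpleGraph V) (n : ℕ) (x y z : V) (cx cy cz : V → Prop) : Prop where
  xy : x ≠ y
  xz : x ≠ z
  yz : y ≠ z
  dxy : ∀ v, cx v → cy v → False
  dxz : ∀ v, cx v → cz v → False
  dyz : ∀ v, cy v → cz v → False
  nx : ∀ v, cx v → v ≠ x ∧ v ≠ y ∧ v ≠ z
  ny : ∀ v, cy v → v ≠ x ∧ v ≠ y ∧ v ≠ z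
  nz : ∀ v, cz v → v ≠ x ∧ v ≠ y ∧ v ≠ z
  cov : ∀ v, v = x ∨ v = y ∨ v = z ∨ cx v ∨ cy v ∨ cz v
  ex : ∀ u v, cx u → G.Adj u v → cx v ∨ v = y ∨ v = z
  ey : ∀ u v, cy u → G.Adj u v → cy v ∨ v = x ∨ v = z
  ez : ∀ u v, cz u → G.Adj u v → cz v ∨ v = x ∨ v = y
  gx : Good G n y z (fun v => v ≠ y ∧ v ≠ z ∧ ¬ cx v)
  gy : Good G n x z (fun v => v ≠ x ∧ v ≠ z ∧ ¬ cy v)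
  gz : Good G n x y (fun v => v ≠ x ∧ v ≠ y ∧ ¬ cz v)

theorem Good.congr {x y : V} {C D : V → Prop} (h : Good G n x y C) (hCD : ∀ v, C v → D v) :
    Good G n x y D :=
  ⟨fun S hS => by obtain ⟨v, h1, h2⟩ := h.1 S hS; exact ⟨v, h1, hCD v h2⟩,
   fun P Q a b c d e f => by
    obtain ⟨v, h1, h2, h3⟩ := h.2 P Q a b c d e f; exact ⟨v, h1, h2, hCD v h3⟩⟩

variable {x y z : V} {cx cy cz : V → Prop}

theorem Tri.sxy (T : Tri G n x y z cx cy cz) : Tri G n y x z cy cx cz where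
  xy := T.xy.symm
  xz := T.yz
  yz := T.xz
  dxy v a b := T.dxy v b a
  dxz := T.dyz
  dyz := T.dxz
  nx v h := by have := T.ny v h; tauto
  ny v h := by have := T.nx v h; tauto
  nz v h := by have := T.nz v h; tauto
  cov v := by have := T.cov v; tauto
  ex := T.ey
  ey := T.ex
  ez u v a b := by have := T.ez u v a b; tauto
  gx := T.gy
  gy := T.gx
  gz := T.gz.symm.congr (by tauto)

theorem Tri.syz (T : Tri G n x y z cx cy cz) : Tri G n x z y cx cz cy where
  xy := T.xz
  xz := T.xy
  yz := T.yz.symm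
  dxy := T.dxz
  dxz := T.dxy
  dyz v a b := T.dyz v b a
  nx v h := by have := T.nx v h; tauto
  ny v h := by have := T.nz v h; tauto
  nz v h := by have := T.ny v h; tauto
  cov v := by have := T.cov v; tauto
  ex u v a b := by have := T.ex u v a b; tauto
  ey := T.ez
  ez := T.ey
  gx := T.gx.symm.congr (by tauto)
  gy := T.gz
  gz := T.gy

theorem Tri.sxz (T : Tri G n x y z cx cy cz) : Tri G n z y x cz cy cx := T.sxy.syz.sxy
theorem Tri.rot (T : Tri G n x y z cx cy cz) : Tri G n y z x cy cz cx := T.sxy.syz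

/-- a path avoiding x,y,z lies in one region -/
theorem Tri.single (T : Tri G n x y z cx cy cz) {l} (hl : Pth G l) (hx : x ∉ l) (hy : y ∉ l)
    (hz : z ∉ l) : (∀ v ∈ l, cx v) ∨ (∀ v ∈ l, cy v) ∨ (∀ v ∈ l, cz v) := by
  obtain ⟨-, -, -, -, -, -, -, -, -, cov, ex, ey, ez, -, -, -⟩ := T
  cases l with
  | nil => simp
  | cons a t =>
    have ha : a ∈ a :: t := by simp
    rcases cov a with h | h | h | h | h | h
    · grind
    · grind
    · grind
    · left; intro v hv
      refine hl.prop cx ?_ a v ha hv h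
      intro u w hu hw huw hc
      have := ex u w hc huw; grind
    · right; left; intro v hv
      refine hl.prop cy ?_ a v ha hv h
      intro u w hu hw huw hc
      have := ey u w hc huw; grind
    · right; right; intro v hv
      refine hl.prop cz ?_ a v ha hv h
      intro u w hu hw huw hc
      have := ez u w hc huw; grind

theorem Tri.tail (T : Tri G n x y z cx cy cz) {t} (h : Tl G x t) (hy : y ∉ t) (hz : z ∉ t) :
    (∀ v ∈ t, cy v) ∨ (∀ v ∈ t, cz v) := by
  rcases T.single h.tail h.nmem hy hz with h1 | h1 | h1
  · cases t with
    | nil => simp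
    | cons a t =>
      have : G.Adj x a := by
        have := h.1; rw [List.isChain_cons_cons] at this; exact this.1
      have h2 := T.ex a x (h1 a (by simp)) this.symm
      have h3 := T.nx x
      have := T.xy
      have := T.xz
      tauto
  · exact Or.inl h1
  · exact Or.inr h1

theorem Tri.mid (T : Tri G n x y z cx cy cz) {m} (h : Md G x m y) (hz : z ∉ m) :
    (∀ v ∈ m, cz v) := by
  have hx : Tl G x m := Tl.take h
  have hy : Tl G y m.reverse := Tl.take h.rev
  rcases T.tail hx h.ny hz with h1 | h1
  · rcases T.sxy.tail hy (by simpa using h.nx) (by simpa using hz) with h2 | h2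
    · intro v hv
      exact (T.dxy v (h2 v (by simpa using hv)) (h1 v hv)).elim
    · simpa using h2
  · exact h1

structure E2 (G : SimpleGraph V) (n : ℕ) (x y z : V) (cx cy cz : V → Prop) (a m b : List V) :
    Prop where
  l : L2 G n x y a m b
  za : z ∉ a
  zm : z ∉ m
  zb : z ∉ b
  hm : ∀ v ∈ m, cz v
  ha : (∀ v ∈ a, cy v) ∨ (∀ v ∈ a, cz v)
  hb : (∀ v ∈ b, cx v) ∨ (∀ v ∈ b, cz v)

theorem E2.symm {a m b} (h : E2 G n x y z cx cy cz a m b) :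
    E2 G n y x z cy cx cz b m.reverse a :=
  ⟨h.l.symm, h.zb, by simpa using h.zm, h.za, by simpa using h.hm, h.hb, h.ha⟩

theorem Tri.mk2 (T : Tri G n x y z cx cy cz) {a m b} (h : L2 G n x y a m b) (za : z ∉ a)
    (zm : z ∉ m) (zb : z ∉ b) : E2 G n x y z cx cy cz a m b :=
  ⟨h, za, zm, zb, T.mid h.hm zm, T.tail h.h1 h.y1 za, T.sxy.tail h.h2 h.x2 zb⟩

theorem Tri.dec2 (T : Tri G n x y z cx cy cz) {R} (h : Lg G n R) (hx : x ∈ R) (hy : y ∈ R)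
    (hz : z ∉ R) : ∃ a m b, E2 G n x y z cx cy cz a m b ∧
      ∀ v, v ∈ R ↔ v ∈ a ∨ v = x ∨ v ∈ m ∨ v = y ∨ v ∈ b := by
  obtain ⟨a, m, b, h1, h2⟩ := h.dec2 hx hy T.xy
  exact ⟨a, m, b, T.mk2 h1 (by grind) (by grind) (by grind), h2⟩

theorem Tri.no0 (T : Tri G n x y z cx cy cz) {S} (h : Lg G n S) (hx : x ∉ S) (hy : y ∉ S)
    (hz : z ∉ S) : False := by
  rcases T.single h.1 hx hy hz with h1 | h1 | h1
  · obtain ⟨v, h2, h3⟩ := T.gx.1 S h; grind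
  · obtain ⟨v, h2, h3⟩ := T.gy.1 S h; grind
  · obtain ⟨v, h2, h3⟩ := T.gz.1 S h; grind

theorem Tri.memx (T : Tri G n x y z cx cy cz) {S} (h : Lg G n S) (hx : x ∈ S) (hy : y ∉ S)
    (hz : z ∉ S) : ∀ v ∈ S, v = x ∨ cy v ∨ cz v := by
  obtain ⟨t1, t2, h1, h2⟩ := h.dec1 hx
  have a1 := T.tail h1.h1 (by grind) (by grind)
  have a2 := T.tail h1.h2 (by grind) (by grind)
  grind

/-- Case 1 -/
theorem Tri.case1 (T : Tri G n x y z cx cy cz) {P Q} (hP : Lg G n P) (hQ : Lg G n Q)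
    (xP : x ∈ P) (yP : y ∉ P) (zP : z ∉ P) (xQ : x ∉ Q) (yQ : y ∈ Q) (zQ : z ∉ Q) : False := by
  obtain ⟨v, h1, h2, h3⟩ := T.gz.2 P Q hP hQ xP yP yQ xQ
  have h4 := T.memx hP xP yP zP v h1
  have h5 := T.sxy.memx hQ yQ xQ zQ v h2
  have := T.dxy v
  grind

theorem Tri.join (T : Tri G n x y z cx cy cz) (c : Ctx G n) {a m b qy qm qz}
    (R : E2 G n x y z cx cy cz a m b) (Q : E2 G n y z x cy cz cx qy qm qz) (h : Dj a qz) :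
    a.length + m.length + qm.length + qz.length + 3 ≤ n := by
  obtain ⟨xy, xz, yz, dxy, dxz, dyz, -, -, -, -, -, -, -, -, -, -⟩ := T
  obtain ⟨rl, za, zm, zb, hm, ha, hb⟩ := R
  obtain ⟨ql, xqy, xqm, xqz, hqm, hqy, hqz⟩ := Q
  refine c.le3 rl.h1 rl.hm ql.hm ql.h2 rl.d1m ?_ h ?_ ?_ ql.dm2 rl.y1 za xqz ql.x2 xqm zm xz
  all_goals unfold Dj; grind

/-- replacing one tail -/
theorem L2.repl (c : Ctx G n) {a m b a'} (R : L2 G n x y a m b) (h : Tl G x a') (hy : y ∉ a')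
    (d1 : Dj a' m) (d2 : Dj a' b) : a'.length ≤ a.length := by
  have := c.le2 h R.hm R.h2 d1 d2 R.dm2 hy R.x2
  have := R.len
  omega

theorem Tri.ideal (T : Tri G n x y z cx cy cz) (c : Ctx G n) {px pm pz qy qm qz a m b}
    (P : E2 G n x z y cx cz cy px pm pz) (Q : E2 G n y z x cy cz cx qy qm qz)
    (R : E2 G n x y z cx cy cz a m b) (h1 : Dj px qy) (h2 : Dj a qz) (h3 : Dj pz b) : False := by
  have e1 := T.join c R Q h2
  have e2 := T.syz.join c P Q.symm h1
  have e3 := T.sxz.syz.join c P.symm R h3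
  have := P.l.len
  have := Q.l.len
  have := R.l.len
  simp at *
  omega

theorem Tri.combine (T : Tri G n x y z cx cy cz) (c : Ctx G n) {px pm pz qy qm qz a m b a' m' b' s t}
    (P : E2 G n x z y cx cz cy px pm pz) (Q : E2 G n y z x cy cz cx qy qm qz)
    (R : E2 G n x y z cx cy cz a m b) (R' : E2 G n x y z cx cy cz a' m' b')
    (hs : ∀ v ∈ s, ¬ cz v) (ht : ∀ v ∈ t, ¬ cz v)
    (h1 : Dj px qy) (h2 : Dj a s) (h3 : Dj b' t) :
    ∃ a m b, E2 G n x y z cx cy cz a m b ∧ Dj a s ∧ Dj b t := by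
  have dxy := T.dxy
  have dxz := T.dxz
  have dyz := T.dyz
  rcases R'.ha with ha' | ha'
  swap
  · exact ⟨a', m', b', R', by unfold Dj; grind, h3⟩
  rcases R.hb with hb | hb
  swap
  · exact ⟨a, m, b, R, h2, by unfold Dj; grind⟩
  have hm := R.hm
  have hm' := R'.hm
  have hl := R.l.len
  have hl' := R'.l.len
  rcases R.ha with ha | ha
  · have e1 := c.le2 R.l.h1 R'.l.hm R'.l.h2 (by unfold Dj; grind)
      (by have := R'.hb; unfold Dj; grind) R'.l.dm2 R.l.y1 R'.l.x2
    have e2 := c.le2 R'.l.h1 R.l.hm R.l.h2 (by unfold Dj; grind)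
      (by have := R.hb; unfold Dj; grind) R.l.dm2 R'.l.y1 R.l.x2
    exact ⟨a, m', b', T.mk2 ⟨R.l.h1, R'.l.hm, R'.l.h2, (by unfold Dj; grind),
      (by have := R'.hb; unfold Dj; grind), R'.l.dm2, R.l.y1, R'.l.x2, by omega⟩
      R.za R'.zm R'.zb, h2, h3⟩
  rcases R'.hb with hb' | hb'
  · have e1 := c.le2 R.l.h1 R.l.hm R'.l.h2 R.l.d1m
      (by have := R'.hb; unfold Dj; grind) (by unfold Dj; grind) R.l.y1 R'.l.x2
    have e2 := c.le2 R'.l.h1 R'.l.hm R.l.h2 (by unfold Dj; grind)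
      (by have := R.hb; unfold Dj; grind) (by unfold Dj; grind) R'.l.y1 R.l.x2
    exact ⟨a, m, b', T.mk2 ⟨R.l.h1, R.l.hm, R'.l.h2, R.l.d1m,
      (by have := R'.hb; unfold Dj; grind), (by unfold Dj; grind), R.l.y1, R'.l.x2, by omega⟩
      R.za R.zm R'.zb, h2, h3⟩
  exfalso
  rcases P.hb with hp | hp
  swap
  · exact T.ideal c P Q R h1 (by have := Q.hb; unfold Dj; grind) (by unfold Dj; grind)
  rcases Q.hb with hq | hq
  swap
  · exact T.ideal c P Q R' h1 (by unfold Dj; grind) (by unfold Dj; grind)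
  have e1 := T.join c R Q (by unfold Dj; grind)
  have e2 := T.sxy.join c R'.symm P (by unfold Dj; grind)
  have e3 := R.l.repl c R'.l.h1 R'.l.y1 (by unfold Dj; grind) (by unfold Dj; grind)
  have e4 := R'.l.symm.repl c R.l.h2 R.l.x2 (by unfold Dj; grind) (by unfold Dj; grind)
  have e5 := c.le1 R.l.h1 R'.l.h1 (by unfold Dj; grind)
  have e6 := c.le1 R.l.h2 R'.l.h2 (by unfold Dj; grind)
  have e7 := T.syz.join c P Q.symm h1
  have := P.l.len
  have := Q.l.len
  simp at *
  omega

/-- Case 3, all U -/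
theorem Tri.allU (T : Tri G n x y z cx cy cz) (c : Ctx G n)
    (hz : ∃ px pm pz qy qm qz, E2 G n x z y cx cz cy px pm pz ∧ E2 G n y z x cy cz cx qy qm qz ∧
      Dj px qy)
    (hy : ∃ a m b qy qm qz, E2 G n x y z cx cy cz a m b ∧ E2 G n y z x cy cz cx qy qm qz ∧
      Dj a qz)
    (hx : ∃ a m b px pm pz, E2 G n x y z cx cy cz a m b ∧ E2 G n x z y cx cz cy px pm pz ∧
      Dj b pz) : False := by
  obtain ⟨p1x, p1m, p1z, q1y, q1m, q1z, P1, Q1, h1⟩ := hz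
  obtain ⟨a2, m2, b2, q2y, q2m, q2z, R2, Q2, h2⟩ := hy
  obtain ⟨a3, m3, b3, p3x, p3m, p3z, R3, P3, h3⟩ := hx
  have dxy := T.dxy
  have dxz := T.dxz
  have dyz := T.dyz
  obtain ⟨a, m, b, R, r1, r2⟩ := T.combine c P1 Q1 R2 R3 (s := q2z) (t := p3z)
    (by have := Q2.hb; grind) (by have := P3.hb; grind) h1 h2 h3
  obtain ⟨px, pm, pz, P, s1, s2⟩ := T.syz.combine c R Q2.symm P1 P3 (s := q1y) (t := b)
    (by have := Q1.ha; grind) (by have := R.hb; grind) r1 h1 r2.symm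
  obtain ⟨qy, qm, qz, Q, t1, t2⟩ := T.rot.combine c R.symm P.symm Q1 Q2 (s := px) (t := a)
    (by have := P.ha; grind) (by have := R.ha; grind) s2.symm s1.symm r1.symm
  exact T.ideal c P Q R t1.symm t2.symm s2
end Gallai

namespace Gallai
variable {V : Type} {G : SimpleGraph V} {n : ℕ} {x y z : V} {cx cy cz : V → Prop}

def OutBad (G : SimpleGraph V) (n : ℕ) (x z : V) (A : V → Prop) : Prop :=
  ∃ σ : V → V, (∀ u v, A u → A v → G.Adj u v → σ u = σ v) ∧ (∀ v, A v → A (σ v)) ∧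
    ∀ k, ¬ Good G n x z (fun v => A v ∧ σ v = k)

theorem OutBad.symm {A} (h : OutBad G n x z A) : OutBad G n z x A := by
  obtain ⟨σ, h1, h2, h3⟩ := h
  exact ⟨σ, h1, h2, fun k hk => h3 k hk.symm⟩

def NoS (G : SimpleGraph V) (n : ℕ) (x y z : V) : Prop :=
  ∀ S, Lg G n S → x ∈ S → y ∉ S → z ∉ S → False

def NU (G : SimpleGraph V) (n : ℕ) (x y : V) (cz : V → Prop) : Prop :=
  ∀ P Q, Lg G n P → Lg G n Q → x ∈ P → y ∉ P → y ∈ Q → x ∉ Q → ∃ v, v ∈ P ∧ v ∈ Q ∧ cz v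

theorem NU.symm (h : NU G n x y cz) : NU G n y x cz := by
  intro P Q a b c d e f
  obtain ⟨v, h1, h2, h3⟩ := h Q P b a e f c d
  exact ⟨v, h2, h1, h3⟩

open Classical in
noncomputable def tau (A : V → Prop) (σ : V → V) (v : V) : Option V :=
  if A v then some (σ v) else none

theorem tau_some {A : V → Prop} {σ : V → V} {v k} : tau A σ v = some k ↔ A v ∧ σ v = k := by
  unfold tau; split_ifs <;> simp_all
theorem tau_none {A : V → Prop} {σ : V → V} {v} : tau A σ v = none ↔ ¬ A v := by
  unfold tau; split_ifs <;> simp_all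

theorem col_tau {A : V → Prop} {σ : V → V} 
    (hA : ∀ u v, A u → G.Adj u v → A v ∨ v = x ∨ v = z)
    (hσ : ∀ u v, A u → A v → G.Adj u v → σ u = σ v) : Col G x z (tau A σ) := by
  intro u v h1 h2 h3 h4 huv
  have a1 := hA u v
  have a2 := hA v u
  have a3 := huv.symm
  have a4 := hσ u v
  unfold tau; split_ifs <;> grind

theorem nmem_P1 {v : V} {t1 t2} (h1 : v ∉ t1) (h2 : v ≠ x) (h3 : v ∉ t2) : v ∉ P1 x t1 t2 := by
  rw [mem_P1]; rintro (h | h | h)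
  · exact h1 h
  · exact h2 h
  · exact h3 h

theorem Tri.lemE (T : Tri G n x y z cx cy cz) (c : Ctx G n) (hO : OutBad G n x z cy)
    (hi : NU G n x z cy) (hii : ∀ S, Lg G n S → x ∈ S ∨ z ∈ S) {qy qm qz}
    (Q0 : E2 G n y z x cy cz cx qy qm qz) (hqy : ∀ v ∈ qy, cz v) : False := by
  obtain ⟨σ, hσ, -, hbad⟩ := hO
  have hτ := col_tau (x := x) (z := z) T.ey hσ
  have hsome : ∀ v k, tau cy σ v = some k ↔ cy v ∧ σ v = k := fun v k => tau_some
  have hnone : ∀ v, tau cy σ v = none ↔ ¬ cy v := fun v => tau_none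
  have hcy : ∀ v, cy v → tau cy σ v = some (σ v) := fun v hv => tau_some.2 ⟨hv, rfl⟩
  generalize tau cy σ = τ at hτ hsome hnone hcy
  have dxy := T.dxy
  have dxz := T.dxz
  have dyz := T.dyz
  have ny := T.ny
  obtain ⟨P0, hP0, zP0⟩ := c.nog z
  have xP0 := (hii P0 hP0).resolve_right zP0
  have hQ0 := Q0.l.lg
  set Q := P2 y z qy qm qz with hQdef
  have hQm : ∀ v, v ∈ Q ↔ v ∈ qy ∨ v = y ∨ v ∈ qm ∨ v = z ∨ v ∈ qz := fun v => mem_P2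
  have zQ : z ∈ Q := by simp [hQm]
  have xQ : x ∉ Q := by
    rw [hQm]; have := Q0.za; have := Q0.zm; have := Q0.zb; have := T.xy; have := T.xz; tauto
  clear_value Q
  obtain ⟨v, v1, v2, v3⟩ := hi P0 Q hP0 hQ0 xP0 zP0 zQ xQ
  have hqz1 : v ∈ qz := by
    have := Q0.hm
    have := ny v v3
    grind
  have hqz : ∀ u ∈ qz, τ u = τ v := fun u hu =>
    hτ.mono Q0.l.h2.tail Q0.zb Q0.l.h2.nmem u v hu hqz1
  have hv := hcy v v3
  have key : ∀ P Q, Lg G n P → Lg G n Q → x ∈ P → z ∉ P → z ∈ Q → x ∉ Q →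
      ∃ u, u ∈ P ∧ u ∈ Q ∧ cy u ∧ σ u = σ v := by
    intro P Q' hP hQ' xP zP zQ' xQ'
    obtain ⟨u, u1, u2, u3⟩ := hi P Q hP hQ0 xP zP zQ xQ
    obtain ⟨w, w1, w2, w3, w4, w5⟩ := T.gy.2 P Q' hP hQ' xP zP zQ' xQ'
    obtain ⟨r, r1, r2, r3⟩ := hi P Q' hP hQ' xP zP zQ' xQ'
    have hu : u ∈ qz := by
      have := Q0.hm
      have := ny u u3
      grind
    have eu := hqz u hu
    have ew := (hnone w).2 w5
    have er := hcy r r3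
    have nr := (ny r r3)
    have nu := (ny u u3)
    obtain ⟨t1, t2, a1, a2, a3, a4, a5, a6⟩ := hτ.dec' (v := u) (w := w) hP xP zP u1 nu.1 w1 w3
      (by rw [eu, hv, ew]; simp)
    have : τ r = τ u := by
      rcases (a2 r).1 r1 with h | h | h
      · exact a5 r h
      · exact absurd h nr.1
      · have := a6 r h; rw [er, ew] at this; simp at this
    refine ⟨r, r1, r2, r3, ?_⟩
    rw [er, eu, hv] at this
    simpa using this
  have hS : ∃ S, Lg G n S ∧ ∀ u ∈ S, ¬ (cy u ∧ σ u = σ v) := by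
    by_contra hcon
    push Not at hcon
    exact hbad (σ v) ⟨fun S hS => by
      obtain ⟨u, h1, h2, h3⟩ := hcon S hS
      exact ⟨u, h1, h2, h3⟩, key⟩
  obtain ⟨S, hS, hSk⟩ := hS
  have hSk' : ∀ u ∈ S, τ u ≠ τ v := by
    intro u hu h
    rw [hv] at h
    exact hSk u hu ((hsome u _).1 h)
  have xS : x ∈ S := by
    by_contra hx
    have hz := (hii S hS).resolve_left hx
    obtain ⟨u, u1, u2, u3⟩ := key P0 S hP0 hS xP0 zP0 hz hx
    exact hSk u u2 u3
  have zS : z ∈ S := by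
    by_contra hz
    obtain ⟨u, u1, u2, u3⟩ := key S Q hS hQ0 xS hz zQ xQ
    exact hSk u u1 u3
  obtain ⟨sx, M, sz, s1, s2⟩ := hS.dec2 xS zS T.xz
  obtain ⟨w, w1, w2, w3, w4, w5⟩ := T.gy.2 P0 Q hP0 hQ0 xP0 zP0 zQ xQ
  have ew := (hnone w).2 w5
  obtain ⟨e, d', a1, a2, a3, a4, a5, a6⟩ := hτ.dec' (v := v) (w := w) hP0 xP0 zP0 v1 
    (ny v v3).1 w1 w3 (by rw [hv, ew]; simp)
  have hd' : ∀ u ∈ d', ¬ cy u := fun u hu => (hnone u).1 ((a6 u hu).trans ew)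
  have he : ∀ u ∈ e, cy u := fun u hu => ((hsome u (σ v)).1 ((a5 u hu).trans hv)).1
  have hqz' : ∀ u ∈ qz, cy u := fun u hu => ((hsome u (σ v)).1 ((hqz u hu).trans hv)).1
  have hqm := Q0.hm
  have l0 := Q0.l.len
  have ls := s1.len
  have lp := a1.len
  by_cases hyM : y ∈ M
  · obtain ⟨m1, m2, rfl⟩ := List.append_of_mem hyM
    obtain ⟨b1, b2, b3, b4, b5, b6⟩ := md_append.1 s1.hm
    have c1 := T.mid b1 b6
    have c2 := T.rot.mid b2 b4
    have ySx : y ∉ sx := by have := s1.d1m; unfold Dj at this; grind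
    have ySz : y ∉ sz := by have := s1.dm2; unfold Dj at this; grind
    have c3 := T.tail s1.h1 ySx s1.y1
    have c4 := T.sxz.tail s1.h2 ySz s1.x2
    have d1m := s1.d1m
    have dm2 := s1.dm2
    have f1 : Dj qy m2 := by unfold Dj; grind
    have f2 : Dj qy sz := by unfold Dj; grind
    have f3 : Dj m2 sz := by unfold Dj at *; grind
    have g1 := c.le2 Q0.l.h1 b2 s1.h2 f1 f2 f3 Q0.l.y1 ySz
    have g2 := c.le3 s1.h1 b1 Q0.l.hm Q0.l.h2 (by unfold Dj at *; grind)
      (by unfold Dj; grind) (by unfold Dj; grind) (by unfold Dj; grind) (by unfold Dj; grind)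
      Q0.l.dm2 ySx s1.y1 Q0.zb Q0.l.x2 Q0.zm b6 T.xz
    simp at ls
    have hL : L2 G n y z qy m2 sz := ⟨Q0.l.h1, b2, s1.h2, f1, f2, f3, Q0.l.y1, ySz, by omega⟩
    obtain ⟨u, u1, u2, u3⟩ := key P0 _ hP0 hL.lg xP0 zP0 (by simp)
      (by have := Q0.za; have := s1.x2; have := T.xy; have := T.xz; simp; tauto)
    have nu := (ny u u3.1)
    rw [mem_P2] at u2
    have : u ∈ S := by
      rw [s2]
      rcases u2 with h | h | h | h | h
      · exact (dyz u u3.1 (hqy u h)).elim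
      · exact absurd h nu.2.1
      · simp [h]
      · simp [h]
      · simp [h]
    exact hSk u this u3
  · have hM := T.syz.mid s1.hm hyM
    have hq' : Tl G z (qm.reverse ++ y :: qy) :=
      tl_append.2 ⟨Q0.l.hm.rev, Q0.l.h1, by have := Q0.l.d1m; unfold Dj at *; grind, Q0.l.y1⟩
    have zd : z ∉ d' := by grind
    have ze : z ∉ e := by grind
    have g1 := c.le2 a1.h2 s1.hm Q0.l.h2 (by unfold Dj; grind) (by unfold Dj; grind)
      (by unfold Dj; grind) zd Q0.zb
    have hyc : ¬ cy y := fun h => (ny y h).2.1 rfl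
    have hq'c : ∀ u ∈ qm.reverse ++ y :: qy, ¬ cy u := by
      intro u hu
      simp at hu
      rcases hu with h | h | h
      · exact fun h' => dxy u (hqm u h) h'
      · rw [h]; exact hyc
      · exact fun h' => dyz u h' (hqy u h)
    have hxq' : x ∉ qm.reverse ++ y :: qy := by
      have := T.xy; have := Q0.za; have := Q0.zm; simp; tauto
    have hlq : (qm.reverse ++ y :: qy).length = qm.length + qy.length + 1 := by simp; omega
    generalize qm.reverse ++ y :: qy = q' at hq' hq'c hxq' hlq
    have g2 := c.le2 a1.h1 s1.hm hq' (by unfold Dj; grind) (by unfold Dj; grind)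
      (by unfold Dj; grind) ze hxq'
    omega

/-- Case 2 -/
theorem Tri.case2 (T : Tri G n x y z cx cy cz) (c : Ctx G n) (hO : OutBad G n x z cy)
    {P0} (hP0 : Lg G n P0) (xP : x ∈ P0) (yP : y ∉ P0) (zP : z ∉ P0) : False := by
  have ns_y : NoS G n y x z := fun S hS a b d => T.case1 hP0 hS xP yP zP b a d
  have ns_z : NoS G n z x y := fun S hS a b d => T.syz.case1 hP0 hS xP zP yP b a d
  have dxy := T.dxy
  have dxz := T.dxz
  have dyz := T.dyz
  have hcy : ∀ P Q, Lg G n P → Lg G n Q → x ∈ P → y ∉ P → z ∉ P → y ∈ Q → x ∉ Q →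
      ∃ v, v ∈ P ∧ v ∈ Q ∧ cy v := by
    intro P Q hP hQ a1 a2 a3 a4 a5
    obtain ⟨v, v1, v2, v3, v4, v5⟩ := T.gz.2 P Q hP hQ a1 a2 a4 a5
    have := T.memx hP a1 a2 a3 v v1
    exact ⟨v, v1, v2, by tauto⟩
  have hcz : ∀ P Q, Lg G n P → Lg G n Q → x ∈ P → y ∉ P → z ∉ P → z ∈ Q → x ∉ Q →
      ∃ v, v ∈ P ∧ v ∈ Q ∧ cz v := by
    intro P Q hP hQ a1 a2 a3 a4 a5
    obtain ⟨v, v1, v2, v3, v4, v5⟩ := T.gy.2 P Q hP hQ a1 a3 a4 a5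
    have := T.memx hP a1 a2 a3 v v1
    exact ⟨v, v1, v2, by tauto⟩
  have hQtype : ∀ Q, Lg G n Q → x ∉ Q → y ∈ Q ∧ z ∈ Q := by
    intro Q hQ xQ
    have h1 := ns_y Q hQ
    have h2 := ns_z Q hQ
    have h3 := T.no0 hQ
    tauto
  have hQdec : ∀ Q, Lg G n Q → x ∉ Q → ∃ qy qm qz, E2 G n y z x cy cz cx qy qm qz ∧
      (∀ v, v ∈ Q ↔ v ∈ qy ∨ v = y ∨ v ∈ qm ∨ v = z ∨ v ∈ qz) ∧ (∀ v ∈ qy, cz v) ∧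
      (∀ v ∈ qz, cy v) := by
    intro Q hQ xQ
    obtain ⟨yQ, zQ⟩ := hQtype Q hQ xQ
    obtain ⟨qy, qm, qz, E, hm⟩ := T.rot.dec2 hQ yQ zQ xQ
    obtain ⟨v, v1, v2, v3⟩ := hcy P0 Q hP0 hQ xP yP zP yQ xQ
    obtain ⟨w, w1, w2, w3⟩ := hcz P0 Q hP0 hQ xP yP zP zQ xQ
    have nv := T.ny v v3
    have nw := T.nz w w3
    have e1 := E.ha
    have e2 := E.hb
    have e3 := E.hm
    rw [hm] at v2 w2
    refine ⟨qy, qm, qz, E, hm, ?_, ?_⟩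
    · rcases e1 with e1 | e1
      · exact e1
      · exfalso; grind
    · rcases e2 with e2 | e2
      · exact e2
      · exfalso; grind
  by_cases hi : NU G n x z cy
  · obtain ⟨Q, hQ, xQ⟩ := c.nog x
    obtain ⟨qy, qm, qz, E, -, h1, h2⟩ := hQdec Q hQ xQ
    refine T.lemE c hO hi ?_ E h1
    intro S hS
    by_contra hcon
    push Not at hcon
    exact hcon.2 (hQtype S hS hcon.1).2
  · unfold NU at hi
    push Not at hi
    obtain ⟨R, Q, hR, hQ, xR, zR, zQ, xQ, hnm⟩ := hi
    obtain ⟨yQ, -⟩ := hQtype Q hQ xQ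
    have yR : y ∈ R := by
      by_contra yR
      obtain ⟨v, v1, v2, v3⟩ := hcy R Q hR hQ xR yR zR yQ xQ
      exact hnm v v1 v2 v3
    obtain ⟨qy, qm, qz, E, hQm, hqy, hqz⟩ := hQdec Q hQ xQ
    obtain ⟨a, m, b, F, hRm⟩ := T.dec2 hR xR yR zR
    have g1 := T.join c F E (by unfold Dj; grind)
    have l1 := E.l.len
    have l2 := F.l.len
    have hb : ∀ v ∈ b, cz v := by
      rcases F.hb with hb | hb
      · exfalso
        have d : Dj qy b := by unfold Dj; grind
        have := c.le1 E.l.h1 F.l.h2 d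
        have hL : L1 G n y qy b := ⟨E.l.h1, F.l.h2, d, by omega⟩
        refine ns_y _ hL.lg (by simp) ?_ ?_
        · exact nmem_P1 E.za T.xy F.l.x2
        · exact nmem_P1 E.l.y1 T.yz.symm F.zb
      · exact hb
    have hm := F.hm
    obtain ⟨w, w1, w2, w3, w4⟩ := T.gz.1 R hR
    have hwa : w ∈ a := by grind
    have ha : ∀ v ∈ a, cy v := by
      rcases F.ha with h | h
      · exact h
      · exact (w4 (h w hwa)).elim
    obtain ⟨v, v1, v2, v3⟩ := hcy P0 Q hP0 hQ xP yP zP yQ xQ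
    obtain ⟨u, u1, u2, u3⟩ := hcz P0 Q hP0 hQ xP yP zP zQ xQ
    have nv := T.ny v v3
    have nu := T.nz u u3
    have hP : ∃ d e, L1 G n x d e ∧ (∀ v ∈ d, cz v) ∧ (∀ v ∈ e, cy v) ∧ y ∉ d ∧ y ∉ e ∧ z ∉ d := by
      obtain ⟨t1, t2, h1, h2⟩ := hP0.dec1 xP
      have b1 := T.tail h1.h1 (by grind) (by grind)
      have b2 := T.tail h1.h2 (by grind) (by grind)
      rw [h2] at v1 u1
      rcases b1 with b1 | b1
      · exact ⟨t2, t1, h1.symm, by grind, b1, by grind, by grind, by grind⟩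
      · exact ⟨t1, t2, h1, b1, by grind, by grind, by grind, by grind⟩
    obtain ⟨d, e, hL, hd, he, yd, ye, zd⟩ := hP
    have dj : Dj a d := by unfold Dj; grind
    have g2 := c.le1 F.l.h1 hL.h1 dj
    have g3 := c.le2 hL.h2 F.l.hm F.l.h2 (by unfold Dj; grind) (by unfold Dj; grind) F.l.dm2 
      ye F.l.x2
    have l3 := hL.len
    have hN : L1 G n x a d := ⟨F.l.h1, hL.h1, dj, by omega⟩
    obtain ⟨r, r1, r2, r3⟩ := hcy _ Q hN.lg hQ (by simp)
      (by rw [mem_P1]; have := F.l.y1; have := T.xy.symm; tauto)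
      (by rw [mem_P1]; have := F.za; have := T.xz.symm; tauto) yQ xQ
    rw [mem_P1] at r1
    have := (T.ny r r3).1
    rcases r1 with h | h | h
    · exact hnm r (by rw [hRm]; simp [h]) r2 r3
    · exact this h
    · exact dyz r r3 (hd r h)

/-- Case 3 propagation -/
theorem Tri.prop3 (T : Tri G n x y z cx cy cz) (c : Ctx G n) (ns_x : NoS G n x y z)
    (ns_y : NoS G n y x z) (ns_z : NoS G n z x y) (hz : NU G n x y cz) : NU G n x z cy := by
  have dxy := T.dxy
  have dxz := T.dxz
  have dyz := T.dyz
  intro R Q hR hQ xR zR zQ xQ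
  by_contra hnm
  have yR : y ∈ R := by by_contra h; exact ns_x R hR xR h zR
  have yQ : y ∈ Q := by by_contra h; exact ns_z Q hQ zQ xQ h
  obtain ⟨P, hP, yP⟩ := c.nog y
  have h3 := T.no0 hP
  have h1 := ns_x P hP
  have h2 := ns_z P hP
  have xP : x ∈ P := by tauto
  have zP : z ∈ P := by tauto
  clear h1 h2 h3
  obtain ⟨v, v1, v2, v3⟩ := hz P Q hP hQ xP yP yQ xQ
  obtain ⟨px, pm, pz, Pe, hPm⟩ := T.syz.dec2 hP xP zP yP
  obtain ⟨qy, qm, qz, Qe, hQm⟩ := T.rot.dec2 hQ yQ zQ xQ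
  obtain ⟨a, m, b, Re, hRm⟩ := T.dec2 hR xR yR zR
  have nv := T.nz v v3
  rw [hPm] at v1
  rw [hQm] at v2
  have hpx : ∀ v ∈ px, cz v := by
    have e1 := Pe.ha
    have e2 := Pe.hb
    have e3 := Pe.hm
    rcases e1 with e1 | e1
    · exact e1
    · grind
  have hqy : ∀ v ∈ qy, cz v := by
    have e1 := Qe.ha
    have e2 := Qe.hb
    have e3 := Qe.hm
    rcases e1 with e1 | e1
    · exact e1
    · grind
  have hm := Re.hm
  obtain ⟨w, w1, w2, w3, w4⟩ := T.gz.1 R hR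
  have hw : w ∈ a ∨ w ∈ b := by grind
  have lP := Pe.l.len
  have lQ := Qe.l.len
  have lR := Re.l.len
  have hab : (∀ v ∈ a, cy v) ∧ (∀ v ∈ b, cx v) := by
    rcases Re.ha with ha | ha <;> rcases Re.hb with hb | hb
    · exact ⟨ha, hb⟩
    · exfalso
      have g1 := T.sxz.syz.join c Pe.symm Re (by have := Pe.hb; unfold Dj; grind)
      have d : Dj a px := by unfold Dj; grind
      have g2 := c.le1 Re.l.h1 Pe.l.h1 d
      simp at g1
      have hL : L1 G n x a px := ⟨Re.l.h1, Pe.l.h1, d, by omega⟩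
      refine ns_x _ hL.lg (by simp) ?_ ?_
      · exact nmem_P1 Re.l.y1 T.xy.symm Pe.za
      · exact nmem_P1 Re.za T.xz.symm Pe.l.y1
    · exfalso
      have g1 := T.rot.sxy.join c Qe.symm Re.symm (by have := Qe.hb; unfold Dj; grind)
      have d : Dj b qy := by unfold Dj; grind
      have g2 := c.le1 Re.l.h2 Qe.l.h1 d
      simp at g1
      have hL : L1 G n y b qy := ⟨Re.l.h2, Qe.l.h1, d, by omega⟩
      refine ns_y _ hL.lg (by simp) ?_ ?_
      · exact nmem_P1 Re.l.x2 T.xy Qe.za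
      · exact nmem_P1 Re.zb T.yz.symm Qe.l.y1
    · exfalso; grind
  obtain ⟨ha, hb⟩ := hab
  have g1 := T.join c Re Qe (by have := Qe.hb; unfold Dj; grind)
  have d : Dj qy b := by unfold Dj; grind
  have g2 := c.le1 Qe.l.h1 Re.l.h2 d
  have hL : L1 G n y qy b := ⟨Qe.l.h1, Re.l.h2, d, by omega⟩
  refine ns_y _ hL.lg (by simp) ?_ ?_
  · exact nmem_P1 Qe.za T.xy Re.l.x2
  · exact nmem_P1 Qe.l.y1 T.yz.symm Re.zb

/-- extracting a non-meeting pair -/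
theorem Tri.ext (T : Tri G n x y z cx cy cz) (ns_x : NoS G n x y z) (ns_y : NoS G n y x z)
    (h : ¬ NU G n x y cz) :
    ∃ px pm pz qy qm qz, E2 G n x z y cx cz cy px pm pz ∧ E2 G n y z x cy cz cx qy qm qz ∧
      Dj px qy := by
  unfold NU at h
  push Not at h
  obtain ⟨P, Q, hP, hQ, xP, yP, yQ, xQ, hnm⟩ := h
  have zP : z ∈ P := by by_contra h; exact ns_x P hP xP yP h
  have zQ : z ∈ Q := by by_contra h; exact ns_y Q hQ yQ xQ h
  obtain ⟨px, pm, pz, Pe, hPm⟩ := T.syz.dec2 hP xP zP yP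
  obtain ⟨qy, qm, qz, Qe, hQm⟩ := T.rot.dec2 hQ yQ zQ xQ
  have dxy := T.dxy
  have dxz := T.dxz
  have dyz := T.dyz
  refine ⟨px, pm, pz, qy, qm, qz, Pe, Qe, ?_⟩
  have := Pe.ha
  have := Qe.ha
  intro v h1 h2
  have := hnm v (by simp [hPm, h1]) (by simp [hQm, h2])
  grind

theorem NoS.swap (h : NoS G n x y z) : NoS G n x z y := fun S a b c d => h S a b d c

/-- Case 3, with NUz -/
theorem Tri.case3z (T : Tri G n x y z cx cy cz) (c : Ctx G n) (hO : OutBad G n x z cy)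
    (ns_x : NoS G n x y z)
    (ns_y : NoS G n y x z) (ns_z : NoS G n z x y) (hz : NU G n x y cz) : False := by
  have hy := T.prop3 c ns_x ns_y ns_z hz
  obtain ⟨Q, hQ, xQ⟩ := c.nog x
  obtain ⟨P, hP, yP⟩ := c.nog y
  have hii : ∀ S, Lg G n S → x ∈ S ∨ z ∈ S := by
    intro S hS
    by_contra hcon
    rw [not_or] at hcon
    by_cases hy' : y ∈ S
    · exact ns_y S hS hy' hcon.1 hcon.2
    · exact T.no0 hS hcon.1 hy' hcon.2
  have zQ : z ∈ Q := (hii Q hQ).resolve_left xQ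
  have yQ : y ∈ Q := by by_contra h; exact ns_z Q hQ zQ xQ h
  have xP : x ∈ P := by
    by_contra h
    by_cases hz' : z ∈ P
    · exact ns_z P hP hz' h yP
    · exact T.no0 hP h yP hz'
  obtain ⟨v, v1, v2, v3⟩ := hz P Q hP hQ xP yP yQ xQ
  obtain ⟨qy, qm, qz, Qe, hQm⟩ := T.rot.dec2 hQ yQ zQ xQ
  refine T.lemE c hO hy hii Qe ?_
  have nv := T.nz v v3
  rw [hQm] at v2
  have dxy := T.dxy
  have dxz := T.dxz
  have dyz := T.dyz
  have e1 := Qe.ha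
  have e2 := Qe.hb
  have e3 := Qe.hm
  rcases e1 with e1 | e1
  · exact e1
  · clear * - v2 nv e1 e2 e3 v3 dxy dxz dyz
    grind

/-- The triangle argument. -/
theorem Tri.false (T : Tri G n x y z cx cy cz) (c : Ctx G n) (hy : OutBad G n x z cy)
    (hx : OutBad G n y z cx) : False := by
  have ns_x : NoS G n x y z := fun S hS a b d => T.case2 c hy hS a b d
  have ns_y : NoS G n y x z := fun S hS a b d => T.sxy.case2 c hx hS a b d
  have ns_z : NoS G n z x y := fun S hS a b d => T.sxz.case2 c hy.symm hS a d b
  by_cases nz : NU G n x y cz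
  · exact T.case3z c hy ns_x ns_y ns_z nz
  by_cases ny : NU G n x z cy
  · exact T.case3z c hy ns_x ns_y ns_z (T.syz.prop3 c ns_x.swap ns_z ns_y ny)
  by_cases nx : NU G n y z cx
  · exact T.case3z c hy ns_x ns_y ns_z
      (T.rot.prop3 c ns_y.swap ns_z.swap ns_x nx).symm
  refine T.allU c (T.ext ns_x ns_y nz) ?_ ?_
  · obtain ⟨px, pm, pz, qy, qm, qz, h1, h2, h3⟩ := T.syz.ext ns_x.swap ns_z ny
    exact ⟨_, _, _, _, _, _, h1, h2.symm, h3⟩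
  · obtain ⟨px, pm, pz, qy, qm, qz, h1, h2, h3⟩ := T.rot.ext ns_y.swap ns_z.swap nx
    exact ⟨_, _, _, _, _, _, h1.symm, h2.symm, h3⟩
end Gallai

namespace Gallai
variable {V : Type} {G : SimpleGraph V} {n : ℕ}

inductive Br (T : SimpleGraph V) : V → V → (V → Prop) → Prop
  | empty {x y : V} {C : V → Prop} : (∀ v, ¬ C v) → Br T x y C
  | union {x y : V} {C1 C2 C : V → Prop} : Br T x y C1 → Br T x y C2 →
      (∀ v, C v ↔ C1 v ∨ C2 v) → (∀ v, C1 v → ¬ C2 v) →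
      (∀ u v, C1 u → C2 v → ¬ T.Adj u v) → Br T x y C
  | apex {x y z : V} {A B C : V → Prop} : Br T x z A → Br T y z B → z ≠ x → z ≠ y →
      ¬ A z → ¬ B z → (∀ v, C v ↔ v = z ∨ A v ∨ B v) → (∀ v, A v → ¬ B v) →
      (∀ u v, A u → B v → ¬ T.Adj u v) → (∀ u, A u → ¬ T.Adj u y) → (∀ u, B u → ¬ T.Adj u x) →
      Br T x y C

theorem good_out (c : Ctx G n) {x z : V} {A : V → Prop} (hxz : x ≠ z)
    (hA : ∀ u v, A u → G.Adj u v → A v ∨ v = x ∨ v = z) (hO : OutBad G n x z A) :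
    Good G n x z (fun v => v ≠ x ∧ v ≠ z ∧ ¬ A v) := by
  obtain ⟨σ, h1, h2, h3⟩ := hO
  obtain ⟨k, hk⟩ := c.thm1 hxz (col_tau hA h1)
  cases k with
  | none => exact hk.congr fun v ⟨a, b, d⟩ => ⟨a, b, tau_none.1 d⟩
  | some k => exact (h3 k (hk.congr fun v ⟨_, _, d⟩ => tau_some.1 d)).elim

theorem Br.outBad {T : SimpleGraph V} (hGT : ∀ u v, G.Adj u v → T.Adj u v) (c : Ctx G n) {x y : V}
    {C : V → Prop}
    (h : Br T x y C) : x ≠ y → ¬ C x → ¬ C y →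
    (∀ u v, C u → G.Adj u v → C v ∨ v = x ∨ v = y) → OutBad G n x y C := by
  classical
  have hne : ∀ {x y : V} {C : V → Prop}, Good G n x y C → ∃ v, C v := by
    intro x y C h
    obtain ⟨P, hP, -⟩ := c.nog x
    obtain ⟨v, -, hv⟩ := h.1 P hP
    exact ⟨v, hv⟩
  induction h with
  | empty h => 
    intro _ _ _ _
    refine ⟨id, fun u _ hu => (h u hu).elim, fun v hv => hv, fun k hk => ?_⟩
    obtain ⟨v, hv⟩ := hne hk
    exact h v hv.1
  | @union x y C1 C2 C _ _ hC hd he ih1 ih2 =>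
    intro hxy hx hy hcl
    have k1 : ∀ u v, C1 u → G.Adj u v → C1 v ∨ v = x ∨ v = y := by
      intro u v hu huv
      rcases hcl u v ((hC u).2 (.inl hu)) huv with h | h
      · rcases (hC v).1 h with h | h
        · exact .inl h
        · exact (he u v hu h (hGT _ _ huv)).elim
      · exact .inr h
    have k2 : ∀ u v, C2 u → G.Adj u v → C2 v ∨ v = x ∨ v = y := by
      intro u v hu huv
      rcases hcl u v ((hC u).2 (.inr hu)) huv with h | h
      · rcases (hC v).1 h with h | h
        · exact (he v u h hu (hGT _ _ huv.symm)).elim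
        · exact .inl h
      · exact .inr h
    rw [hC, not_or] at hx hy
    obtain ⟨s1, a1, b1, d1⟩ := ih1 hxy hx.1 hy.1 k1
    obtain ⟨s2, a2, b2, d2⟩ := ih2 hxy hx.2 hy.2 k2
    refine ⟨fun v => if C1 v then s1 v else s2 v, ?_, ?_, ?_⟩
    · intro u v hu hv huv
      have := hGT _ _ huv
      rw [hC] at hu hv
      rcases hu with hu | hu <;> rcases hv with hv | hv
      · simp [hu, hv, a1 u v hu hv huv]
      · exact (he u v hu hv this).elim
      · exact (he v u hv hu this.symm).elim
      · have e1 : ¬ C1 u := fun h => hd u h hu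
        have e2 : ¬ C1 v := fun h => hd v h hv
        simp [e1, e2, a2 u v hu hv huv]
    · intro v hv
      rw [hC] at hv ⊢
      by_cases h : C1 v
      · simp [h, b1 v h]
      · simp [h, b2 v (hv.resolve_left h)]
    · intro k hk
      by_cases h : C1 k
      · refine d1 k (hk.congr ?_)
        rintro v ⟨hv, e⟩
        by_cases h' : C1 v
        · simp [h'] at e; exact ⟨h', e⟩
        · simp [h'] at e
          have := b2 v (((hC v).1 hv).resolve_left h')
          rw [e] at this
          exact (hd k h this).elim
      · refine d2 k (hk.congr ?_)
        rintro v ⟨hv, e⟩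
        by_cases h' : C1 v
        · simp [h'] at e
          have := b1 v h'
          rw [e] at this
          exact (h this).elim
        · simp [h'] at e
          exact ⟨((hC v).1 hv).resolve_left h', e⟩
  | @apex x y z A B C _ _ zx zy nA nB hC hd he heA heB ih1 ih2 =>
    intro hxy hx hy hcl
    have hx' := hx
    have hy' := hy
    rw [hC, not_or, not_or] at hx hy
    have ey : ∀ u v, A u → G.Adj u v → A v ∨ v = x ∨ v = z := by
      intro u v hu huv
      have h1 := hcl u v ((hC u).2 (.inr (.inl hu))) huv
      have h2 := he u v hu
      have h3 := heA u hu
      have h4 := hGT _ _ huv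
      rw [hC] at h1
      grind
    have ex : ∀ u v, B u → G.Adj u v → B v ∨ v = y ∨ v = z := by
      intro u v hu huv
      have h1 := hcl u v ((hC u).2 (.inr (.inr hu))) huv
      have h2 := he v u
      have h3 := heB u hu
      have h4 := hGT _ _ huv
      have h5 := h4.symm
      rw [hC] at h1
      grind
    have o1 := ih1 zx.symm hx.2.1 nA ey
    have o2 := ih2 zy.symm hy.2.2 nB ex
    refine ⟨fun _ => z, fun _ _ _ _ _ => rfl, fun v _ => (hC z).2 (.inl rfl), fun k hk => ?_⟩
    have T : Tri G n x y z B A (fun v => ¬ C v ∧ v ≠ x ∧ v ≠ y) := by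
      refine ⟨hxy, zx.symm, zy.symm, fun v a b => hd v b a, ?_, ?_, ?_, ?_, ?_, ?_, ex, ey, ?_, 
        good_out c zy.symm ex o2, good_out c zx.symm ey o1, ?_⟩
      · exact fun v a b => b.1 ((hC v).2 (.inr (.inr a)))
      · exact fun v a b => b.1 ((hC v).2 (.inr (.inl a)))
      · exact fun v a => ⟨fun e => hx.2.2 (e ▸ a), fun e => hy.2.2 (e ▸ a), fun e => nB (e ▸ a)⟩
      · exact fun v a => ⟨fun e => hx.2.1 (e ▸ a), fun e => hy.2.1 (e ▸ a), fun e => nA (e ▸ a)⟩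
      · exact fun v a => ⟨a.2.1, a.2.2, fun e => a.1 ((hC v).2 (.inl e))⟩
      · intro v; have := hC v; tauto
      · intro u v hu huv
        have := hcl v u
        have h := huv.symm
        tauto
      · refine hk.congr ?_
        rintro v ⟨hv, -⟩
        exact ⟨fun e => hx' (e ▸ hv), fun e => hy' (e ▸ hv), fun h => h.1 hv⟩
    exact T.false c o1 o2

theorem Br.root {T : SimpleGraph V} (hGT : ∀ u v, G.Adj u v → T.Adj u v) (c : Ctx G n) {x y : V}
    (hxy : x ≠ y) (h : Br T x y (fun v => v ≠ x ∧ v ≠ y)) : False := by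
  obtain ⟨σ, h1, h2, h3⟩ := h.outBad hGT c hxy (by simp) (by simp) (by intro u v _ _; tauto)
  obtain ⟨k, hk⟩ := c.thm1 (τ := σ) hxy (fun u v a b d e f => h1 u v ⟨a, b⟩ ⟨d, e⟩ f)
  exact h3 k (hk.congr fun v ⟨a, b, d⟩ => ⟨⟨a, b⟩, d⟩)

end Gallai

namespace Gallai
variable {V : Type}

def Lf (p : Prop) (C : V → Prop) : Option V → Prop
  | none => p
  | some v => C v

@[simp] theorem Lf_none {p : Prop} {C : V → Prop} : Lf p C none ↔ p := Iff.rfl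
@[simp] theorem Lf_some {p : Prop} {C : V → Prop} {v} : Lf p C (some v) ↔ C v := Iff.rfl

theorem adj_ss {T : SimpleGraph V} {a b u v : V} :
    (T.addLink2 a b).Adj (some u) (some v) ↔ T.Adj u v := by
  simp only [SimpleGraph.addLink2, SimpleGraph.fromRel_adj]
  constructor
  · rintro ⟨h1, (⟨u', v', h2, h3, h4⟩ | h) | (⟨u', v', h2, h3, h4⟩ | h)⟩
    · simp at h2 h3; subst h2 h3; exact h4
    · simp at h
    · simp at h2 h3; subst h2 h3; exact h4.symm
    · simp at h
  · intro h
    exact ⟨by simpa using h.ne, .inl (.inl ⟨u, v, rfl, rfl, h⟩)⟩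

theorem adj_ns {T : SimpleGraph V} {a b v : V} :
    (T.addLink2 a b).Adj none (some v) ↔ v = a ∨ v = b := by
  simp [SimpleGraph.addLink2, SimpleGraph.fromRel_adj]

theorem adj_sn {T : SimpleGraph V} {a b v : V} :
    (T.addLink2 a b).Adj (some v) none ↔ v = a ∨ v = b := by
  rw [SimpleGraph.adj_comm, adj_ns]

theorem adj_nn {T : SimpleGraph V} {a b : V} :
    ¬ (T.addLink2 a b).Adj none none := fun h => h.ne rfl

theorem Br.lift {T : SimpleGraph V} {a b x y : V} {C : V → Prop} (h : Br T x y C) :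
    Br (T.addLink2 a b) (some x) (some y) (Lf False C) := by
  induction h with
  | empty h => exact .empty (by rintro (_ | v) <;> simp [h])
  | union _ _ hC hd he ih1 ih2 =>
    refine .union ih1 ih2 ?_ ?_ ?_
    · rintro (_ | v) <;> simp [hC]
    · rintro (_ | v) <;> simp; exact hd v
    · rintro (_ | u) (_ | v) <;> simp [adj_ss]; exact he u v
  | apex _ _ zx zy nA nB hC hd he heA heB ih1 ih2 =>
    refine .apex ih1 ih2 (by simpa using zx) (by simpa using zy) nA nB ?_ ?_ ?_ ?_ ?_
    · rintro (_ | v) <;> simp [hC]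
    · rintro (_ | v) <;> simp; exact hd v
    · rintro (_ | u) (_ | v) <;> simp [adj_ss]; exact he u v
    · rintro (_ | u) <;> simp [adj_ss]; exact heA u
    · rintro (_ | u) <;> simp [adj_ss]; exact heB u

theorem Br.top {T : SimpleGraph V} {a b x y : V} {C : V → Prop} (h : Br T x y C) 
    (hx : ¬ C x) (hy : ¬ C y) (ha : a = x ∨ a = y) (hb : b = x ∨ b = y) :
    Br (T.addLink2 a b) (some x) (some y) (Lf True C) := by
  have k : Br (T.addLink2 a b) (some x) (some y) (fun v => v = none) :=
    .apex (z := none) (A := fun _ => False) (B := fun _ => False) (.empty (by simp)) 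
      (.empty (by simp)) (by simp) (by simp) (by simp) (by simp) (by simp) (by simp) (by simp)
      (by simp) (by simp)
  refine .union h.lift k ?_ ?_ ?_
  · rintro (_ | v) <;> simp
  · rintro (_ | v) <;> simp
  · rintro (_ | u) (_ | v) <;> simp [adj_sn]
    intro hu
    have : u ≠ x := fun e => hx (e ▸ hu)
    have : u ≠ y := fun e => hy (e ▸ hu)
    grind

theorem Br.insert {T : SimpleGraph V} {a b x y : V} {C : V → Prop} (h : Br T x y C) :
    ¬ C x → ¬ C y → x ≠ y → T.Adj a b → (C a ∨ a = x ∨ a = y) → (C b ∨ b = x ∨ b = y) →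
    Br (T.addLink2 a b) (some x) (some y) (Lf True C) := by
  induction h with
  | empty h => 
    intro hx hy hxy hab ha hb
    exact (Br.empty h).top hx hy (ha.resolve_left (h a)) (hb.resolve_left (h b))
  | @union x y C1 C2 C h1 h2 hC hd he ih1 ih2 =>
    intro hx hy hxy hab ha hb
    have ba := hab.symm
    by_cases htop : (a = x ∨ a = y) ∧ (b = x ∨ b = y)
    · exact (Br.union h1 h2 hC hd he).top hx hy htop.1 htop.2
    have hx1 : ¬ C1 x := fun h => hx ((hC x).2 (.inl h))
    have hx2 : ¬ C2 x := fun h => hx ((hC x).2 (.inr h))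
    have hy1 : ¬ C1 y := fun h => hy ((hC y).2 (.inl h))
    have hy2 : ¬ C2 y := fun h => hy ((hC y).2 (.inr h))
    have key : ((C1 a ∨ a = x ∨ a = y) ∧ (C1 b ∨ b = x ∨ b = y)) ∨
        ((C2 a ∨ a = x ∨ a = y) ∧ (C2 b ∨ b = x ∨ b = y)) := by
      rw [hC] at ha hb
      rcases ha with (ha | ha) | ha <;> rcases hb with (hb | hb) | hb
      · exact .inl ⟨.inl ha, .inl hb⟩
      · exact (he a b ha hb hab).elim
      · exact .inl ⟨.inl ha, .inr hb⟩
      · exact (he b a hb ha ba).elim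
      · exact .inr ⟨.inl ha, .inl hb⟩
      · exact .inr ⟨.inl ha, .inr hb⟩
      · exact .inl ⟨.inr ha, .inl hb⟩
      · exact .inr ⟨.inr ha, .inl hb⟩
      · exact .inl ⟨.inr ha, .inr hb⟩
    rcases key with ⟨ka, kb⟩ | ⟨ka, kb⟩
    · refine .union (ih1 hx1 hy1 hxy hab ka kb) h2.lift ?_ ?_ ?_
      · rintro (_ | v) <;> simp [hC]
      · rintro (_ | v) <;> simp; exact hd v
      · rintro (_ | u) (_ | v) <;> simp [adj_ss, adj_ns]
        · intro hv; have := hd v; grind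
        · exact he u v
    · refine .union h1.lift (ih2 hx2 hy2 hxy hab ka kb) ?_ ?_ ?_
      · rintro (_ | v) <;> simp [hC]
      · rintro (_ | v) <;> simp; exact hd v
      · rintro (_ | u) (_ | v) <;> simp [adj_ss, adj_sn]
        · intro hv; have := hd u; grind
        · exact he u v
  | @apex x y z A B C h1 h2 zx zy nA nB hC hd he heA heB ih1 ih2 =>
    intro hx hy hxy hab ha hb
    have ba := hab.symm
    by_cases htop : (a = x ∨ a = y) ∧ (b = x ∨ b = y)
    · exact (Br.apex h1 h2 zx zy nA nB hC hd he heA heB).top hx hy htop.1 htop.2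
    have hx1 : ¬ A x := fun h => hx ((hC x).2 (.inr (.inl h)))
    have hx2 : ¬ B x := fun h => hx ((hC x).2 (.inr (.inr h)))
    have hy1 : ¬ A y := fun h => hy ((hC y).2 (.inr (.inl h)))
    have hy2 : ¬ B y := fun h => hy ((hC y).2 (.inr (.inr h)))
    have nab := hab.ne
    have key : ((A a ∨ a = x ∨ a = z) ∧ (A b ∨ b = x ∨ b = z)) ∨
        ((B a ∨ a = y ∨ a = z) ∧ (B b ∨ b = y ∨ b = z)) := by
      rw [hC] at ha hb
      rcases ha with (ha | ha | ha) | ha | ha <;> rcases hb with (hb | hb | hb) | hb | hb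
      · exact (nab (ha.trans hb.symm)).elim
      · exact .inl ⟨.inr (.inr ha), .inl hb⟩
      · exact .inr ⟨.inr (.inr ha), .inl hb⟩
      · exact .inl ⟨.inr (.inr ha), .inr (.inl hb)⟩
      · exact .inr ⟨.inr (.inr ha), .inr (.inl hb)⟩
      · exact .inl ⟨.inl ha, .inr (.inr hb)⟩
      · exact .inl ⟨.inl ha, .inl hb⟩
      · exact (he a b ha hb hab).elim
      · exact .inl ⟨.inl ha, .inr (.inl hb)⟩
      · exact (heA a ha (hb ▸ hab)).elim
      · exact .inr ⟨.inl ha, .inr (.inr hb)⟩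
      · exact (he b a hb ha ba).elim
      · exact .inr ⟨.inl ha, .inl hb⟩
      · exact (heB a ha (hb ▸ hab)).elim
      · exact .inr ⟨.inl ha, .inr (.inl hb)⟩
      · exact .inl ⟨.inr (.inl ha), .inr (.inr hb)⟩
      · exact .inl ⟨.inr (.inl ha), .inl hb⟩
      · exact (heB b hb (ha ▸ ba)).elim
      · exact (htop ⟨.inl ha, .inl hb⟩).elim
      · exact (htop ⟨.inl ha, .inr hb⟩).elim
      · exact .inr ⟨.inr (.inl ha), .inr (.inr hb)⟩
      · exact (heA b hb (ha ▸ ba)).elim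
      · exact .inr ⟨.inr (.inl ha), .inl hb⟩
      · exact (htop ⟨.inr ha, .inl hb⟩).elim
      · exact (htop ⟨.inr ha, .inr hb⟩).elim
    rcases key with ⟨ka, kb⟩ | ⟨ka, kb⟩
    · refine .apex (ih1 hx1 nA zx.symm hab ka kb) h2.lift (by simpa using zx) (by simpa using zy)
        nA nB ?_ ?_ ?_ ?_ ?_
      · rintro (_ | v) <;> simp [hC]
      · rintro (_ | v) <;> simp; exact hd v
      · rintro (_ | u) (_ | v) <;> simp [adj_ss, adj_ns]
        · intro hv; have := hd v; grind
        · exact he u v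
      · rintro (_ | u) <;> simp [adj_ss, adj_ns]
        · grind
        · exact heA u
      · rintro (_ | u) <;> simp [adj_ss, adj_ns]; exact heB u
    · refine .apex h1.lift (ih2 hy2 nB zy.symm hab ka kb) (by simpa using zx) (by simpa using zy)
        nA nB ?_ ?_ ?_ ?_ ?_
      · rintro (_ | v) <;> simp [hC]
      · rintro (_ | v) <;> simp; exact hd v
      · rintro (_ | u) (_ | v) <;> simp [adj_ss, adj_sn]
        · intro hv; have := hd u; grind
        · exact he u v
      · rintro (_ | u) <;> simp [adj_ss, adj_ns]; exact heA u
      · rintro (_ | u) <;> simp [adj_ss, adj_ns]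
        · grind
        · exact heB u

theorem Br.congr {T : SimpleGraph V} {x y : V} {C D : V → Prop} (h : Br T x y C)
    (hCD : ∀ v, C v ↔ D v) : Br T x y D := by
  have : C = D := funext fun v => propext (hCD v)
  exact this ▸ h

theorem skel_br {W : Type} {H : SimpleGraph W} (h : IsTwoTreeSkel W H) :
    ∃ x y : W, x ≠ y ∧ Br H x y (fun v => v ≠ x ∧ v ≠ y) := by
  induction h with
  | base =>
    refine ⟨⟨0⟩, ⟨1⟩, by simp, .empty ?_⟩
    rintro ⟨v⟩
    fin_cases v <;> simp
  | @extend W G a b _ hab ih =>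
    obtain ⟨x, y, hxy, h⟩ := ih
    refine ⟨some x, some y, by simpa using hxy, ?_⟩
    refine (h.insert (by simp) (by simp) hxy hab (by tauto) (by tauto)).congr ?_
    rintro (_ | v) <;> simp

end Gallai

namespace Gallai
variable {V W : Type} {G : SimpleGraph V} {n : ℕ}

theorem pth_map {f : V ↪ W} {l : List V} : Pth (G.map f) (l.map f) ↔ Pth G l := by
  unfold Pth
  rw [List.isChain_map, List.nodup_map_iff f.injective]
  simp [SimpleGraph.map_adj_apply]

theorem chain_range {f : V ↪ W} {l : List W} (h : l.IsChain (G.map f).Adj) (hl : 2 ≤ l.length) :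
    ∃ l0 : List V, l0.map f = l := by
  induction l with
  | nil => simp at hl
  | cons a t ih =>
    cases t with
    | nil => simp at hl
    | cons b t =>
      rw [List.isChain_cons_cons] at h
      obtain ⟨u, v, huv, hu, hv⟩ := (SimpleGraph.map_adj f G a b).1 h.1
      cases t with
      | nil => exact ⟨[u, v], by simp [hu, hv]⟩
      | cons c t =>
        obtain ⟨l0, e⟩ := ih h.2 (by simp)
        exact ⟨u :: l0, by simp [hu, e]⟩

theorem pull {f : V ↪ W} {l : List W} (h : Pth (G.map f) l) (hl : 2 ≤ l.length) :
    ∃ l0 : List V, l0.map f = l ∧ Pth G l0 := by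
  obtain ⟨l0, rfl⟩ := chain_range h.1 hl
  exact ⟨l0, rfl, pth_map.1 h⟩

theorem connect (P Q : List V) (l : List V) : ∀ (x : V) (m : List V), Pth G (x :: (m ++ l)) →
    x ∈ P → Dj m P → Dj m Q → (∃ q ∈ l, q ∈ Q) → Dj P Q →
    ∃ x y m, x ∈ P ∧ y ∈ Q ∧ Md G x m y ∧ Dj m P ∧ Dj m Q := by
  induction l with
  | nil => intro x m _ _ _ _ ⟨q, h, _⟩; simp at h
  | cons b t ih =>
    intro x m hp hx hP hQ ⟨q, hq, hqQ⟩ hd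
    have hp' := tl_append.1 hp
    by_cases bQ : b ∈ Q
    · exact ⟨x, b, m, hx, bQ, hp'.1, hP, hQ⟩
    have hq' : ∃ q ∈ t, q ∈ Q := by
      refine ⟨q, ?_, hqQ⟩
      rcases List.mem_cons.1 hq with rfl | h
      · exact (bQ hqQ).elim
      · exact h
    by_cases bP : b ∈ P
    · exact ih b [] hp'.2.1 bP (by simp [Dj]) (by simp [Dj]) hq' hd
    · refine ih x (m ++ [b]) (by simpa using hp) hx ?_ ?_ hq' hd
      · unfold Dj at *; grind
      · unfold Dj at *; grind

theorem inter_of_conn (hconn : G.Connected) (hmax : ∀ l, Pth G l → l.length ≤ n) (hn : 1 ≤ n)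
    (P Q : List V) (hP : Lg G n P) (hQ : Lg G n Q) : ∃ v, v ∈ P ∧ v ∈ Q := by
  classical
  by_contra hcon
  have hd : Dj P Q := fun v h1 h2 => hcon ⟨v, h1, h2⟩
  obtain ⟨p, hp⟩ : ∃ p, p ∈ P := List.exists_mem_of_length_pos (by have := hP.2; omega)
  obtain ⟨q, hq⟩ : ∃ q, q ∈ Q := List.exists_mem_of_length_pos (by have := hQ.2; omega)
  obtain ⟨w⟩ := hconn.preconnected p q
  have hw := w.bypass_isPath
  have hpth : Pth G w.bypass.support := ⟨w.bypass.isChain_adj_support, hw.support_nodup⟩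
  have hqm := w.bypass.end_mem_support
  rw [SimpleGraph.Walk.support_eq_cons] at hpth hqm
  have hq2 : q ∈ w.bypass.support.tail := by
    rcases List.mem_cons.1 hqm with e | h
    · exact (hd p hp (e ▸ hq)).elim
    · exact h
  obtain ⟨x, y, m, hx, hy, hm, mP, mQ⟩ := connect P Q _ p [] hpth hp (by simp [Dj]) (by simp [Dj])
    ⟨q, hq2, hq⟩ hd
  obtain ⟨t1, t2, hL, hPm⟩ := hP.dec1 hx
  obtain ⟨s1, s2, hM, hQm⟩ := hQ.dec1 hy
  have g1 := hmax _ (pth_P2.2 ⟨hL.h1, hm, hM.h1, by unfold Dj at *; grind, by unfold Dj at *; grind,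
    by unfold Dj at *; grind, by unfold Dj at *; grind, by unfold Dj at *; grind⟩)
  have g2 := hmax _ (pth_P2.2 ⟨hL.h2, hm, hM.h2, by unfold Dj at *; grind, by unfold Dj at *; grind,
    by unfold Dj at *; grind, by unfold Dj at *; grind, by unfold Dj at *; grind⟩)
  have := hL.len
  have := hM.len
  simp at g1 g2
  omega

theorem exists_max [Fintype V] (hne : Nonempty V) :
    ∃ n, 1 ≤ n ∧ (∀ l, Pth G l → l.length ≤ n) ∧ ∃ l, Lg G n l := by
  classical
  obtain ⟨v⟩ := hne
  have hb : ∀ l, Pth G l → l.length ≤ Fintype.card V := fun l h => h.2.length_le_card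
  let p : ℕ → Prop := fun k => ∃ l, Pth G l ∧ l.length = k
  have h1 : p 1 := ⟨[v], ⟨by simp, by simp⟩, rfl⟩
  have hc : 1 ≤ Fintype.card V := hb [v] ⟨by simp, by simp⟩
  refine ⟨Nat.findGreatest p (Fintype.card V), Nat.le_findGreatest hc h1, ?_, ?_⟩
  · intro l hl
    exact Nat.le_findGreatest (hb l hl) ⟨l, hl, rfl⟩
  · exact Nat.findGreatest_spec hc h1

theorem longest_lg (hmax : ∀ l, Pth G l → l.length ≤ n) (hn : 1 ≤ n) {l} (hl : Lg G n l) {a b : V}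
    {p : G.Walk a b} (h : IsLongestPath G p) : Lg G n p.support := by
  have hp : Pth G p.support := ⟨p.isChain_adj_support, h.1.support_nodup⟩
  refine ⟨hp, ?_⟩
  have hne : l ≠ [] := by rintro rfl; have := hl.2; simp at this; omega
  have hq := h.2 _ _ (SimpleGraph.Walk.ofSupport l hne hl.1.1) (by
    rw [SimpleGraph.Walk.isPath_def, SimpleGraph.Walk.support_ofSupport]; exact hl.1.2)
  rw [SimpleGraph.Walk.length_ofSupport] at hq
  have h1 := hmax _ hp
  have h2 := hl.2
  rw [SimpleGraph.Walk.length_support] at h1 ⊢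
  omega

theorem main [Fintype V] (hconn : G.Connected) (hsp : IsSeriesParallel G) :
    ∃ v : V, ∀ (a b : V) (p : G.Walk a b), IsLongestPath G p → v ∈ p.support := by
  by_contra hcon
  obtain ⟨n, hn, hmax, l, hl⟩ := exists_max (G := G) hconn.nonempty
  have hnog : ∀ v, ∃ P, Lg G n P ∧ v ∉ P := by
    intro v
    by_contra h
    refine hcon ⟨v, fun a b p hp => ?_⟩
    by_contra hv
    exact h ⟨_, longest_lg hmax hn hl hp, hv⟩
  have hinter := inter_of_conn hconn hmax hn
  have hn2 : 2 ≤ n := by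
    by_contra hlt
    have e : n = 1 := by omega
    subst e
    obtain ⟨v⟩ := hconn.nonempty
    obtain ⟨P, hP, hv⟩ := hnog v
    obtain ⟨u, hu1, hu2⟩ := hinter P [v] hP ⟨⟨by simp, by simp⟩, rfl⟩
    simp at hu2
    exact hv (hu2 ▸ hu1)
  obtain ⟨W, T, ⟨W', H, hH, ⟨e⟩⟩, f, hf⟩ := hsp
  obtain ⟨x, y, hxy, hB⟩ := skel_br hH
  let g : V ↪ W' := f.trans e.toEquiv.toEmbedding
  have hg : ∀ u v, (G.map g).Adj u v → H.Adj u v := by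
    intro u v huv
    obtain ⟨u', v', h, rfl, rfl⟩ := (SimpleGraph.map_adj g G u v).1 huv
    exact e.map_adj_iff.2 (hf _ _ h)
  have c : Ctx (G.map g) n := by
    refine ⟨?_, ?_, ?_⟩
    · intro l hl
      by_cases h : 2 ≤ l.length
      · obtain ⟨l0, rfl, h0⟩ := pull hl h
        simpa using hmax _ h0
      · omega
    · intro P Q hP hQ
      obtain ⟨P0, rfl, h0⟩ := pull hP.1 (by rw [hP.2]; exact hn2)
      obtain ⟨Q0, rfl, h1⟩ := pull hQ.1 (by rw [hQ.2]; exact hn2)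
      obtain ⟨v, h2, h3⟩ := hinter P0 Q0 ⟨h0, by simpa using hP.2⟩ ⟨h1, by simpa using hQ.2⟩
      exact ⟨g v, List.mem_map_of_mem h2, List.mem_map_of_mem h3⟩
    · intro w
      by_cases hw : ∃ v, g v = w
      · obtain ⟨v, rfl⟩ := hw
        obtain ⟨P, hP, hv⟩ := hnog v
        refine ⟨P.map g, ⟨pth_map.2 hP.1, by simpa using hP.2⟩, fun h => ?_⟩
        obtain ⟨u, hu, huv⟩ := List.mem_map.1 h
        exact hv (g.injective huv ▸ hu)
      · refine ⟨l.map g, ⟨pth_map.2 hl.1, by simpa using hl.2⟩, fun h => ?_⟩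
        obtain ⟨u, hu, huv⟩ := List.mem_map.1 h
        exact hw ⟨u, huv⟩
  exact hB.root hg c hxy

end Gallai

/-- Every finite connected series-parallel graph has a vertex contained in all of its
longest paths. -/
theorem gallai_seriesParallel {V : Type} [Fintype V] (G : SimpleGraph V)
    (hconn : G.Connected) (hsp : IsSeriesParallel G) :
    ∃ v : V, ∀ (a b : V) (p : G.Walk a b), IsLongestPath G p → v ∈ p.support := by
  exact Gallai.main hconn hsp
end

section
/- For every finite connected outerplanar graph G, there exists a vertex v of G such that every longest path in G contains v. -/
open SimpleGraph

/-- `H` is a minor of `G`: there is a family of nonempty, connected, pairwise disjoint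
branch sets in `G`, one for each vertex of `H`, such that adjacent vertices of `H` have
branch sets joined by an edge of `G`. -/
def IsMinorOf {W V : Type*} (H : SimpleGraph W) (G : SimpleGraph V) : Prop :=
  ∃ φ : W → Set V,
    (∀ w, (φ w).Nonempty) ∧
    (∀ w, (G.induce (φ w)).Connected) ∧
    (∀ w w', w ≠ w' → Disjoint (φ w) (φ w')) ∧
    (∀ w w', H.Adj w w' → ∃ a ∈ φ w, ∃ b ∈ φ w', G.Adj a b)

/-- A graph is outerplanar (it has a planar embedding with all vertices on the outer face)
iff it has no `K₄` minor and no `K_{2,3}` minor. -/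
def IsOuterplanar {V : Type*} (G : SimpleGraph V) : Prop :=
  ¬ IsMinorOf (⊤ : SimpleGraph (Fin 4)) G ∧
  ¬ IsMinorOf (completeBipartiteGraph (Fin 2) (Fin 3)) G

namespace Gallai

variable {V : Type}

theorem _root_.List.IsChain.onSeg {R : V → V → Prop} {l₁ l : List V}
    (h : l.IsChain R) (hs : l₁ <:+: l) : l₁.IsChain R := by
  obtain ⟨s, t, rfl⟩ := hs
  exact (List.isChain_append.1 (List.isChain_append.1 h).1).2.1

theorem _root_.List.IsChain.onInit {R : V → V → Prop} {l₁ l : List V}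
    (h : l.IsChain R) (hs : l₁ <+: l) : l₁.IsChain R := by
  obtain ⟨t, rfl⟩ := hs
  exact (List.isChain_append.1 h).1

/-- List version of a path. -/
def PathL (G : SimpleGraph V) (P : List V) : Prop := P.Nodup ∧ P.IsChain G.Adj

/-- First and last element of a list. -/
def Ends (P : List V) (a b : V) : Prop := P.head? = some a ∧ P.getLast? = some b

theorem chain_rev {G : SimpleGraph V} {l : List V} :
    l.reverse.IsChain G.Adj ↔ l.IsChain G.Adj := by
  rw [List.isChain_reverse]
  constructor <;> exact fun h => h.imp fun _ _ h => h.symm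

theorem chain_rev_seg {G : SimpleGraph V} {A : List V} {a b : V}
    (h : (a :: (A ++ [b])).IsChain G.Adj) : (b :: (A.reverse ++ [a])).IsChain G.Adj := by
  have := chain_rev.2 h
  simpa using this

theorem PathL.reverse {G : SimpleGraph V} {l : List V} (h : PathL G l) : PathL G l.reverse :=
  ⟨List.nodup_reverse.2 h.1, chain_rev.2 h.2⟩

theorem Ends.reverse {l : List V} {a b : V} (h : Ends l a b) : Ends l.reverse b a := by
  simpa [Ends, and_comm] using h

theorem exists_adj_last {G : SimpleGraph V} {A : List V} {a b : V}
    (h : (a :: (A ++ [b])).IsChain G.Adj) : ∃ z ∈ a :: A, G.Adj z b := by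
  induction A generalizing a with
  | nil => exact ⟨a, by simp, by simpa using h⟩
  | cons c A ih =>
    obtain ⟨z, hz, hb⟩ := ih (a := c) (by simpa using h.tail)
    exact ⟨z, List.mem_cons_of_mem _ hz, hb⟩

theorem connected_of_chain {G : SimpleGraph V} (l : List V) (hne : l ≠ [])
    (h : l.IsChain G.Adj) : (G.induce {x | x ∈ l}).Connected := by
  let w := Walk.ofSupport l hne h
  have hw : w.support = l := Walk.support_ofSupport hne h
  have := w.connected_induce_support
  rw [hw] at this
  exact this

theorem no_K4 {G : SimpleGraph V} (hK : ¬ IsMinorOf (⊤ : SimpleGraph (Fin 4)) G)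
    {a s b t : V} {A1 A2 B1 B2 : List V}
    (hnd : ((a :: A1) ++ (s :: A2) ++ (b :: B1) ++ (t :: B2)).Nodup)
    (h1 : (a :: (A1 ++ [s])).IsChain G.Adj) (h2 : (s :: (A2 ++ [b])).IsChain G.Adj)
    (h3 : (b :: (B1 ++ [t])).IsChain G.Adj) (h4 : (t :: (B2 ++ [a])).IsChain G.Adj)
    (hab : G.Adj a b) (hst : G.Adj s t) : False := by
  apply hK
  have c1 : ((a :: A1).IsChain G.Adj) := h1.onInit ⟨[s], by simp⟩
  have c2 : ((s :: A2).IsChain G.Adj) := h2.onInit ⟨[b], by simp⟩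
  have c3 : ((b :: B1).IsChain G.Adj) := h3.onInit ⟨[t], by simp⟩
  have c4 : ((t :: B2).IsChain G.Adj) := h4.onInit ⟨[a], by simp⟩
  obtain ⟨z1, hz1, e1⟩ := exists_adj_last h1
  obtain ⟨z2, hz2, e2⟩ := exists_adj_last h2
  obtain ⟨z3, hz3, e3⟩ := exists_adj_last h3
  obtain ⟨z4, hz4, e4⟩ := exists_adj_last h4
  have main : ∀ w w' : Fin 4, w < w' →
      (Disjoint {x | x ∈ ![a :: A1, s :: A2, b :: B1, t :: B2] w}
        {x | x ∈ ![a :: A1, s :: A2, b :: B1, t :: B2] w'}) ∧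
      ∃ x ∈ ![a :: A1, s :: A2, b :: B1, t :: B2] w,
        ∃ y ∈ ![a :: A1, s :: A2, b :: B1, t :: B2] w', G.Adj x y := by
    rw [List.nodup_append', List.nodup_append', List.nodup_append'] at hnd
    obtain ⟨⟨⟨-, -, d1⟩, -, d2⟩, -, d3⟩ := hnd
    have key : ∀ l l' : List V, l.Disjoint l' → Disjoint {x | x ∈ l} {x | x ∈ l'} :=
      fun l l' h => Set.disjoint_left.2 fun x hx hx' => h hx hx'
    intro w w' hw
    fin_cases w <;> fin_cases w' <;> first | (exfalso; revert hw; decide) | skip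
    · exact ⟨key _ _ d1, z1, hz1, s, by simp, e1⟩
    · exact ⟨key _ _ (fun x hx hy => d2 (by simp at hx ⊢; tauto) hy),
        a, by simp, b, by simp, hab⟩
    · exact ⟨key _ _ (fun x hx hy => d3 (by simp at hx ⊢; tauto) hy),
        a, by simp, z4, hz4, e4.symm⟩
    · exact ⟨key _ _ (fun x hx hy => d2 (by simp at hx ⊢; tauto) hy),
        z2, hz2, b, by simp, e2⟩
    · exact ⟨key _ _ (fun x hx hy => d3 (by simp at hx ⊢; tauto) hy),
        s, by simp, t, by simp, hst⟩
    · exact ⟨key _ _ (fun x hx hy => d3 (by simp at hx ⊢; tauto) hy),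
        z3, hz3, t, by simp, e3⟩
  refine ⟨fun w => {x | x ∈ ![a :: A1, s :: A2, b :: B1, t :: B2] w}, ?_, ?_, ?_, ?_⟩
  · intro w; fin_cases w
    exacts [⟨a, by simp⟩, ⟨s, by simp⟩, ⟨b, by simp⟩, ⟨t, by simp⟩]
  · intro w; apply connected_of_chain <;> fin_cases w <;> simp <;> assumption
  · intro w w' h
    rcases lt_or_gt_of_ne h with h | h
    · exact (main _ _ h).1
    · exact (main _ _ h).1.symm
  · intro w w' h
    rcases lt_or_gt_of_ne h.ne with h | h
    · exact (main _ _ h).2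
    · obtain ⟨x, hx, y, hy, hh⟩ := (main _ _ h).2
      exact ⟨y, hy, x, hx, hh.symm⟩

theorem no_K23 {G : SimpleGraph V}
    (hK : ¬ IsMinorOf (completeBipartiteGraph (Fin 2) (Fin 3)) G)
    {a b : V} {A B C : List V} (hnd : (a :: b :: (A ++ B ++ C)).Nodup)
    (hA : A ≠ []) (hB : B ≠ []) (hC : C ≠ [])
    (h1 : (a :: (A ++ [b])).IsChain G.Adj) (h2 : (a :: (B ++ [b])).IsChain G.Adj)
    (h3 : (a :: (C ++ [b])).IsChain G.Adj) : False := by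
  apply hK
  have key : ∀ L : List V, L ≠ [] → (a :: (L ++ [b])).IsChain G.Adj →
      L.IsChain G.Adj ∧ (∃ x ∈ L, G.Adj a x) ∧ (∃ x ∈ L, G.Adj b x) := by
    intro L hL h
    obtain ⟨x, L', rfl⟩ := List.exists_cons_of_ne_nil hL
    refine ⟨h.onSeg ⟨[a], [b], by simp⟩, ⟨x, by simp, h.rel_head? (by simp)⟩, ?_⟩
    obtain ⟨z, hz, e⟩ := exists_adj_last (a := x) (A := L') (b := b) (by simpa using h.tail)
    exact ⟨z, hz, e.symm⟩
  obtain ⟨cA, ⟨A1, hA1, eA1⟩, ⟨A2, hA2, eA2⟩⟩ := key A hA h1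
  obtain ⟨cB, ⟨B1, hB1, eB1⟩, ⟨B2, hB2, eB2⟩⟩ := key B hB h2
  obtain ⟨cC, ⟨C1, hC1, eC1⟩, ⟨C2, hC2, eC2⟩⟩ := key C hC h3
  have adj : ∀ (i : Fin 2) (j : Fin 3), ∃ x ∈ ![[a], [b]] i, ∃ y ∈ ![A, B, C] j, G.Adj x y := by
    intro i j
    fin_cases i <;> fin_cases j
    exacts [⟨a, by simp, A1, hA1, eA1⟩, ⟨a, by simp, B1, hB1, eB1⟩, ⟨a, by simp, C1, hC1, eC1⟩,
      ⟨b, by simp, A2, hA2, eA2⟩, ⟨b, by simp, B2, hB2, eB2⟩, ⟨b, by simp, C2, hC2, eC2⟩]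
  simp only [List.nodup_cons, List.nodup_append', List.mem_append, List.mem_cons, not_or] at hnd
  obtain ⟨⟨ab, ⟨aA, aB⟩, aC⟩, ⟨⟨bA, bB⟩, bC⟩, ⟨-, -, dAB⟩, -, dC⟩ := hnd
  have dAC : A.Disjoint C := fun x hx hy => dC (by simp [hx]) hy
  have dBC : B.Disjoint C := fun x hx hy => dC (by simp [hx]) hy
  have dab : ∀ (i : Fin 2) (j : Fin 3) (x : V), x ∈ ![[a], [b]] i → x ∈ ![A, B, C] j → False := by
    intro i j x
    fin_cases i <;> fin_cases j <;> simp <;> rintro rfl <;> assumption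
  refine ⟨fun w => {x | x ∈ Sum.elim ![[a], [b]] ![A, B, C] w}, ?_, ?_, ?_, ?_⟩
  · rintro (w | w) <;> fin_cases w
    exacts [⟨a, by simp⟩, ⟨b, by simp⟩, ⟨A1, hA1⟩, ⟨B1, hB1⟩, ⟨C1, hC1⟩]
  · rintro (w | w) <;> apply connected_of_chain <;> fin_cases w <;> simp <;> assumption
  · rintro (w | w) (w' | w') h <;> refine Set.disjoint_left.2 fun x hx hx' => ?_
    · fin_cases w <;> fin_cases w' <;> simp_all
    · exact dab w w' x hx hx'
    · exact dab w' w x hx' hx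
    · fin_cases w <;> fin_cases w' <;> simp at hx hx' h
      exacts [dAB hx hx', dAC hx hx', dAB hx' hx, dBC hx hx', dAC hx' hx, dBC hx' hx]
  · rintro (w | w) (w' | w') h
    · simp at h
    · exact adj w w'
    · obtain ⟨x, hx, y, hy, e⟩ := adj w' w
      exact ⟨y, hy, x, hx, e.symm⟩
    · simp at h

/-- The graph obtained by isolating the vertices of `S`. -/
def Out (G : SimpleGraph V) (S : Set V) : SimpleGraph V where
  Adj a b := G.Adj a b ∧ a ∉ S ∧ b ∉ S
  symm := ⟨fun _ _ h => ⟨h.1.symm, h.2.2, h.2.1⟩⟩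
  loopless := ⟨fun _ h => h.1.ne rfl⟩

theorem reach_of_chain {G : SimpleGraph V} {S : Set V} {N : List V} (h : N.IsChain G.Adj)
    (hS : ∀ x ∈ N, x ∉ S) {a b : V} (ha : a ∈ N) (hb : b ∈ N) : (Out G S).Reachable a b := by
  suffices H : ∀ b ∈ N, ∀ x ∈ N.head?, (Out G S).Reachable x b by
    obtain ⟨x, L, rfl⟩ := List.exists_cons_of_ne_nil (List.ne_nil_of_mem ha)
    exact (H a ha x rfl).symm.trans (H b hb x rfl)
  clear ha hb a b
  induction N with
  | nil => simp
  | cons c N ih =>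
    intro b hb x hx
    obtain rfl : c = x := by simpa using hx
    rcases List.mem_cons.1 hb with rfl | hb
    · exact Reachable.refl _
    · obtain ⟨d, L, rfl⟩ := List.exists_cons_of_ne_nil (List.ne_nil_of_mem hb)
      have := ih h.tail (fun x hx => hS x (by simp [hx])) b hb d rfl
      have e : (Out G S).Adj c d := ⟨h.rel_head? (by simp), hS _ (by simp), hS _ (by simp)⟩
      exact e.reachable.trans this

theorem chain_of_reach {G : SimpleGraph V} {S : Set V} {a b : V}
    (h : (Out G S).Reachable a b) (ha : a ∉ S) :
    ∃ N, PathL G N ∧ (∀ x ∈ N, x ∉ S) ∧ Ends N a b := by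
  classical
  obtain ⟨w⟩ := h
  let p := w.toPath
  refine ⟨p.1.support, ⟨p.2.support_nodup, ?_⟩, ?_, ?_, ?_⟩
  · exact p.1.isChain_adj_support.imp fun _ _ h => h.1
  · have : ∀ {a b : V} (q : (Out G S).Walk a b), a ∉ S → ∀ x ∈ q.support, x ∉ S := by
      intro a b q
      induction q with
      | nil => simp
      | cons e q ih => intro ha x hx; simp at hx; rcases hx with rfl | hx; exacts [ha, ih e.2.2 x hx]
    exact this p.1 ha
  · rw [List.head?_eq_some_head p.1.support_ne_nil]; simp
  · rw [List.getLast?_eq_some_getLast p.1.support_ne_nil]; simp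

/-- split a list at the first element satisfying `p` -/
theorem split_first {p : V → Prop} {l : List V} (h : ∃ x ∈ l, p x) :
    ∃ s x t, l = s ++ x :: t ∧ p x ∧ ∀ y ∈ s, ¬ p y := by
  induction l with
  | nil => simp at h
  | cons c l ih =>
    by_cases hc : p c
    · exact ⟨[], c, l, by simp, hc, by simp⟩
    · obtain ⟨s, x, t, rfl, hx, hs⟩ := ih (by
        obtain ⟨x, hx, hp⟩ := h
        rcases List.mem_cons.1 hx with rfl | hx
        · exact absurd hp hc
        · exact ⟨x, hx, hp⟩)
      exact ⟨c :: s, x, t, by simp, hx, by simpa using ⟨hc, hs⟩⟩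

theorem split_last {p : V → Prop} {l : List V} (h : ∃ x ∈ l, p x) :
    ∃ s x t, l = s ++ x :: t ∧ p x ∧ ∀ y ∈ t, ¬ p y := by
  obtain ⟨s, x, t, e, hx, hs⟩ := split_first (p := p) (l := l.reverse) (by simpa using h)
  refine ⟨t.reverse, x, s.reverse, ?_, hx, by simpa using hs⟩
  have := congrArg List.reverse e
  simpa using this

theorem exists_switch {G : SimpleGraph V} {p : V → Prop} {N : List V} (h : N.IsChain G.Adj)
    (h1 : ∃ x ∈ N, p x) (h2 : ∃ x ∈ N, ¬ p x) :
    ∃ s ∈ N, ∃ t ∈ N, G.Adj s t ∧ p s ∧ ¬ p t := by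
  induction N with
  | nil => simp at h1
  | cons c N ih =>
    rcases N with _ | ⟨d, N⟩
    · simp at h1 h2; exact absurd h1 h2
    · have e : G.Adj c d := h.rel_head? (by simp)
      by_cases hA : (∃ x ∈ d :: N, p x) ∧ (∃ x ∈ d :: N, ¬ p x)
      · obtain ⟨s, hs, t, ht, r⟩ := ih h.tail hA.1 hA.2
        exact ⟨s, List.mem_cons_of_mem _ hs, t, List.mem_cons_of_mem _ ht, r⟩
      · by_cases hc : p c <;> by_cases hd : p d
        · exfalso
          apply hA
          refine ⟨⟨d, by simp, hd⟩, ?_⟩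
          obtain ⟨x, hx, hp⟩ := h2
          rcases List.mem_cons.1 hx with rfl | hx
          · exact absurd hc hp
          · exact ⟨x, hx, hp⟩
        · exact ⟨c, by simp, d, by simp, e, hc, hd⟩
        · exact ⟨d, by simp, c, by simp, e.symm, hd, hc⟩
        · exfalso
          apply hA
          refine ⟨?_, ⟨d, by simp, hd⟩⟩
          obtain ⟨x, hx, hp⟩ := h1
          rcases List.mem_cons.1 hx with rfl | hx
          · exact absurd hp hc
          · exact ⟨x, hx, hp⟩

theorem no_cross {G : SimpleGraph V} (hK : ¬ IsMinorOf (⊤ : SimpleGraph (Fin 4)) G)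
    {v a b : V} {S1 S2 S3 : List V}
    (hnd : (v :: (S1 ++ a :: (S2 ++ b :: S3))).Nodup)
    (hc : (v :: ((S1 ++ a :: (S2 ++ b :: S3)) ++ [v])).IsChain G.Adj)
    (hab : G.Adj a b) {N : List V} (hN : N.IsChain G.Adj) (hsub : ∀ x ∈ N, x ∈ S2 ∨ x ∈ S3)
    (h2 : ∃ x ∈ N, x ∈ S2) (h3 : ∃ x ∈ N, x ∈ S3) : False := by
  have hdis : ∀ x, x ∈ S2 → x ∈ S3 → False := by
    intro x hx hy
    grind
  obtain ⟨s, hs, t, ht, e, hs2, ht2⟩ := exists_switch (p := fun x => x ∈ S2) hN h2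
    (by obtain ⟨x, hx, hx3⟩ := h3; exact ⟨x, hx, fun h => hdis x h hx3⟩)
  have ht3 : t ∈ S3 := (hsub t ht).resolve_left ht2
  obtain ⟨A1, A2, rfl⟩ := List.append_of_mem hs2
  obtain ⟨B1, B2, rfl⟩ := List.append_of_mem ht3
  have c0 : (v :: (S1 ++ [a])).IsChain G.Adj :=
    hc.onSeg ⟨[], A1 ++ s :: A2 ++ b :: (B1 ++ t :: B2) ++ [v], by simp⟩
  have c4 : (t :: (B2 ++ [v])).IsChain G.Adj :=
    hc.onSeg ⟨v :: (S1 ++ a :: (A1 ++ s :: A2 ++ b :: B1)), [], by simp⟩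
  refine no_K4 hK (a := a) (s := s) (b := b) (t := t) (A1 := A1) (A2 := A2) (B1 := B1)
    (B2 := B2 ++ v :: S1) ?_ ?_ ?_ ?_ ?_ hab e
  · refine List.Perm.nodup ?_ hnd
    have : (v :: S1 ++ (a :: A1 ++ s :: A2 ++ b :: B1 ++ t :: B2)).Perm
      ((a :: A1 ++ s :: A2 ++ b :: B1 ++ t :: B2) ++ v :: S1) := List.perm_append_comm
    simpa using this
  · exact hc.onSeg ⟨v :: S1, A2 ++ b :: (B1 ++ t :: B2) ++ [v], by simp⟩
  · exact hc.onSeg ⟨v :: S1 ++ a :: A1, B1 ++ t :: B2 ++ [v], by simp⟩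
  · exact hc.onSeg ⟨v :: S1 ++ a :: A1 ++ s :: A2, B2 ++ [v], by simp⟩
  · have := List.isChain_split (l₁ := t :: B2) (c := v) (l₂ := S1 ++ [a]) (R := G.Adj)
    simpa using this.2 ⟨by simpa using c4, by simpa using c0⟩

/-- Local improvement when the minimum `p1` precedes the maximum `p2`. -/
theorem improve_aux {G : SimpleGraph V} (hK : ¬ IsMinorOf (⊤ : SimpleGraph (Fin 4)) G)
    {v p1 p2 x y : V} {L1 L5 L4 X Y : List V}
    (hnd : (v :: (L1 ++ p1 :: (L5 ++ p2 :: L4))).Nodup)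
    (hc : (v :: ((L1 ++ p1 :: (L5 ++ p2 :: L4)) ++ [v])).IsChain G.Adj)
    (hM : PathL G (X ++ p1 :: Y)) (he : Ends (X ++ p1 :: Y) x y)
    (hsub : ∀ z ∈ X ++ p1 :: Y, z = p1 ∨ z ∈ L5 ∨ z = p2) (hp2 : p2 ∈ Y) (hX : X ≠ []) :
    ∃ M', PathL G M' ∧ (∀ z ∈ M', z ∈ v :: (L1 ++ p1 :: (L5 ++ p2 :: L4))) ∧
      (X ++ p1 :: Y).length < M'.length ∧ (Ends M' x y ∨ Ends M' v x) := by
  obtain ⟨b, Y', rfl⟩ := List.exists_cons_of_ne_nil (List.ne_nil_of_mem hp2)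
  obtain ⟨hMn, hMc⟩ := hM
  by_cases hb : b = p2
  · subst hb
    refine ⟨X ++ p1 :: (L1.reverse ++ v :: (L4.reverse ++ b :: Y')), ⟨?_, ?_⟩, ?_, ?_, Or.inl ?_⟩
    · have hd1 : ∀ z ∈ L1.reverse ++ v :: L4.reverse, z ∉ X ++ p1 :: b :: Y' := by
        intro z hz hz'
        have := hsub z hz'
        simp at hz
        grind
      have hd2 : (L1.reverse ++ v :: L4.reverse).Nodup := by
        have : (v :: (L1 ++ L4)).Nodup := hnd.sublist (by
          refine List.Sublist.cons_cons _ ?_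
          refine List.Sublist.append_left ?_ _
          refine List.Sublist.cons _ ?_
          exact (List.sublist_cons_self _ _).trans (List.sublist_append_right _ _))
        refine List.Perm.nodup ?_ this
        refine (List.Perm.trans ?_ List.perm_middle.symm)
        refine List.Perm.cons _ ?_
        exact (L1.reverse_perm.symm.append L4.reverse_perm.symm)
      have : ((L1.reverse ++ v :: L4.reverse) ++ (X ++ p1 :: b :: Y')).Nodup := by
        rw [List.nodup_append']
        exact ⟨hd2, hMn, fun z hz hz' => hd1 z hz hz'⟩
      refine List.Perm.nodup ?_ this
      have h1 : (((L1.reverse ++ v :: L4.reverse) ++ (X ++ [p1])) ++ b :: Y').Perm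
        (((X ++ [p1]) ++ (L1.reverse ++ v :: L4.reverse)) ++ b :: Y') :=
        List.perm_append_comm.append_right _
      simpa using h1
    · have k1 : (X ++ [p1]).IsChain G.Adj := hMc.onInit ⟨b :: Y', by simp⟩
      have k2 : (b :: Y').IsChain G.Adj := hMc.suffix ⟨X ++ [p1], by simp⟩
      have k3 : (v :: (L1 ++ [p1])).IsChain G.Adj := hc.onInit ⟨L5 ++ b :: L4 ++ [v], by simp⟩
      have k4 : (b :: (L4 ++ [v])).IsChain G.Adj :=
        hc.suffix ⟨v :: L1 ++ p1 :: L5, by simp⟩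
      rw [List.isChain_split]
      refine ⟨k1, ?_⟩
      rw [← List.cons_append, List.isChain_split]
      refine ⟨by simpa using chain_rev_seg k3, ?_⟩
      rw [← List.cons_append, List.isChain_split]
      exact ⟨by simpa using chain_rev_seg k4, k2⟩
    · intro z hz
      have := hsub z
      simp at hz this ⊢
      grind
    · simp; omega
    · obtain ⟨x', X', rfl⟩ := List.exists_cons_of_ne_nil hX
      simp only [Ends] at he ⊢
      refine ⟨by simpa using he.1, ?_⟩
      rw [← he.2]
      simp [List.getLast?_append, List.getLast?_cons]
  · -- b is strictly between p1 and p2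
    have hbL5 : b ∈ L5 := by
      have := hsub b (by simp)
      grind
    obtain ⟨A, D, rfl⟩ := List.append_of_mem hbL5
    set D' := D ++ p2 :: L4 with hD'
    have hL : L1 ++ p1 :: ((A ++ b :: D) ++ p2 :: L4) = L1 ++ p1 :: (A ++ b :: D') := by
      simp [D']
    rw [hL] at hnd hc ⊢
    have e1 : G.Adj p1 b := by
      have := (hMc.suffix (l₁ := p1 :: b :: Y') ⟨X, by simp⟩)
      exact this.rel_head? (by simp)
    have hp2Y : p2 ∈ Y' := by
      rcases List.mem_cons.1 hp2 with h | h
      · exact absurd h.symm hb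
      · exact h
    have hmem : ∀ z ∈ X ++ p1 :: b :: Y', z ≠ p1 → z ≠ b → z ∈ A ∨ z ∈ D' := by
      intro z hz h1 h2
      have := hsub z hz
      simp [D'] at this ⊢
      grind
    have hXne : ∀ z ∈ X, z ≠ p1 ∧ z ≠ b := by
      intro z hz
      grind
    have hYne : ∀ z ∈ Y', z ≠ p1 ∧ z ≠ b := by
      intro z hz
      grind
    have cX : X.IsChain G.Adj := hMc.onInit ⟨p1 :: b :: Y', by simp⟩
    have cY' : Y'.IsChain G.Adj := hMc.suffix ⟨X ++ [p1, b], by simp⟩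
    have cY : (b :: Y').IsChain G.Adj := hMc.suffix ⟨X ++ [p1], by simp⟩
    have dAD : ∀ z ∈ A, z ∉ D' := by
      intro z hz hz'
      grind
    have hY'A : ∀ z ∈ Y', z ∈ A ∨ z ∈ D' := fun z hz =>
      hmem z (by simp [hz]) (hYne z hz).1 (hYne z hz).2
    have hXA : ∀ z ∈ X, z ∈ A ∨ z ∈ D' := fun z hz =>
      hmem z (by simp [hz]) (hXne z hz).1 (hXne z hz).2
    have hY'D : ∀ z ∈ Y', z ∈ D' := by
      intro z hz
      rcases hY'A z hz with h | h
      · exact (no_cross hK hnd hc e1 cY' hY'A ⟨z, hz, h⟩ ⟨p2, hp2Y, by simp [D']⟩).elim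
      · exact h
    obtain ⟨X', c, rfl⟩ : ∃ X' c, X = X' ++ [c] :=
      ⟨X.dropLast, X.getLast hX, (List.dropLast_append_getLast hX).symm⟩
    have e2 : G.Adj p1 c := by
      have := (hMc.onSeg (l₁ := [c, p1]) ⟨X', b :: Y', by simp⟩)
      exact (this.rel_head? (by simp)).symm
    have hcA : c ∈ A := by
      rcases hXA c (by simp) with h | h
      · exact h
      · exfalso
        have hcD : c ∈ D := by
          have := hsub c (by simp)
          grind
        obtain ⟨D1, D2, rfl⟩ := List.append_of_mem hcD
        have hL' : L1 ++ p1 :: (A ++ b :: D') =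
          L1 ++ p1 :: ((A ++ b :: D1) ++ c :: (D2 ++ p2 :: L4)) := by simp [D']
        rw [hL'] at hnd hc
        refine no_cross hK hnd hc e2 cY ?_ ⟨b, by simp, by simp⟩ ⟨p2, hp2, by simp⟩
        intro z hz
        rcases List.mem_cons.1 hz with rfl | hz'
        · simp
        · have h1 := hY'D z hz'
          have : z ≠ c := by grind
          simp [D'] at h1 ⊢
          grind
    have hXsub : ∀ z ∈ X' ++ [c], z ∈ A := by
      intro z hz
      rcases hXA z hz with h | h
      · exact h
      · exact (no_cross hK hnd hc e1 cX hXA ⟨c, by simp, hcA⟩ ⟨z, hz, h⟩).elim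
    have hYlen : (b :: Y').length ≤ (b :: D').length := by
      simp only [List.length_cons]
      exact Nat.succ_le_succ (List.Nodup.length_le_of_subset (by grind) hY'D)
    have hpath : PathL G ((X' ++ [c]) ++ p1 :: b :: (D' ++ [v])) := by
      constructor
      · have n1 : (X' ++ [c]).Nodup := by grind
        have n2 : (v :: (p1 :: b :: D')).Nodup := by
          refine hnd.sublist ?_
          refine List.Sublist.cons_cons _ ?_
          refine List.Sublist.trans ?_ (List.sublist_append_right _ _)
          refine List.Sublist.cons_cons _ ?_
          exact List.sublist_append_right _ _
        have n3 : (p1 :: b :: (D' ++ [v])).Nodup := by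
          refine List.Perm.nodup ?_ n2
          have : ([v] ++ (p1 :: b :: D')).Perm ((p1 :: b :: D') ++ [v]) := List.perm_append_comm
          simpa using this
        rw [List.nodup_append']
        refine ⟨n1, n3, fun z hz hz' => ?_⟩
        have hzA := hXsub z hz
        have h1 := dAD z hzA
        have h2 := hXne z hz
        have h3 : z ≠ v := by
          rintro rfl
          exact (List.nodup_cons.1 hnd).1 (by simp [hzA])
        simp only [List.mem_cons, List.mem_append, List.not_mem_nil, or_false] at hz'
        tauto
      · rw [List.isChain_split]
        refine ⟨hMc.onInit ⟨b :: Y', by simp⟩, ?_⟩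
        rw [List.isChain_cons_cons]
        exact ⟨e1, hc.suffix ⟨v :: L1 ++ p1 :: A, by simp⟩⟩
    refine ⟨_, hpath.reverse, ?_, ?_, Or.inr (Ends.reverse ?_)⟩
    · intro z hz
      have := hXsub z
      simp at hz this ⊢
      grind
    · simp at hYlen ⊢; omega
    · obtain ⟨h1, -⟩ := he
      constructor
      · rw [← h1]; simp [List.head?_append]
      · simp [List.getLast?_append, List.getLast?_cons]

theorem improve {G : SimpleGraph V} (hK : ¬ IsMinorOf (⊤ : SimpleGraph (Fin 4)) G)
    {v x y : V} {L M : List V} (hnd : (v :: L).Nodup) (hc : (v :: (L ++ [v])).IsChain G.Adj)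
    (hM : PathL G M) (he : Ends M x y) (hsub : ∀ z ∈ M, z ∈ L) :
    ∃ M', PathL G M' ∧ (∀ z ∈ M', z ∈ v :: L) ∧ M.length < M'.length ∧
      (Ends M' x y ∨ Ends M' v x ∨ Ends M' v y) := by
  have hx : x ∈ M := List.mem_of_head? he.1
  obtain ⟨L1, p1, L2, rfl, hp1, hL1⟩ := split_first (p := fun z => z ∈ M) ⟨x, hsub x hx, hx⟩
  -- if an end of the path is `p1`
  have easy : ∀ (M Y : List V) (y : V), PathL G M → M = p1 :: Y → M.getLast? = some y →
      (∀ z ∈ M, z ∈ L1 ++ p1 :: L2) → (∀ z ∈ L1, z ∉ M) →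
      ∃ M', PathL G M' ∧ (∀ z ∈ M', z ∈ v :: (L1 ++ p1 :: L2)) ∧ M.length < M'.length ∧
        Ends M' v y := by
    rintro M Y y hM rfl hy hsub hL1
    refine ⟨v :: (L1 ++ p1 :: Y), ⟨?_, ?_⟩, ?_, ?_, ?_, ?_⟩
    · have : (v :: L1).Nodup := hnd.sublist (by simp)
      have h2 : ((v :: L1) ++ (p1 :: Y)).Nodup := by
        rw [List.nodup_append']
        refine ⟨this, hM.1, fun z hz hz' => ?_⟩
        rcases List.mem_cons.1 hz with rfl | hz
        · exact (List.nodup_cons.1 hnd).1 (hsub _ hz')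
        · exact hL1 z hz hz'
      simpa using h2
    · rw [← List.cons_append, List.isChain_split]
      exact ⟨hc.onInit ⟨L2 ++ [v], by simp⟩, hM.2⟩
    · intro z hz
      have := hsub z
      simp at hz this ⊢
      grind
    · simp
    · simp
    · rw [← hy]; simp [List.getLast?_append, List.getLast?_cons]
  obtain ⟨X, Y, rfl⟩ := List.append_of_mem hp1
  rcases List.eq_nil_or_concat X with rfl | ⟨X', c, hX⟩
  · obtain ⟨M', h1, h2, h3, h4⟩ := easy _ Y y hM (by simp) he.2 hsub hL1
    exact ⟨M', h1, h2, h3, Or.inr (Or.inr h4)⟩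
  have hXne : X ≠ [] := by rw [hX]; simp
  rcases List.eq_nil_or_concat Y with rfl | ⟨Y', d, hY⟩
  · obtain ⟨M', h1, h2, h3, h4⟩ := easy _ X.reverse x hM.reverse (by simp) he.reverse.2
      (fun z hz => hsub z (List.mem_reverse.1 hz)) (fun z hz h => hL1 z hz (List.mem_reverse.1 h))
    exact ⟨M', h1, h2, by simpa using h3, Or.inr (Or.inl h4)⟩
  have hYne : Y ≠ [] := by rw [hY]; simp
  have hX2 : ∀ z ∈ X, z ∈ L2 := by
    intro z hz
    have h1 := hsub z (by simp [hz])
    have h2 := hL1 z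
    have h3 := hM.1
    grind
  have hY2 : ∀ z ∈ Y, z ∈ L2 := by
    intro z hz
    have h1 := hsub z (by simp [hz])
    have h2 := hL1 z
    have h3 := hM.1
    grind
  obtain ⟨L5, p2, L4, rfl, hp2, hL4⟩ := split_last (p := fun z => z ∈ X ++ p1 :: Y) (l := L2)
    ⟨c, hX2 c (by rw [hX]; simp), by rw [hX]; simp⟩
  have hsub' : ∀ z ∈ X ++ p1 :: Y, z = p1 ∨ z ∈ L5 ∨ z = p2 := by
    intro z hz
    have h1 := hsub z hz
    have h2 := hL1 z
    have h3 := hL4 z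
    grind
  have hp : p2 ∈ X ∨ p2 ∈ Y := by
    have : p2 ≠ p1 := by grind
    simp at hp2
    tauto
  rcases hp with hp | hp
  · have hrev : (X ++ p1 :: Y).reverse = Y.reverse ++ p1 :: X.reverse := by simp
    obtain ⟨M', h1, h2, h3, h4⟩ := improve_aux hK (X := Y.reverse) (Y := X.reverse) (x := y)
      (y := x) hnd hc (hrev ▸ hM.reverse) (hrev ▸ he.reverse)
      (fun z hz => hsub' z (by simp at hz ⊢; tauto)) (by simpa using hp) (by simpa using hYne)
    have h3' : (X ++ p1 :: Y).length < M'.length := by simp at h3 ⊢; omega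
    rcases h4 with h4 | h4
    · exact ⟨M'.reverse, h1.reverse, fun z hz => h2 z (by simpa using hz), by simpa using h3',
        Or.inl h4.reverse⟩
    · exact ⟨M', h1, h2, h3', Or.inr (Or.inr h4)⟩
  · obtain ⟨M', h1, h2, h3, h4⟩ := improve_aux hK hnd hc hM he hsub' hp hXne
    exact ⟨M', h1, h2, h3, by tauto⟩

/-- A cyclic list (an edge is allowed as a cycle of length two). -/
def Cyc (G : SimpleGraph V) (l : List V) : Prop :=
  l.Nodup ∧ ∀ s x t, l = s ++ x :: t → (x :: (t ++ s ++ [x])).IsChain G.Adj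

theorem cyc_mk {G : SimpleGraph V} {a : V} {m : List V} (hnd : (a :: m).Nodup)
    (hc : (a :: (m ++ [a])).IsChain G.Adj) : Cyc G (a :: m) := by
  refine ⟨hnd, fun s x t h => ?_⟩
  rcases s with _ | ⟨a', s⟩
  · simp at h
    obtain ⟨rfl, rfl⟩ := h
    simpa using hc
  · simp at h
    obtain ⟨rfl, rfl⟩ := h
    have c1 : (a :: (s ++ [x])).IsChain G.Adj := hc.onInit ⟨t ++ [a], by simp⟩
    have c2 : (x :: (t ++ [a])).IsChain G.Adj := hc.suffix ⟨a :: s, by simp⟩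
    have := List.isChain_split (l₁ := x :: t) (c := a) (l₂ := s ++ [x]) (R := G.Adj)
    simpa using this.2 ⟨by simpa using c2, c1⟩

theorem rotate_nodup {s t : List V} {x : V} (h : (s ++ x :: t).Nodup) :
    (x :: (t ++ s)).Nodup := by
  refine List.Perm.nodup ?_ h
  have : (s ++ x :: t).Perm (x :: t ++ s) := List.perm_append_comm
  simpa using this

/-- `l` has no ears. -/
def NoEar (G : SimpleGraph V) (l : List V) : Prop :=
  ∀ c1 ∈ l, ∀ c2 ∈ l, ∀ s t, s ∉ l → G.Adj c1 s → G.Adj c2 t →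
    (Out G {x | x ∈ l}).Reachable s t → c1 = c2

theorem noEar_of_max {G : SimpleGraph V}
    (hK : ¬ IsMinorOf (completeBipartiteGraph (Fin 2) (Fin 3)) G) {l : List V} (hl : Cyc G l)
    (hmax : ∀ l', Cyc G l' → (∀ x ∈ l, x ∈ l') → l'.length ≤ l.length) : NoEar G l := by
  intro c1 h1 c2 h2 s t hs e1 e2 hr
  by_contra hne
  obtain ⟨I, ⟨hIn, hIc⟩, hIl, hIs, hIt⟩ := chain_of_reach hr hs
  replace hIl : ∀ x ∈ I, x ∉ l := hIl
  have hIne : I ≠ [] := by rintro rfl; simp at hIs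
  have hear : (c1 :: (I ++ [c2])).IsChain G.Adj := by
    rw [← List.cons_append]
    refine List.IsChain.append (List.IsChain.cons hIc ?_) (by simp) ?_
    · intro y hy; rw [hIs] at hy; simp at hy; exact hy ▸ e1
    · intro x hx y hy
      rw [List.getLast?_cons, hIt] at hx
      simp at hx hy
      rw [← hx, ← hy]; exact e2.symm
  obtain ⟨P, R, rfl⟩ := List.append_of_mem h1
  have hc := hl.2 P c1 R rfl
  have hnd := rotate_nodup hl.1
  have h2' : c2 ∈ R ++ P := by simp at h2 ⊢; tauto
  have hlen : (P ++ c1 :: R).length = (c1 :: (R ++ P)).length := by simp; omega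
  have hmm : ∀ x, x ∈ P ++ c1 :: R ↔ x ∈ c1 :: (R ++ P) := by intro x; simp; tauto
  simp only [hlen, hmm] at hmax hIl
  obtain ⟨A, D, hAD⟩ := List.append_of_mem h2'
  rw [hAD] at hc hnd hmax hIl
  have cA : (c1 :: (A ++ [c2])).IsChain G.Adj := hc.onInit ⟨D ++ [c1], by simp⟩
  have cD : (c2 :: (D ++ [c1])).IsChain G.Adj := hc.suffix ⟨c1 :: A, by simp⟩
  have hbig : ((c1 :: (A ++ c2 :: D)) ++ I).Nodup := by
    rw [List.nodup_append']
    exact ⟨hnd, hIn, fun x hx hx' => hIl x hx' hx⟩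
  have hIpos : 0 < I.length := List.length_pos_iff.2 hIne
  rcases eq_or_ne A [] with rfl | hA
  · have hcyc : Cyc G (c1 :: (I ++ c2 :: D)) := by
      apply cyc_mk
      · refine List.Perm.nodup ?_ hbig
        simp only [List.nil_append, List.cons_append]
        refine List.Perm.cons _ ?_
        have : ((c2 :: D) ++ I).Perm (I ++ (c2 :: D)) := List.perm_append_comm
        simpa using this
      · have := List.isChain_split (l₁ := c1 :: I) (c := c2) (l₂ := D ++ [c1]) (R := G.Adj)
        simpa using this.2 ⟨hear, cD⟩
    have := hmax _ hcyc (by intro x hx; simp at hx ⊢; tauto)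
    simp only [List.length_cons, List.length_append, List.length_reverse, List.length_nil] at this; omega
  rcases eq_or_ne D [] with rfl | hD
  · have hcyc : Cyc G (c1 :: (A ++ c2 :: I.reverse)) := by
      apply cyc_mk
      · refine List.Perm.nodup ?_ hbig
        simp only [List.append_assoc, List.cons_append]
        refine List.Perm.cons _ (List.Perm.append_left _ (List.Perm.cons _ ?_))
        simpa using I.reverse_perm.symm
      · have := List.isChain_split (l₁ := c1 :: A) (c := c2) (l₂ := I.reverse ++ [c1]) (R := G.Adj)
        simpa using this.2 ⟨cA, chain_rev_seg hear⟩
    have := hmax _ hcyc (by intro x hx; simp at hx ⊢; tauto)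
    simp only [List.length_cons, List.length_append, List.length_reverse, List.length_nil] at this; omega
  refine no_K23 hK (a := c1) (b := c2) (A := A) (B := D.reverse) (C := I) ?_ hA (by simpa using hD)
    hIne cA (chain_rev_seg cD) hear
  refine List.Perm.nodup ?_ hbig
  simp only [List.append_assoc, List.cons_append]
  refine List.Perm.cons _ (List.perm_middle.trans (List.Perm.cons _ (List.Perm.append_left _ ?_)))
  exact D.reverse_perm.symm.append_right _

/-- Longest paths as lists. -/
def LP (G : SimpleGraph V) (P : List V) : Prop :=
  P ≠ [] ∧ PathL G P ∧ ∀ Q, PathL G Q → Q.length ≤ P.length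

theorem LP.reverse {G : SimpleGraph V} {P : List V} (h : LP G P) : LP G P.reverse :=
  ⟨by simpa using h.1, h.2.1.reverse, by simpa using h.2.2⟩

theorem chain_of_conn {G : SimpleGraph V} (hconn : G.Connected) (a b : V) :
    ∃ N, PathL G N ∧ Ends N a b := by
  have : Out G ∅ = G := by ext; simp [Out]
  obtain ⟨N, h1, -, h2⟩ := chain_of_reach (G := G) (S := ∅) (a := a) (b := b)
    (by rw [this]; exact hconn.preconnected a b) (by simp)
  exact ⟨N, h1, h2⟩

theorem long_half {G : SimpleGraph V} {P : List V} (h : LP G P) {p : V} (hp : p ∈ P) :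
    ∃ A, PathL G (A ++ [p]) ∧ (∀ x ∈ A, x ∈ P) ∧ P.length ≤ 2 * A.length + 1 := by
  obtain ⟨A, B, rfl⟩ := List.append_of_mem hp
  rcases le_total A.length B.length with hl | hl
  · have hr := h.2.1.reverse
    have e : (A ++ p :: B).reverse = (B.reverse ++ [p]) ++ A.reverse := by simp
    rw [e] at hr
    refine ⟨B.reverse, ⟨hr.1.sublist (List.sublist_append_left _ _),
      hr.2.onInit (List.prefix_append _ _)⟩, by simp; tauto, by simp; omega⟩
  · have hr := h.2.1
    have e : (A ++ p :: B) = (A ++ [p]) ++ B := by simp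
    rw [e] at hr
    refine ⟨A, ⟨hr.1.sublist (List.sublist_append_left _ _),
      hr.2.onInit (List.prefix_append _ _)⟩, by simp; tauto, by simp; omega⟩

theorem LP_inter {G : SimpleGraph V} (hconn : G.Connected) {P Q : List V} (hP : LP G P)
    (hQ : LP G Q) : ∃ x ∈ P, x ∈ Q := by
  by_contra hcon
  push Not at hcon
  obtain ⟨a, _, hPe⟩ := List.exists_cons_of_ne_nil hP.1
  obtain ⟨b, _, hQe⟩ := List.exists_cons_of_ne_nil hQ.1
  have ha : a ∈ P := by rw [hPe]; simp
  have hb : b ∈ Q := by rw [hQe]; simp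
  obtain ⟨N, ⟨hNn, hNc⟩, hNa, hNb⟩ := chain_of_conn hconn a b
  obtain ⟨N1, q, N2, rfl, hq, hN1⟩ := split_first (p := fun x => x ∈ Q) (l := N)
    ⟨b, List.mem_of_getLast? hNb, hb⟩
  have haN1 : a ∈ N1 := by
    rcases N1 with _ | ⟨c, N1⟩
    · simp at hNa; subst hNa; exact absurd hq (hcon _ ha)
    · simp at hNa; simp [hNa]
  obtain ⟨N3, p, I, rfl, hp, hI⟩ := split_last (p := fun x => x ∈ P) (l := N1) ⟨a, haN1, ha⟩
  obtain ⟨A, hA, hAP, hAl⟩ := long_half hP hp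
  obtain ⟨B, hB, hBQ, hBl⟩ := long_half hQ hq
  have hPQ : P.length = Q.length := le_antisymm (hQ.2.2 _ hP.2.1) (hP.2.2 _ hQ.2.1)
  have hnew : PathL G ((A ++ [p]) ++ I ++ (B ++ [q]).reverse) := by
    constructor
    · rw [List.nodup_append', List.nodup_append']
      refine ⟨⟨hA.1, ?_, ?_⟩, hB.reverse.1, ?_⟩
      · have : (p :: I).Nodup := hNn.sublist (by
          refine List.Sublist.trans ?_ (List.sublist_append_left _ _)
          exact List.sublist_append_right _ _)
        exact (List.nodup_cons.1 this).2
      · intro x hx hx'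
        refine hI x hx' ?_
        simp at hx
        rcases hx with hx | rfl
        exacts [hAP x hx, hp]
      · intro x hx hx'
        have hxQ : x ∈ Q := by
          simp at hx'
          rcases hx' with rfl | hx'
          exacts [hq, hBQ x hx']
        simp at hx
        rcases hx with hx | rfl | hx
        · exact hcon x (hAP x hx) hxQ
        · exact hcon x hp hxQ
        · exact hN1 x (by simp [hx]) hxQ
    · have c1 : (p :: (I ++ [q])).IsChain G.Adj := hNc.onSeg ⟨N3, N2, by simp⟩
      have c2 := hB.reverse.2
      have e : (A ++ [p]) ++ I ++ (B ++ [q]).reverse = A ++ p :: (I ++ q :: B.reverse) := by simp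
      rw [e, List.isChain_split]
      refine ⟨hA.2, ?_⟩
      rw [← List.cons_append, List.isChain_split]
      exact ⟨c1, by simpa using c2⟩
  have := hP.2.2 _ hnew
  simp at this
  omega

/-- The part of `G - z` where the longest paths avoiding `z` live. -/
def KK (G : SimpleGraph V) (z : V) : Set V :=
  {s | ∃ P, LP G P ∧ z ∉ P ∧ ∃ p ∈ P, (Out G {z}).Reachable p s}

theorem mem_KK {G : SimpleGraph V} (hconn : G.Connected) {z : V} {Q : List V} (hQ : LP G Q)
    (hz : z ∉ Q) {q : V} (hq : q ∈ Q) {s : V} :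
    s ∈ KK G z ↔ (Out G {z}).Reachable q s := by
  constructor
  · rintro ⟨P, hP, hzP, p, hp, hr⟩
    obtain ⟨x, hxP, hxQ⟩ := LP_inter hconn hP hQ
    have h1 : (Out G {z}).Reachable q x :=
      reach_of_chain hQ.2.1.2 (by rintro y hy rfl; exact hz hy) hq hxQ
    have h2 : (Out G {z}).Reachable x p :=
      reach_of_chain hP.2.1.2 (by rintro y hy rfl; exact hzP hy) hxP hp
    exact (h1.trans h2).trans hr
  · exact fun h => ⟨Q, hQ, hz, q, hq, h⟩

theorem not_mem_KK {G : SimpleGraph V} {z : V} : z ∉ KK G z := by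
  rintro ⟨P, hP, hzP, p, hp, hr⟩
  have hpz : p ∉ ({z} : Set V) := by rintro rfl; exact hzP hp
  obtain ⟨N, -, h1, -, h2⟩ := chain_of_reach hr hpz
  exact h1 z (List.mem_of_getLast? h2) rfl

theorem exists_max_s1 {p : ℕ → Prop} {n : ℕ} (h : p n) {b : ℕ} (hb : ∀ m, p m → m ≤ b) :
    ∃ m, p m ∧ ∀ k, p k → k ≤ m := by
  classical
  exact ⟨Nat.findGreatest p b, Nat.findGreatest_spec (hb n h) h,
    fun k hk => Nat.le_findGreatest (hb k hk) hk⟩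

theorem exists_block [Fintype V] {G : SimpleGraph V} (hconn : G.Connected)
    (hK : ¬ IsMinorOf (completeBipartiteGraph (Fin 2) (Fin 3)) G)
    (hno : ∀ v, ∃ P, LP G P ∧ v ∉ P) :
    ∃ l, Cyc G l ∧ l ≠ [] ∧ NoEar G l ∧ ∀ P, LP G P → ∃ x ∈ P, x ∈ l := by
  classical
  obtain ⟨v0⟩ := hconn.nonempty
  obtain ⟨v, -, hvmin⟩ := Finset.exists_min_image Finset.univ (fun z => (KK G z).ncard)
    ⟨v0, Finset.mem_univ _⟩
  obtain ⟨P, hP, hvP⟩ := hno v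
  obtain ⟨u, huv, huK⟩ : ∃ u, G.Adj v u ∧ u ∈ KK G v := by
    obtain ⟨p, _, hPe⟩ := List.exists_cons_of_ne_nil hP.1
    have hp : p ∈ P := by rw [hPe]; simp
    obtain ⟨N, ⟨hNn, hNc⟩, hNa, hNb⟩ := chain_of_conn hconn v p
    rcases N with _ | ⟨v', N⟩
    · simp at hNa
    obtain rfl : v' = v := by simpa using hNa
    rcases N with _ | ⟨u, N⟩
    · simp at hNb; subst hNb; exact absurd hp hvP
    refine ⟨u, hNc.rel_head? (by simp), (mem_KK hconn hP hvP hp).2 ?_⟩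
    refine reach_of_chain hNc.tail ?_ ?_ (by simp)
    · rintro y hy rfl
      exact (List.nodup_cons.1 hNn).1 hy
    · exact List.mem_of_getLast? (by rw [List.getLast?_cons_cons] at hNb; exact hNb)
  have hcyc0 : Cyc G [v, u] := cyc_mk (by simp [huv.ne]) (by simp [huv, huv.symm])
  obtain ⟨m, ⟨l, hl, hvl, hul, rfl⟩, hmax⟩ :=
    exists_max_s1 (p := fun n => ∃ l, Cyc G l ∧ v ∈ l ∧ u ∈ l ∧ l.length = n) (n := 2)
      (b := Fintype.card V) ⟨[v, u], hcyc0, by simp, by simp, by simp⟩ (by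
        rintro m ⟨l, hl, -, -, rfl⟩
        exact hl.1.length_le_card)
  have hear : NoEar G l := noEar_of_max hK hl fun l' h1 h2 =>
    hmax _ ⟨l', h1, h2 v hvl, h2 u hul, rfl⟩
  refine ⟨l, hl, List.ne_nil_of_mem hvl, hear, fun Q hQ => ?_⟩
  by_contra hcon
  push Not at hcon
  obtain ⟨q, _, hQe⟩ := List.exists_cons_of_ne_nil hQ.1
  have hq : q ∈ Q := by rw [hQe]; simp
  clear hQe
  -- first vertex of `l` on a path from `q`
  have hit : ∀ N : List V, N.IsChain G.Adj → N.head? = some q → (∃ x ∈ N, x ∈ l) →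
      ∃ z ∈ N, z ∈ l ∧ ∃ s, G.Adj z s ∧ s ∉ l ∧ (Out G {x | x ∈ l}).Reachable q s := by
    intro N hN hh hx
    obtain ⟨A, z, B, rfl, hz, hA⟩ := split_first (p := fun x => x ∈ l) hx
    rcases A with _ | ⟨q', A⟩
    · simp at hh; subst hh; exact absurd hz (hcon _ hq)
    · obtain rfl : q' = q := by simpa using hh
      obtain ⟨s, hs, e⟩ := exists_adj_last (a := q') (A := A) (b := z) (G := G)
        (hN.onInit ⟨B, by simp⟩)
      exact ⟨z, by simp, hz, s, e.symm, hA s hs,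
        reach_of_chain (N := q' :: A) (hN.onInit ⟨z :: B, by simp⟩) hA (by simp) hs⟩
  obtain ⟨N, ⟨hNn, hNc⟩, hNq, hNv⟩ := chain_of_conn hconn q v
  obtain ⟨z, -, hzl, s, hzs, hsl, hqs⟩ := hit N hNc hNq ⟨v, List.mem_of_getLast? hNv, hvl⟩
  have hzQ : z ∉ Q := fun h => hcon z h hzl
  have hvQ : v ∉ Q := fun h => hcon v h hvl
  have hqz : q ∉ ({z} : Set V) := by rintro rfl; exact hzQ hq
  have hKl : ∀ x ∈ KK G z, x ∉ l := by
    intro x hx hxl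
    rw [mem_KK hconn hQ hzQ hq] at hx
    obtain ⟨N, hN, hN1, hN2, hN3⟩ := chain_of_reach hx hqz
    obtain ⟨z', hz'N, hz'l, s', hzs', hsl', hqs'⟩ :=
      hit N hN.2 hN2 ⟨x, List.mem_of_getLast? hN3, hxl⟩
    exact hN1 z' hz'N (hear z' hz'l z hzl s' s hsl' hzs' hzs (hqs'.symm.trans hqs))
  rcases eq_or_ne z v with rfl | hzv
  · exact hKl u huK hul
  · have hsub : KK G z ⊆ KK G v := by
      intro x hx
      rw [mem_KK hconn hQ hzQ hq] at hx
      rw [mem_KK hconn hQ hvQ hq]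
      obtain ⟨N, hN, hN1, hN2, hN3⟩ := chain_of_reach hx hqz
      refine reach_of_chain hN.2 ?_ (List.mem_of_head? hN2) (List.mem_of_getLast? hN3)
      rintro y hy rfl
      refine hKl y ?_ hvl
      rw [mem_KK hconn hQ hzQ hq]
      exact reach_of_chain hN.2 hN1 (List.mem_of_head? hN2) hy
    have hzK : z ∈ KK G v := by
      rw [mem_KK hconn hQ hvQ hq]
      obtain ⟨N, hN, hN1, hN2, hN3⟩ := chain_of_reach hqs (hcon q hq)
      have h1 : (Out G {v}).Reachable q s := by
        refine reach_of_chain hN.2 ?_ (List.mem_of_head? hN2) (List.mem_of_getLast? hN3)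
        rintro y hy rfl
        exact hN1 y hy hvl
      have h2 : (Out G {v}).Adj s z :=
        ⟨hzs.symm, by rintro rfl; exact hsl hvl, hzv⟩
      exact h1.trans h2.reachable
    have hlt : (KK G z).ncard < (KK G v).ncard :=
      Set.ncard_lt_ncard ⟨hsub, fun h => not_mem_KK (h hzK)⟩ (Set.toFinite _)
    exact absurd (hvmin z (Finset.mem_univ _)) (by omega)

/-- A tail hanging off `l` at `z`. -/
def Tail (G : SimpleGraph V) (l : List V) (z : V) (T : List V) : Prop :=
  PathL G (z :: T) ∧ ∀ t ∈ T, t ∉ l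

theorem tail_disjoint {G : SimpleGraph V} {l : List V} (hear : NoEar G l) {a b : V}
    {S T : List V} (ha : a ∈ l) (hb : b ∈ l) (hab : a ≠ b) (hS : Tail G l a S)
    (hT : Tail G l b T) : S.Disjoint T := by
  intro x hx hx'
  have key : ∀ (a : V) (S : List V), Tail G l a S → x ∈ S →
      ∃ s, G.Adj a s ∧ s ∉ l ∧ (Out G {x | x ∈ l}).Reachable s x := by
    intro a S hS hx
    obtain ⟨s, S', rfl⟩ := List.exists_cons_of_ne_nil (List.ne_nil_of_mem hx)
    exact ⟨s, hS.1.2.rel_head? (by simp), hS.2 s (by simp),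
      reach_of_chain hS.1.2.tail hS.2 (by simp) hx⟩
  obtain ⟨s, e, hs, r⟩ := key a S hS hx
  obtain ⟨s', e', hs', r'⟩ := key b T hT hx'
  exact hab (hear a ha b hb s s' hs e e' (r.trans r'.symm))

/-- Attach two tails to a path inside `l`. -/
theorem glue {G : SimpleGraph V} {l M S T : List V} {a b : V} (hM : PathL G M)
    (hMl : ∀ x ∈ M, x ∈ l) (he : Ends M a b) (hS : Tail G l a S) (hT : Tail G l b T)
    (hd : S.Disjoint T) : PathL G (S.reverse ++ (M ++ T)) := by
  constructor
  · rw [List.nodup_append', List.nodup_append']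
    refine ⟨List.nodup_reverse.2 (List.nodup_cons.1 hS.1.1).2,
      ⟨hM.1, (List.nodup_cons.1 hT.1.1).2, fun x hx hx' => hT.2 x hx' (hMl x hx)⟩, ?_⟩
    intro x hx hx'
    rw [List.mem_reverse] at hx
    rcases List.mem_append.1 hx' with h | h
    · exact hS.2 x hx (hMl x h)
    · exact hd hx h
  · have cS := hS.1.2
    have cT := hT.1.2
    rw [List.isChain_cons] at cS cT
    refine (chain_rev.2 cS.2).append (hM.2.append cT.2 ?_) ?_
    · intro x hx y hy
      rw [he.2] at hx
      obtain rfl : b = x := by simpa using hx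
      exact cT.1 y hy
    · intro x hx y hy
      rw [List.getLast?_reverse] at hx
      have : (M ++ T).head? = some a := by rw [List.head?_append, he.1]; rfl
      rw [this] at hy
      obtain rfl : a = y := by simpa using hy
      exact (cS.1 x hx).symm

theorem main_s1 [Fintype V] {G : SimpleGraph V} (hconn : G.Connected) (houter : IsOuterplanar G) :
    ∃ v, ∀ P, LP G P → v ∈ P := by
  by_contra hno
  push Not at hno
  obtain ⟨l, hl, hlne, hear, hmeet⟩ := exists_block hconn houter.2 hno
  obtain ⟨a, _, hle⟩ := List.exists_cons_of_ne_nil hlne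
  obtain ⟨m, ⟨v, T0, hvl, hT0, rfl⟩, hmax⟩ :=
    exists_max_s1 (p := fun n => ∃ z T, z ∈ l ∧ Tail G l z T ∧ T.length = n) (n := 0)
      (b := Fintype.card V) ⟨a, [], by rw [hle]; simp, ⟨⟨by simp, by simp⟩, by simp⟩, by simp⟩ (by
        rintro m ⟨z, T, -, hT, rfl⟩
        exact (List.nodup_cons.1 hT.1.1).2.length_le_card)
  obtain ⟨P, hP, hvP⟩ := hno v
  obtain ⟨S, x, R, hPe, hxl, hS⟩ := split_first (p := fun x => x ∈ l) (hmeet P hP)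
  obtain ⟨M0, y, T, hR, hyl, hT⟩ := split_last (p := fun x => x ∈ l) (l := x :: R)
    ⟨x, by simp, hxl⟩
  -- P = S ++ (M0 ++ [y]) ++ T
  rw [hR] at hPe
  obtain ⟨M, hM⟩ : ∃ M, M = M0 ++ [y] := ⟨_, rfl⟩
  have hPM : P = S ++ M ++ T := by rw [hPe, hM]; simp
  have hMe : Ends M x y := by
    refine ⟨?_, by simp [hM]⟩
    have := congrArg List.head? hR
    rw [hM]
    rcases M0 with _ | ⟨c, M0⟩ <;> simp at this ⊢ <;> exact this.symm
  have hPp := hP.2.1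
  have hMp : PathL G M := by
    rw [hPM] at hPp
    exact ⟨hPp.1.sublist ((List.sublist_append_right _ _).trans (List.sublist_append_left _ _)),
      hPp.2.onSeg ⟨S, T, rfl⟩⟩
  have hMl : ∀ z ∈ M, z ∈ l := by
    intro z hz
    by_contra hzl
    obtain ⟨M1, M2, hM12⟩ := List.append_of_mem hz
    have hx1 : x ∈ M1 := by
      have h1 := hMe.1
      rw [hM12] at h1
      rcases M1 with _ | ⟨c, M1⟩
      · simp at h1; subst h1; exact absurd hxl hzl
      · simp at h1; simp [h1]
    have hy2 : y ∈ M2 := by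
      have h1 := hMe.2
      rw [hM12] at h1
      rcases List.eq_nil_or_concat M2 with rfl | ⟨M3, c, rfl⟩
      · simp at h1; subst h1; exact absurd hyl hzl
      · simp [List.getLast?_append, List.getLast?_cons] at h1; simp [h1]
    obtain ⟨A, c1, I1, rfl, hc1, hI1⟩ := split_last (p := fun x => x ∈ l) ⟨x, hx1, hxl⟩
    obtain ⟨I2, c2, B, rfl, hc2, hI2⟩ := split_first (p := fun x => x ∈ l) ⟨y, hy2, hyl⟩
    have t1 : (c2 :: (I2.reverse ++ [z])).IsChain G.Adj := by
      apply chain_rev_seg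
      exact hMp.2.onSeg ⟨A ++ c1 :: I1, B, by rw [hM12]; simp⟩
    have t2 : (c1 :: (I1 ++ [z])).IsChain G.Adj :=
      hMp.2.onSeg ⟨A, I2 ++ c2 :: B, by rw [hM12]; simp⟩
    have key : ∀ c I, (c :: (I ++ [z])).IsChain G.Adj → (∀ x ∈ I, x ∉ l) →
        ∃ s, G.Adj c s ∧ s ∉ l ∧ (Out G {x | x ∈ l}).Reachable s z := by
      intro c I hc hI
      have hI' : ∀ x ∈ I ++ [z], x ∉ l := by
        intro x hx
        rcases List.mem_append.1 hx with h | h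
        · exact hI x h
        · obtain rfl : x = z := by simpa using h
          exact hzl
      obtain ⟨s, I', hI''⟩ := List.exists_cons_of_ne_nil (l := I ++ [z]) (by simp)
      have hs : s ∈ I ++ [z] := by rw [hI'']; simp
      refine ⟨s, hc.rel_head? (by rw [hI'']; simp), hI' s hs,
        reach_of_chain hc.tail hI' hs (by simp)⟩
    obtain ⟨s1, e1, hs1, r1⟩ := key c1 I1 t2 hI1
    obtain ⟨s2, e2, hs2, r2⟩ := key c2 I2.reverse t1 (by simpa using hI2)
    have := hear c1 hc1 c2 hc2 s1 s2 hs1 e1 e2 (r1.trans r2.symm)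
    subst this
    have hn := hMp.1
    rw [hM12] at hn
    have : (c1 :: (I1 ++ z :: (I2 ++ c1 :: B))).Nodup :=
      hn.sublist (by simp)
    exact (List.nodup_cons.1 this).1 (by simp)
  have hSt : Tail G l x S.reverse := by
    refine ⟨?_, by simpa using hS⟩
    have h1 : PathL G (S ++ [x]) := by
      have e : P = (S ++ [x]) ++ R := by rw [hPe, ← hR]; simp
      rw [e] at hPp
      exact ⟨hPp.1.sublist (List.sublist_append_left _ _), hPp.2.onInit (List.prefix_append _ _)⟩
    simpa using h1.reverse
  have hTt : Tail G l y T := by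
    refine ⟨?_, hT⟩
    have e : P = (S ++ M0) ++ (y :: T) := by rw [hPe]; simp
    rw [e] at hPp
    exact ⟨hPp.1.sublist (List.sublist_append_right _ _), hPp.2.suffix (List.suffix_append _ _)⟩
  have hlS := hmax _ ⟨x, _, hxl, hSt, rfl⟩
  have hlT := hmax _ ⟨y, _, hyl, hTt, rfl⟩
  have hMP : ∀ z ∈ M, z ∈ P := by intro z hz; rw [hPM]; simp [hz]
  have hxv : v ≠ x := by rintro rfl; exact hvP (hMP _ (List.mem_of_head? hMe.1))
  have hyv : v ≠ y := by rintro rfl; exact hvP (hMP _ (List.mem_of_getLast? hMe.2))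
  obtain ⟨A, B, rfl⟩ := List.append_of_mem hvl
  have hmm : ∀ z, z ∈ v :: (B ++ A) → z ∈ A ++ v :: B := by intro z; simp; tauto
  obtain ⟨M', hM', hM'l, hlen, hends⟩ := improve houter.1 (v := v) (L := B ++ A) (M := M)
    (x := x) (y := y) (rotate_nodup hl.1) (hl.2 A v B rfl) hMp hMe (by
      intro z hz
      have h1 := hMl z hz
      have h2 : z ≠ v := by rintro rfl; exact hvP (hMP _ hz)
      simp at h1 ⊢
      tauto)
  replace hM'l : ∀ z ∈ M', z ∈ A ++ v :: B := fun z hz => hmm z (hM'l z hz)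
  have hPl : P.length = S.length + M.length + T.length := by rw [hPM]; simp; omega
  rcases hends with h | h | h
  · have hd : S.reverse.Disjoint T := by
      have := hPp.1
      rw [hPM, List.append_assoc, List.nodup_append'] at this
      intro z hz hz'
      exact this.2.2 (List.mem_reverse.1 hz) (by simp [hz'])
    have := hP.2.2 _ (glue hM' hM'l h hSt hTt hd)
    simp at this
    omega
  · have hd := tail_disjoint hear hvl hxl hxv hT0 hSt
    have := hP.2.2 _ (glue hM' hM'l h hT0 hSt hd)
    simp at this hlS
    omega
  · have hd := tail_disjoint hear hvl hyl hyv hT0 hTt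
    have := hP.2.2 _ (glue hM' hM'l h hT0 hTt hd)
    simp at this hlS
    omega

theorem LP_of_isLongest {G : SimpleGraph V} {a b : V} {p : G.Walk a b} (h : IsLongestPath G p) :
    LP G p.support := by
  refine ⟨p.support_ne_nil, ⟨h.1.support_nodup, p.isChain_adj_support⟩, fun Q hQ => ?_⟩
  rcases eq_or_ne Q [] with rfl | hne
  · simp
  · have h1 := h.2 _ _ (Walk.ofSupport Q hne hQ.2)
      (Walk.IsPath.mk' (by rw [Walk.support_ofSupport]; exact hQ.1))
    rw [Walk.length_ofSupport] at h1
    rw [Walk.length_support]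
    omega

end Gallai

/-- Every finite connected outerplanar graph has a vertex contained in all of its
longest paths. -/
theorem gallai_outerplanar {V : Type} [Fintype V] (G : SimpleGraph V)
    (hconn : G.Connected) (houter : IsOuterplanar G) :
    ∃ v : V, ∀ (a b : V) (p : G.Walk a b), IsLongestPath G p → v ∈ p.support := by
  obtain ⟨v, hv⟩ := Gallai.main_s1 hconn houter
  exact ⟨v, fun a b p hp => hv _ (Gallai.LP_of_isLongest hp)⟩
end

section
/- For every 2-tree T, there exists a vertex v of T such that every longest path in T contains v. -/
open SimpleGraph

/-- `Conn G X a b`: `a` and `b` are joined by a walk avoiding `X` (or are equal). -/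
def Conn {V : Type*} (G : SimpleGraph V) (X : Set V) (a b : V) : Prop :=
  Relation.ReflTransGen (fun a b => G.Adj a b ∧ a ∉ X ∧ b ∉ X) a b

namespace Conn
variable {V : Type*} {G : SimpleGraph V} {X Y : Set V} {a b c : V}

theorem refl (G : SimpleGraph V) (X : Set V) (a : V) : Conn G X a a := Relation.ReflTransGen.refl

theorem trans (h : Conn G X a b) (h' : Conn G X b c) : Conn G X a c :=
  Relation.ReflTransGen.trans h h'

theorem single (h : G.Adj a b) (ha : a ∉ X) (hb : b ∉ X) : Conn G X a b :=
  Relation.ReflTransGen.single ⟨h, ha, hb⟩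

theorem symm (h : Conn G X a b) : Conn G X b a := by
  induction h with
  | refl => exact refl _ _ _
  | tail _ h ih => exact (single h.1.symm h.2.2 h.2.1).trans ih

theorem notMem (h : Conn G X a b) (ha : a ∉ X) : b ∉ X := by
  induction h with
  | refl => exact ha
  | tail _ h ih => exact h.2.2

/-- Mapping connections. -/
theorem map {W : Type*} {H : SimpleGraph W} {Z : Set W} (f : V → W) (h : Conn G X a b)
    (hf : ∀ c d, G.Adj c d → c ∉ X → d ∉ X → Conn H Z (f c) (f d)) : Conn H Z (f a) (f b) := by
  induction h with
  | refl => exact refl _ _ _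
  | tail _ h ih => exact ih.trans (hf _ _ h.1 h.2.1 h.2.2)

theorem mono (h : Conn G X a b) (hXY : Y ⊆ X) : Conn G Y a b :=
  h.map id (fun _ _ h hc hd => single h (fun h' => hc (hXY h')) (fun h' => hd (hXY h')))

theorem near (h : Conn G X a c) (ha : a ∉ X) (hac : a ≠ c) :
    ∃ y, Conn G (insert c X) a y ∧ G.Adj y c := by
  revert hac ha
  induction h using Relation.ReflTransGen.head_induction_on with
  | refl => intro _ h; exact absurd rfl h
  | @head x x' h1 h2 ih =>
    intro hx hxc
    by_cases hc : x' = c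
    · subst hc; exact ⟨x, refl _ _ _, h1.1⟩
    · obtain ⟨y, hy, hyc⟩ := ih h1.2.2 hc
      refine ⟨y, (single h1.1 ?_ ?_).trans hy, hyc⟩
      · simp [hxc, hx]
      · simp [hc, h1.2.2]

theorem of_chain {l : List V} (hl : l.IsChain G.Adj) (hX : ∀ c ∈ l, c ∉ X) :
    ∀ a ∈ l, ∀ b ∈ l, Conn G X a b := by
  induction l with
  | nil => simp
  | cons x l ih =>
    have ih := ih hl.tail (fun c hc => hX c (by simp [hc]))
    have key : ∀ b ∈ l, Conn G X x b := by
      intro b hb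
      cases l with
      | nil => simp at hb
      | cons y l =>
        have hxy : G.Adj x y := by simp at hl; exact hl.1
        exact (single hxy (hX _ (by simp)) (hX _ (by simp))).trans (ih y (by simp) b hb)
    intro a ha b hb
    rcases List.mem_cons.1 ha with ha | ha <;> rcases List.mem_cons.1 hb with hb | hb
    · rw [ha, hb]; exact refl _ _ _
    · rw [ha]; exact key b hb
    · rw [hb]; exact (key a ha).symm
    · exact ih a ha b hb

end Conn

section skel
variable {W : Type*} {G : SimpleGraph W} {x y : W}

theorem al_some_some {a b : W} : (G.addLink2 x y).Adj (some a) (some b) ↔ G.Adj a b := by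
  simp only [SimpleGraph.addLink2, SimpleGraph.fromRel_adj]
  constructor
  · rintro ⟨_, (⟨u, w, h1, h2, h⟩ | h) | (⟨u, w, h1, h2, h⟩ | h)⟩
    · cases h1; cases h2; exact h
    · simp at h
    · cases h1; cases h2; exact h.symm
    · simp at h
  · intro h
    exact ⟨by simpa using h.ne, Or.inl (Or.inl ⟨a, b, rfl, rfl, h⟩)⟩

theorem al_none_some {b : W} : (G.addLink2 x y).Adj none (some b) ↔ b = x ∨ b = y := by
  simp [SimpleGraph.addLink2, SimpleGraph.fromRel_adj]

theorem al_some_none {b : W} : (G.addLink2 x y).Adj (some b) none ↔ b = x ∨ b = y := by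
  rw [SimpleGraph.adj_comm, al_none_some]

theorem conn_lift {X : Set W} {Z : Set (Option W)} {a b : W} (h : Conn G X a b)
    (hZ : ∀ c, some c ∈ Z → c ∈ X) : Conn (G.addLink2 x y) Z (some a) (some b) :=
  h.map some (fun _ _ hcd hc hd => Conn.single (al_some_some.2 hcd)
    (fun h => hc (hZ _ h)) (fun h => hd (hZ _ h)))

end skel

theorem skel_conn {W : Type u} {G : SimpleGraph W} (h : IsTwoTreeSkel W G) :
    ∀ a b, Conn G ∅ a b := by
  induction h with
  | base =>
    intro a b
    by_cases hab : a = b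
    · subst hab; exact Conn.refl _ _ _
    · exact Conn.single (by simpa using hab) (by simp) (by simp)
  | @extend W G x y _ hxy ih =>
    have key : ∀ a, Conn (G.addLink2 x y) ∅ a (some x) := by
      rintro (_ | a)
      · exact Conn.single (al_none_some.2 (Or.inl rfl)) (by simp) (by simp)
      · exact conn_lift (ih a x) (by simp)
    exact fun a b => (key a).trans (key b).symm

theorem skel_conn2 {W : Type u} {G : SimpleGraph W} (h : IsTwoTreeSkel W G) :
    ∀ v a b, a ≠ v → b ≠ v → Conn G {v} a b := by
  induction h with
  | base =>
    intro v a b ha hb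
    have : a = b := by
      obtain ⟨v⟩ := v; obtain ⟨a⟩ := a; obtain ⟨b⟩ := b
      simp at *; omega
    subst this; exact Conn.refl _ _ _
  | @extend W G x y hG hxy ih =>
    rintro (_ | v)
    · rintro (_ | a) (_ | b) ha hb
      · simp at ha
      · simp at ha
      · simp at hb
      · exact conn_lift (skel_conn hG a b) (by simp)
    · have hz : ∃ z, z ≠ v ∧ (z = x ∨ z = y) := by
        by_cases h : x = v
        · exact ⟨y, fun h' => hxy.ne (h.trans h'.symm), Or.inr rfl⟩
        · exact ⟨x, h, Or.inl rfl⟩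
      obtain ⟨z, hzv, hz⟩ := hz
      have key : ∀ a, a ≠ some v → Conn (G.addLink2 x y) {some v} a (some z) := by
        rintro (_ | a) ha
        · exact Conn.single (al_none_some.2 hz) (by simp) (by simpa using hzv)
        · exact conn_lift (ih v a z (by simpa using ha) hzv) (by simp)
      exact fun a b ha hb => (key a ha).trans (key b hb).symm

/-- No component of the complement of a triangle is attached to all three vertices. -/
theorem skel_noK4 {W : Type u} {G : SimpleGraph W} (h : IsTwoTreeSkel W G) :
    ∀ u v w s a b c, G.Adj u v → G.Adj v w → G.Adj u w → s ∉ ({u, v, w} : Set W) →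
      Conn G {u, v, w} s a → Conn G {u, v, w} s b → Conn G {u, v, w} s c →
      G.Adj a u → G.Adj b v → G.Adj c w → False := by
  induction h with
  | base =>
    intro u v w s a b c huv hvw huw
    obtain ⟨u⟩ := u; obtain ⟨v⟩ := v; obtain ⟨w⟩ := w
    simp at huv hvw huw; omega
  | @extend W G x y hG hxy ih =>
    intro u v w s a b c huv hvw huw hs ha hb hc hau hbv hcw
    have ha' := ha.notMem hs
    have hb' := hb.notMem hs
    have hc' := hc.notMem hs
    simp only [Set.mem_insert_iff, Set.mem_singleton_iff, not_or] at ha' hb' hc' hs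
    rcases u with _ | u
    · rcases v with _ | v
      · simp at huv
      rcases w with _ | w
      · simp at huw
      rcases a with _ | a
      · simp at ha'
      rw [al_none_some] at huv huw
      rw [al_some_none] at hau
      rw [al_some_some] at hvw
      have := hvw.ne
      simp at ha'
      grind
    rcases v with _ | v
    · rcases w with _ | w
      · simp at hvw
      rcases b with _ | b
      · simp at hb'
      rw [al_none_some] at hvw
      rw [al_some_none] at huv hbv
      rw [al_some_some] at huw
      have := huw.ne
      simp at hb'
      grind
    rcases w with _ | w
    · rcases c with _ | c
      · simp at hc'
      rw [al_some_none] at huw hcw hvw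
      rw [al_some_some] at huv
      have := huv.ne
      simp at hc'
      grind
    rw [al_some_some] at huv hvw huw
    by_cases hz : ∃ z z', ((z = x ∧ z' = y) ∨ (z = y ∧ z' = x)) ∧ z ∉ ({u, v, w} : Set W)
    · obtain ⟨z, z', hzz, hz⟩ := hz
      have hadj : G.Adj z z' := by
        rcases hzz with ⟨rfl, rfl⟩ | ⟨rfl, rfl⟩
        · exact hxy
        · exact hxy.symm
      have hor : ∀ {t}, (t = x ∨ t = y) ↔ (t = z ∨ t = z') := by
        intro t; grind
      let f : Option W → W := fun t => t.getD z
      have hm : ∀ {s a}, Conn (G.addLink2 x y) {some u, some v, some w} s a →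
          Conn G {u, v, w} (f s) (f a) := by
        intro s a h
        refine h.map f ?_
        rintro (_ | c) (_ | d) hcd hc hd
        · exact Conn.refl _ _ _
        · rw [al_none_some, hor] at hcd
          rcases hcd with rfl | rfl
          · exact Conn.refl _ _ _
          · exact Conn.single hadj hz (by simpa [f] using hd)
        · rw [al_some_none, hor] at hcd
          rcases hcd with rfl | rfl
          · exact Conn.refl _ _ _
          · exact Conn.single hadj.symm (by simpa [f] using hc) hz
        · exact Conn.single (al_some_some.1 hcd) (by simpa [f] using hc) (by simpa [f] using hd)
      have hadj' : ∀ {a t}, t ∈ ({u, v, w} : Set W) → (G.addLink2 x y).Adj a (some t) →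
          G.Adj (f a) t := by
        rintro (_ | a) t ht h
        · rw [al_none_some, hor] at h
          rcases h with rfl | rfl
          · exact absurd ht hz
          · exact hadj
        · exact al_some_some.1 h
      refine ih u v w (f s) (f a) (f b) (f c) huv hvw huw ?_ (hm ha) (hm hb) (hm hc)
        (hadj' (by simp) hau) (hadj' (by simp) hbv) (hadj' (by simp) hcw)
      rcases s with _ | s
      · exact hz
      · simpa [f] using hs
    · have hx : x ∈ ({u, v, w} : Set W) := by
        by_contra h; exact hz ⟨x, y, Or.inl ⟨rfl, rfl⟩, h⟩
      have hy : y ∈ ({u, v, w} : Set W) := by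
        by_contra h; exact hz ⟨y, x, Or.inr ⟨rfl, rfl⟩, h⟩
      have hxy' : ∀ {t}, (t = x ∨ t = y) → t ∈ ({u, v, w} : Set W) := by
        rintro t (rfl | rfl) <;> assumption
      have hm : ∀ {s a}, Conn (G.addLink2 x y) {some u, some v, some w} s a →
          s = a ∨ ∃ s' a', s = some s' ∧ a = some a' ∧ Conn G {u, v, w} s' a' := by
        intro s a h
        induction h with
        | refl => exact Or.inl rfl
        | @tail c d _ h ih =>
          obtain ⟨h1, h2, h3⟩ := h
          rcases c with _ | c
          · rcases d with _ | d
            · simp at h1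
            · rw [al_none_some] at h1
              exact absurd (hxy' h1) (by simpa using h3)
          · rcases d with _ | d
            · rw [al_some_none] at h1
              exact absurd (hxy' h1) (by simpa using h2)
            · have hcd : Conn G {u, v, w} c d :=
                Conn.single (al_some_some.1 h1) (by simpa using h2) (by simpa using h3)
              rcases ih with rfl | ⟨s', a', rfl, h5, h6⟩
              · exact Or.inr ⟨c, d, rfl, rfl, hcd⟩
              · cases h5
                exact Or.inr ⟨s', d, rfl, rfl, h6.trans hcd⟩
      rcases s with _ | s
      · have e : ∀ {t}, Conn (G.addLink2 x y) {some u, some v, some w} none t → t = none := by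
          intro t ht
          rcases hm ht with h | ⟨_, _, h, _⟩
          · exact h.symm
          · simp at h
        cases e ha; cases e hb; cases e hc
        rw [al_none_some] at hau hbv hcw
        have := huv.ne
        have := huw.ne
        have := hvw.ne
        grind
      · have e : ∀ {t}, Conn (G.addLink2 x y) {some u, some v, some w} (some s) t →
            ∃ t', t = some t' ∧ Conn G {u, v, w} s t' := by
          intro t ht
          rcases hm ht with h | ⟨s', t', h1, h2, h3⟩
          · exact ⟨s, h.symm, Conn.refl _ _ _⟩
          · cases h1; exact ⟨t', h2, h3⟩
        obtain ⟨a, rfl, ka⟩ := e ha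
        obtain ⟨b, rfl, kb⟩ := e hb
        obtain ⟨c, rfl, kc⟩ := e hc
        exact ih u v w s a b c huv hvw huw (by simpa using hs) ka kb kc
          (al_some_some.1 hau) (al_some_some.1 hbv) (al_some_some.1 hcw)

/-- Any orientation of the edges of a 2-tree towards components has a sink triangle. -/
theorem skel_sink {W : Type u} {G : SimpleGraph W} (h : IsTwoTreeSkel W G) :
    ∀ β : W → W → W, (∀ u v, G.Adj u v → β u v ≠ u ∧ β u v ≠ v) →
      ∃ u v w, G.Adj u v ∧ G.Adj v w ∧ G.Adj u w ∧ Conn G {u, v} (β u v) w ∧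
        Conn G {v, w} (β v w) u ∧ Conn G {u, w} (β u w) v := by
  induction h with
  | base =>
    intro β hβ
    have := hβ ⟨0⟩ ⟨1⟩ (by simp)
    exfalso
    generalize β ⟨0⟩ ⟨1⟩ = t at this
    obtain ⟨t⟩ := t
    simp at this; omega
  | @extend W G x y hG hxy ih =>
    intro β hβ
    have key : ∀ x' y', ((x' = x ∧ y' = y) ∨ (x' = y ∧ y' = x)) →
        β (some x') (some y') = none →
        ∃ u v w, (G.addLink2 x y).Adj u v ∧ (G.addLink2 x y).Adj v w ∧ (G.addLink2 x y).Adj u w ∧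
        Conn (G.addLink2 x y) {u, v} (β u v) w ∧
        Conn (G.addLink2 x y) {v, w} (β v w) u ∧ Conn (G.addLink2 x y) {u, w} (β u w) v := by
      intro x' y' h hn
      have hadj : G.Adj x' y' := by
        rcases h with ⟨rfl, rfl⟩ | ⟨rfl, rfl⟩
        · exact hxy
        · exact hxy.symm
      have hx : (G.addLink2 x y).Adj (some x') none := al_some_none.2 (by grind)
      have hy : (G.addLink2 x y).Adj (some y') none := al_some_none.2 (by grind)
      refine ⟨some x', some y', none, al_some_some.2 hadj, hy, hx, ?_, ?_, ?_⟩
      · rw [hn]; exact Conn.refl _ _ _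
      · have h1 := hβ _ _ hy
        revert h1
        rcases β (some y') none with _ | c
        · simp
        · intro h1
          exact conn_lift (skel_conn2 hG y' c x' (by simpa using h1) hadj.ne) (by simp)
      · have h1 := hβ _ _ hx
        revert h1
        rcases β (some x') none with _ | c
        · simp
        · intro h1
          exact conn_lift (skel_conn2 hG x' c y' (by simpa using h1) hadj.ne.symm) (by simp)
    by_cases h1 : β (some x) (some y) = none
    · exact key x y (by simp) h1
    by_cases h2 : β (some y) (some x) = none
    · exact key y x (by simp) h2
    classical
    let z : W → W → W := fun u v => if x ≠ u ∧ x ≠ v then x else y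
    let γ : W → W → W := fun u v => (β (some u) (some v)).getD (z u v)
    have hz : ∀ u v, G.Adj u v → β (some u) (some v) = none → z u v ≠ u ∧ z u v ≠ v := by
      intro u v huv hn
      have := huv.ne
      have := hxy.ne
      simp only [z]
      grind
    have hγ : ∀ u v, G.Adj u v → γ u v ≠ u ∧ γ u v ≠ v := by
      intro u v huv
      have h3 := hβ (some u) (some v) (al_some_some.2 huv)
      have h4 := hz u v huv
      simp only [γ]
      revert h3 h4
      rcases β (some u) (some v) with _ | c
      · intro _ h4; exact h4 rfl
      · intro h3 _; simpa using h3
    have hc : ∀ u v, G.Adj u v →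
        Conn (G.addLink2 x y) {some u, some v} (β (some u) (some v)) (some (γ u v)) := by
      intro u v huv
      have h4 := hz u v huv
      simp only [γ]
      revert h4
      rcases β (some u) (some v) with _ | c
      · intro h4
        have h4 := h4 rfl
        refine Conn.single (al_none_some.2 ?_) (by simp) (by simpa using h4)
        simp only [z, Option.getD_none]
        split_ifs <;> simp
      · intro _; exact Conn.refl _ _ _
    obtain ⟨u, v, w, huv, hvw, huw, k1, k2, k3⟩ := ih γ hγ
    exact ⟨some u, some v, some w, al_some_some.2 huv, al_some_some.2 hvw, al_some_some.2 huw,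
      (hc u v huv).trans (conn_lift k1 (by simp)), (hc v w hvw).trans (conn_lift k2 (by simp)),
      (hc u w huw).trans (conn_lift k3 (by simp))⟩

/-- Paths as lists of vertices. -/
def LPath {V : Type*} (G : SimpleGraph V) (l : List V) : Prop := l.IsChain G.Adj ∧ l.Nodup

namespace LPath
variable {V : Type*} {G : SimpleGraph V}

theorem reverse {l : List V} (h : LPath G l) : LPath G l.reverse := by
  refine ⟨?_, by simpa using h.2⟩
  rw [List.isChain_reverse]
  exact h.1.imp (fun _ _ h => h.symm)

theorem right {l m : List V} (h : LPath G (l ++ m)) : LPath G m :=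
  ⟨h.1.right_of_append, (List.nodup_append.1 h.2).2.1⟩

theorem left {l m : List V} (h : LPath G (l ++ m)) : LPath G l :=
  ⟨h.1.left_of_append, (List.nodup_append.1 h.2).1⟩

/-- Gluing two paths along a common vertex. -/
theorem glue {l m : List V} {d : V} (h : LPath G (l ++ [d])) (h' : LPath G (d :: m))
    (hd : ∀ c ∈ l, c ∉ m) : LPath G (l ++ d :: m) := by
  constructor
  · have := List.IsChain.append_overlap h.1 (l₂ := [d]) (l₃ := m) (by simpa using h'.1) (by simp)
    simpa using this
  · have h1 := h.2
    have h2 := h'.2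
    simp only [List.nodup_append, List.nodup_cons, List.mem_cons] at h1 h2 ⊢
    grind

/-- Gluing two paths along an edge. -/
theorem glue_edge {l m : List V} {d e : V} (h : LPath G (l ++ [d])) (h' : LPath G (e :: m))
    (hde : G.Adj d e) (hd : ∀ c ∈ l, c ∉ m) (hel : e ∉ l) (hdm : d ∉ m) :
    LPath G (l ++ d :: e :: m) := by
  refine glue h ⟨?_, ?_⟩ ?_
  · simpa using ⟨hde, h'.1⟩
  · rw [List.nodup_cons]
    exact ⟨by simp [hdm, hde.ne], h'.2⟩
  · intro c hc
    have : c ≠ e := fun h => hel (h ▸ hc)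
    simp [this, hd c hc]

end LPath

/-- A path from `c` to (the first vertex on) `l`. -/
theorem reach_list {V : Type*} {G : SimpleGraph V} {X : Set V} {l : List V} {a c : V}
    (ha : a ∈ l) (h : Conn G X c a) :
    ∃ m d, LPath G (m ++ [d]) ∧ d ∈ l ∧ (∀ x ∈ m, x ∉ l ∧ x ∉ X) ∧ (m ++ [d]).head? = some c := by
  induction h using Relation.ReflTransGen.head_induction_on with
  | refl => exact ⟨[], a, ⟨by simp, by simp⟩, ha, by simp, by simp⟩
  | @head c c' h1 h2 ih =>
    obtain ⟨m, d, hp, hd, hm, hh⟩ := ih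
    by_cases hcl : c ∈ l
    · exact ⟨[], c, ⟨by simp, by simp⟩, hcl, by simp, by simp⟩
    by_cases hcm : c ∈ m
    · obtain ⟨m1, m2, rfl⟩ := List.append_of_mem hcm
      refine ⟨c :: m2, d, ?_, hd, ?_, by simp⟩
      · rw [List.append_assoc] at hp; exact hp.right
      · intro x hx; exact hm x (by simp at hx ⊢; tauto)
    · refine ⟨c :: m, d, ⟨?_, ?_⟩, hd, ?_, by simp⟩
      · rw [List.cons_append, List.isChain_cons]
        refine ⟨?_, hp.1⟩
        intro y hy
        rw [hh] at hy
        cases hy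
        exact h1.1
      · rw [List.cons_append, List.nodup_cons]
        refine ⟨?_, hp.2⟩
        have : c ≠ d := fun h => hcl (h ▸ hd)
        simp [hcm, this]
      · intro x hx
        rcases List.mem_cons.1 hx with rfl | hx
        · exact ⟨hcl, h1.2.1⟩
        · exact hm x hx

theorem reach_long {V : Type*} {G : SimpleGraph V} {X : Set V} {l : List V} {a c : V}
    (hl : LPath G l) (ha : a ∈ l) (h : Conn G X c a) :
    ∃ m d t, LPath G (m ++ d :: t) ∧ d ∈ l ∧ (∀ x ∈ t, x ∈ l) ∧ (∀ x ∈ m, x ∉ l ∧ x ∉ X) ∧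
      (m ++ d :: t).head? = some c ∧ l.length ≤ 2 * t.length + 1 := by
  obtain ⟨m, d, hp, hd, hm, hh⟩ := reach_list ha h
  obtain ⟨A, B, rfl⟩ := List.append_of_mem hd
  have hh' : ∀ t, (m ++ d :: t).head? = some c := by
    intro t
    cases m <;> simpa using hh
  rcases le_total A.length B.length with hAB | hAB
  · refine ⟨m, d, B, hp.glue hl.right ?_, hd, by simp +contextual, hm, hh' _, ?_⟩
    · intro c hc hcB; exact (hm c hc).1 (by simp [hcB])
    · simp; omega
  · refine ⟨m, d, A.reverse, hp.glue ?_ ?_, hd, by simp +contextual, hm, hh' _, ?_⟩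
    · have : LPath G (A ++ [d]) := LPath.left (m := B) (by simpa using hl)
      simpa using this.reverse
    · intro c hc hcB; exact (hm c hc).1 (by simp at hcB; simp [hcB])
    · simp; omega

theorem last_split {α : Type*} (p : α → Prop) (l : List α) (h : ∃ a ∈ l, p a) :
    ∃ l₁ e l₂, l = l₁ ++ e :: l₂ ∧ p e ∧ ∀ x ∈ l₂, ¬ p x := by
  induction l with
  | nil => simp at h
  | cons a l ih =>
    by_cases h' : ∃ a ∈ l, p a
    · obtain ⟨l₁, e, l₂, rfl, h1, h2⟩ := ih h'
      exact ⟨a :: l₁, e, l₂, rfl, h1, h2⟩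
    · refine ⟨[], a, l, rfl, ?_, ?_⟩
      · obtain ⟨b, hb, hp⟩ := h
        rcases List.mem_cons.1 hb with rfl | hb
        · exact hp
        · exact absurd ⟨b, hb, hp⟩ h'
      · intro x hx hp; exact h' ⟨x, hx, hp⟩

section main
variable {W : Type u} {G : SimpleGraph W} {N : ℕ}

theorem arm_exists (h2 : ∀ v a b, a ≠ v → b ≠ v → Conn G {v} a b)
    (hno : ∀ v, ∃ l, LPath G l ∧ l.length = N ∧ v ∉ l) (hN : 1 ≤ N) {u v : W} (huv : u ≠ v) :
    ∃ t, LPath G (u :: t) ∧ v ∉ t ∧ N ≤ 2 * t.length + 1 := by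
  obtain ⟨l, hl, hlN, hv⟩ := hno v
  have hne : l ≠ [] := by rintro rfl; simp at hlN; omega
  obtain ⟨a, ha⟩ := List.exists_mem_of_ne_nil l hne
  obtain ⟨m, d, t, hp, hd, ht, hm, hh, hlen⟩ := reach_long hl ha
    (h2 v u a huv (fun h => hv (h ▸ ha)))
  have hvm : v ∉ m ++ d :: t := by
    intro h
    simp only [List.mem_append, List.mem_cons] at h
    rcases h with h | h | h
    · exact (hm v h).2 rfl
    · exact hv (h ▸ hd)
    · exact hv (ht v h)
  rcases m with _ | ⟨m0, m⟩
  · simp at hh; subst hh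
    exact ⟨t, hp, fun h => hvm (by simp [h]), by omega⟩
  · simp at hh; subst hh
    exact ⟨m ++ d :: t, hp, fun h => hvm (List.mem_cons_of_mem _ h), by simp; omega⟩

theorem arm_meet (hmax : ∀ l, LPath G l → l.length ≤ N) {u v : W} (huv : G.Adj u v)
    {s t : List W} (ht : LPath G (u :: t)) (hvt : v ∉ t) (hs : LPath G (v :: s)) (hus : u ∉ s)
    (htN : N ≤ 2 * t.length + 1) (hsN : N ≤ 2 * s.length + 1) : ∃ c ∈ t, c ∈ s := by
  by_contra hcon
  push Not at hcon
  have h1 : LPath G (t.reverse ++ u :: v :: s) := by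
    refine LPath.glue_edge (by simpa using ht.reverse) hs huv ?_ ?_ hus
    · intro c hc; exact hcon c (by simpa using hc)
    · simpa using hvt
  have := hmax _ h1
  simp at this
  omega

theorem home (h2 : ∀ v a b, a ≠ v → b ≠ v → Conn G {v} a b)
    (hmax : ∀ l, LPath G l → l.length ≤ N)
    (hno : ∀ v, ∃ l, LPath G l ∧ l.length = N ∧ v ∉ l) (hN : 1 ≤ N) {u v : W} (huv : G.Adj u v) :
    ∃ b, b ≠ u ∧ b ≠ v ∧ ∀ t, N ≤ 2 * t.length + 1 →
      (LPath G (u :: t) ∧ v ∉ t ∨ LPath G (v :: t) ∧ u ∉ t) → ∀ c ∈ t, Conn G {u, v} b c := by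
  obtain ⟨t0, ht0, hvt0, hl0⟩ := arm_exists h2 hno hN huv.ne
  obtain ⟨s0, hs0, hus0, hl0'⟩ := arm_exists h2 hno hN huv.ne.symm
  obtain ⟨b, hbt, hbs⟩ := arm_meet hmax huv ht0 hvt0 hs0 hus0 hl0 hl0'
  have c1 : ∀ t, LPath G (u :: t) → v ∉ t → ∀ a ∈ t, ∀ b ∈ t, Conn G {u, v} a b := by
    intro t ht hv
    refine Conn.of_chain ht.1.tail ?_
    have := ht.2
    rw [List.nodup_cons] at this
    intro c hc
    simp only [Set.mem_insert_iff, Set.mem_singleton_iff, not_or]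
    exact ⟨fun h => this.1 (h ▸ hc), fun h => hv (h ▸ hc)⟩
  have c2 : ∀ t, LPath G (v :: t) → u ∉ t → ∀ a ∈ t, ∀ b ∈ t, Conn G {u, v} a b := by
    intro t ht hv
    refine Conn.of_chain ht.1.tail ?_
    have := ht.2
    rw [List.nodup_cons] at this
    intro c hc
    simp only [Set.mem_insert_iff, Set.mem_singleton_iff, not_or]
    exact ⟨fun h => hv (h ▸ hc), fun h => this.1 (h ▸ hc)⟩
  refine ⟨b, fun h => hus0 (h ▸ hbs), fun h => hvt0 (h ▸ hbt), ?_⟩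
  rintro t htN (⟨ht, hv⟩ | ⟨ht, hu⟩) c hc
  · obtain ⟨d, hd, hd'⟩ := arm_meet hmax huv ht hv hs0 hus0 htN hl0'
    exact (c2 s0 hs0 hus0 b hbs d hd').trans (c1 t ht hv d hd c hc)
  · obtain ⟨d, hd, hd'⟩ := arm_meet hmax huv ht0 hvt0 ht hu hl0 htN
    exact (c1 t0 ht0 hvt0 b hbt d hd).trans (c2 t ht hu d hd' c hc)

/-- Triangle such that all paths meeting it only in an end vertex are short. -/
theorem star (h : IsTwoTreeSkel W G) (hmax : ∀ l, LPath G l → l.length ≤ N)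
    (hno : ∀ v, ∃ l, LPath G l ∧ l.length = N ∧ v ∉ l) :
    ∃ u v w, G.Adj u v ∧ G.Adj v w ∧ G.Adj u w ∧ ∀ e ∈ ({u, v, w} : Set W), ∀ t, LPath G (e :: t) →
      (∀ c ∈ t, c ∉ ({u, v, w} : Set W)) → 2 * t.length + 1 < N := by
  classical
  have hN : ∀ {u v}, G.Adj u v → 2 ≤ N := by
    intro u v huv
    have := hmax [u, v] ⟨by simpa using huv, by simpa using huv.ne⟩
    simpa using this
  have hb : ∀ u v, ∃ b, G.Adj u v → (b ≠ u ∧ b ≠ v) ∧ ∀ t, N ≤ 2 * t.length + 1 →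
      (LPath G (u :: t) ∧ v ∉ t ∨ LPath G (v :: t) ∧ u ∉ t) → ∀ c ∈ t, Conn G {u, v} b c := by
    intro u v
    by_cases huv : G.Adj u v
    · obtain ⟨b, h1, h2, h3⟩ := home (skel_conn2 h) hmax hno (by have := hN huv; omega) huv
      exact ⟨b, fun _ => ⟨⟨h1, h2⟩, h3⟩⟩
    · exact ⟨u, fun h => absurd h huv⟩
  choose β hβ using hb
  obtain ⟨u, v, w, huv, hvw, huw, k1, k2, k3⟩ := skel_sink h β (fun u v h => (hβ u v h).1)
  refine ⟨u, v, w, huv, hvw, huw, ?_⟩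
  have hN2 := hN huv
  intro e he t ht htΔ
  by_contra hlen
  have hlen : N ≤ 2 * t.length + 1 := by omega
  obtain ⟨x, t', rfl⟩ : ∃ x t', t = x :: t' := by
    cases t with
    | nil => simp at hlen; omega
    | cons x t' => exact ⟨x, t', rfl⟩
  have hxe : G.Adj x e := by
    have := ht.1
    simp at this
    exact this.1.symm
  have hxΔ := htΔ x (by simp)
  have hnot : ∀ c ∈ ({u, v, w} : Set W), c ∉ x :: t' := fun c hc hc' => htΔ c hc' hc
  have hu := hnot u (by simp)
  have hv := hnot v (by simp)
  have hw := hnot w (by simp)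
  have q1 := (hβ u v huv).2 _ hlen
  have q2 := (hβ v w hvw).2 _ hlen
  have q3 := (hβ u w huw).2 _ hlen
  have hxΔ' := hxΔ
  simp only [Set.mem_insert_iff, Set.mem_singleton_iff, not_or] at hxΔ' he
  obtain ⟨xu, xv, xw⟩ := hxΔ'
  have near : ∀ {a b c : W}, Conn G {a, b} x c → ({c, a, b} : Set W) = {u, v, w} →
      ∃ y, Conn G {u, v, w} x y ∧ G.Adj y c := by
    intro a b c hc hs
    have h1 : x ∉ ({c, a, b} : Set W) := by rw [hs]; exact hxΔ
    rw [← hs]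
    simp only [Set.mem_insert_iff, Set.mem_singleton_iff, not_or] at h1
    exact hc.near (by simp [h1]) h1.1
  have s1 : ({w, u, v} : Set W) = {u, v, w} := by
    rw [Set.insert_comm w u, Set.pair_comm w v]
  have s3 : ({v, u, w} : Set W) = {u, v, w} := Set.insert_comm v u {w}
  rcases he with rfl | rfl | rfl
  · have e1 := (q1 (Or.inl ⟨ht, hv⟩) x (by simp)).symm.trans k1
    have e3 := (q3 (Or.inl ⟨ht, hw⟩) x (by simp)).symm.trans k3
    obtain ⟨y, hy, hyw⟩ := near e1 s1
    obtain ⟨z, hz, hzv⟩ := near e3 s3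
    exact skel_noK4 h e v w x x z y huv hvw huw hxΔ (Conn.refl _ _ _) hz hy hxe hzv hyw
  · have e1 := (q1 (Or.inr ⟨ht, hu⟩) x (by simp)).symm.trans k1
    have e2 := (q2 (Or.inl ⟨ht, hw⟩) x (by simp)).symm.trans k2
    obtain ⟨y, hy, hyw⟩ := near e1 s1
    obtain ⟨z, hz, hzu⟩ := near e2 rfl
    exact skel_noK4 h u e w x z x y huv hvw huw hxΔ hz (Conn.refl _ _ _) hy hzu hxe hyw
  · have e2 := (q2 (Or.inr ⟨ht, hv⟩) x (by simp)).symm.trans k2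
    have e3 := (q3 (Or.inr ⟨ht, hu⟩) x (by simp)).symm.trans k3
    obtain ⟨y, hy, hyv⟩ := near e3 s3
    obtain ⟨z, hz, hzu⟩ := near e2 rfl
    exact skel_noK4 h u v e x z y x huv hvw huw hxΔ hz hy (Conn.refl _ _ _) hzu hyv hxe

/-- Every longest path meets the triangle in at least two vertices. -/
theorem two_hits (hconn : ∀ a b, Conn G ∅ a b) {D : Set W} {u : W} (hu : u ∈ D)
    (hstar : ∀ e ∈ D, ∀ t, LPath G (e :: t) → (∀ c ∈ t, c ∉ D) → 2 * t.length + 1 < N)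
    (hN : 1 ≤ N) {l : List W} (hl : LPath G l) (hlN : l.length = N) :
    ∃ a ∈ l, ∃ b ∈ l, a ≠ b ∧ a ∈ D ∧ b ∈ D := by
  by_contra hcon
  push Not at hcon
  by_cases h : ∃ e ∈ l, e ∈ D
  · obtain ⟨e, hel, heD⟩ := h
    obtain ⟨A, B, rfl⟩ := List.append_of_mem hel
    have hnd := hl.2
    simp only [List.nodup_append, List.nodup_cons, List.mem_cons] at hnd
    have h1 := hstar e heD B hl.right (by
      intro c hc hcD
      refine hcon e hel c (by simp [hc]) ?_ heD hcD
      rintro rfl; exact hnd.2.1.1 hc)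
    have h2 := hstar e heD A.reverse (by
      have : LPath G (A ++ [e]) := LPath.left (m := B) (by simpa using hl)
      simpa using this.reverse) (by
      intro c hc hcD
      have hc : c ∈ A := by simpa using hc
      refine hcon e hel c (by simp [hc]) ?_ heD hcD
      rintro rfl; exact hnd.2.2 _ hc _ (Or.inl rfl) rfl)
    simp at h2 hlN
    omega
  · push Not at h
    have hne : l ≠ [] := by rintro rfl; simp at hlN; omega
    obtain ⟨a, ha⟩ := List.exists_mem_of_ne_nil l hne
    obtain ⟨m, d, t, hp, hd, ht, hm, hh, hlen⟩ := reach_long hl ha (hconn u a)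
    obtain ⟨l₁, e, l₂, heq, he, hl₂⟩ := last_split (· ∈ D) m ⟨u, by
      rcases m with _ | ⟨m0, m⟩
      · simp at hh; subst hh; exact absurd hu (h _ hd)
      · simp at hh; subst hh; simp, hu⟩
    subst heq
    have h1 := hstar e he (l₂ ++ d :: t) (LPath.right (l := l₁) (by simpa using hp)) (by
      intro c hc
      simp only [List.mem_append, List.mem_cons] at hc
      rcases hc with hc | rfl | hc
      · exact hl₂ c hc
      · exact h _ hd
      · exact h _ (ht _ hc))
    simp at h1
    omega

/-- A path through two vertices splits in a given order, up to reversal. -/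
theorem split_two {l : List W} (hl : LPath G l) {a b : W} (hab : a ≠ b) (ha : a ∈ l) (hb : b ∈ l) :
    ∃ X Y Z, LPath G (X ++ a :: (Y ++ b :: Z)) ∧ (X ++ a :: (Y ++ b :: Z)).length = l.length ∧
      ∀ c, c ∈ X ++ a :: (Y ++ b :: Z) ↔ c ∈ l := by
  obtain ⟨A, B, rfl⟩ := List.append_of_mem ha
  simp only [List.mem_append, List.mem_cons] at hb
  rcases hb with hb | hb | hb
  · obtain ⟨C, D, rfl⟩ := List.append_of_mem hb
    refine ⟨B.reverse, D.reverse, C.reverse, ?_, ?_, ?_⟩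
    · simpa using hl.reverse
    · simp; omega
    · intro c; simp; tauto
  · exact absurd hb.symm hab
  · obtain ⟨C, D, rfl⟩ := List.append_of_mem hb
    exact ⟨A, C, D, hl, rfl, fun _ => Iff.rfl⟩

/-- There is a vertex on all longest list paths. -/
theorem list_main (h : IsTwoTreeSkel W G) (hmax : ∀ l, LPath G l → l.length ≤ N)
    (hno : ∀ v, ∃ l, LPath G l ∧ l.length = N ∧ v ∉ l) : False := by
  obtain ⟨u, v, w, huv, hvw, huw, hstar⟩ := star h hmax hno
  have hN : 1 ≤ N := by
    have := hmax [u] ⟨by simp, by simp⟩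
    simpa using this
  have hits := fun l hl hlN => two_hits (l := l) (skel_conn h) (u := u) (by simp) hstar hN hl hlN
  have K4 := skel_noK4 h u v w
  -- the attachment predicate
  let Near : W → W → Prop := fun p c => ∃ y, Conn G {u, v, w} c y ∧ G.Adj y p
  have noNear : ∀ c, c ∉ ({u, v, w} : Set W) → Near u c → Near v c → Near w c → False := by
    rintro c hc ⟨a, ha, ha'⟩ ⟨b, hb, hb'⟩ ⟨d, hd, hd'⟩
    exact K4 c a b d huv hvw huw hc ha hb hd ha' hb' hd'
  have nearTail : ∀ p t, LPath G (p :: t) → (∀ c ∈ t, c ∉ ({u, v, w} : Set W)) →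
      ∀ c ∈ t, Near p c := by
    intro p t hp ht c hc
    rcases t with _ | ⟨x, t⟩
    · simp at hc
    · have hpx : G.Adj p x := by
        have := hp.1
        simp at this
        exact this.1
      exact ⟨x, Conn.of_chain hp.1.tail ht c hc x (by simp), hpx.symm⟩
  have nearTail' : ∀ p t, LPath G (t ++ [p]) → (∀ c ∈ t, c ∉ ({u, v, w} : Set W)) →
      ∀ c ∈ t, Near p c := by
    intro p t hp ht c hc
    exact nearTail p t.reverse (by simpa using hp.reverse) (by simpa using ht) c (by simpa using hc)
  -- decompositions
  have decomp : ∀ p q, p ∈ ({u, v, w} : Set W) → q ∈ ({u, v, w} : Set W) → u ≠ p → u ≠ q → p ≠ q →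
      ∃ X Y Z, LPath G (X ++ u :: (Y ++ p :: Z)) ∧ (X ++ u :: (Y ++ p :: Z)).length = N ∧
        q ∉ X ++ u :: (Y ++ p :: Z) ∧ (∀ c ∈ X, c ∉ ({u, v, w} : Set W)) ∧
        (∀ c ∈ Y, c ∉ ({u, v, w} : Set W)) ∧ (∀ c ∈ Z, c ∉ ({u, v, w} : Set W)) := by
    intro p q hp hq hup huq hpq
    have hΔ : ∀ c, c ∈ ({u, v, w} : Set W) ↔ c = u ∨ c = p ∨ c = q := by
      intro c
      have := huv.ne
      have := huw.ne
      have := hvw.ne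
      simp only [Set.mem_insert_iff, Set.mem_singleton_iff] at *
      grind
    obtain ⟨l, hl, hlN, hql⟩ := hno q
    obtain ⟨a, ha, b, hb, hab, haD, hbD⟩ := hits l hl hlN
    rw [hΔ] at haD hbD
    have hul : u ∈ l := by grind
    have hpl : p ∈ l := by grind
    obtain ⟨X, Y, Z, h1, h2, h3⟩ := split_two hl hup hul hpl
    have hql' : q ∉ X ++ u :: (Y ++ p :: Z) := by rw [h3]; exact hql
    have hnd := h1.2
    simp only [List.nodup_append, List.nodup_cons, List.mem_cons, List.mem_append] at hnd hql'
    refine ⟨X, Y, Z, h1, h2.trans hlN, by rw [h3]; exact hql, ?_, ?_, ?_⟩ <;>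
    · intro c hc
      rw [hΔ]
      grind
  obtain ⟨X, Y, Z, hP, hPN, hvP, hX, hY, hZ⟩ :=
    decomp w v (by simp) (by simp) huw.ne huv.ne hvw.ne.symm
  obtain ⟨X', Y', Z', hR, hRN, hwR, hX', hY', hZ'⟩ :=
    decomp v w (by simp) (by simp) huv.ne huw.ne hvw.ne
  -- subpaths
  have pieces : ∀ {p X Y Z}, LPath G (X ++ u :: (Y ++ p :: Z)) →
      LPath G (X ++ [u]) ∧ LPath G (u :: Y) ∧ LPath G (Y ++ [p]) ∧ LPath G (p :: Z) ∧
      LPath G (u :: (Y ++ [p])) ∧ LPath G (X ++ u :: (Y ++ [p])) := by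
    intro p X Y Z h
    have a1 : LPath G (X ++ u :: (Y ++ [p])) := LPath.left (m := Z) (by simpa using h)
    have a2 := a1.right
    have a3 : LPath G (Y ++ [p]) := LPath.right (l := [u]) (by simpa using a2)
    exact ⟨LPath.left (m := Y ++ [p]) (by simpa using a1), LPath.left (m := [p]) (by simpa using a2),
      a3, LPath.right (l := X ++ u :: Y) (by simpa using h), a2, a1⟩
  obtain ⟨p1, p2, p3, p4, p5, p6⟩ := pieces hP
  obtain ⟨r1, r2, r3, r4, r5, r6⟩ := pieces hR
  have nX := nearTail' u X p1 hX
  have nYu := nearTail u Y p2 hY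
  have nYw := nearTail' w Y p3 hY
  have nZ := nearTail w Z p4 hZ
  have nX' := nearTail' u X' r1 hX'
  have nYu' := nearTail u Y' r2 hY'
  have nYv' := nearTail' v Y' r3 hY'
  have nZ' := nearTail v Z' r4 hZ'
  have lX := hstar u (by simp) X.reverse (by simpa using p1.reverse) (by simpa using hX)
  have lX' := hstar u (by simp) X'.reverse (by simpa using r1.reverse) (by simpa using hX')
  have hmeet : ∃ c ∈ Z, c ∈ Z' := by
    by_contra hcon
    push Not at hcon
    have q : LPath G ((Y ++ w :: Z).reverse ++ u :: (Y' ++ v :: Z')) := by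
      refine LPath.glue ?_ hR.right ?_
      · simpa using hP.right.reverse
      · intro c hc hc'
        simp only [List.mem_reverse, List.mem_append, List.mem_cons] at hc hc' hvP hwR
        rcases hc with hc | rfl | hc
        · rcases hc' with hc' | rfl | hc'
          · exact noNear c (hY c hc) (nYu c hc) (nYv' c hc') (nYw c hc)
          · exact hY c hc (by simp)
          · exact noNear c (hY c hc) (nYu c hc) (nZ' c hc') (nYw c hc)
        · exact hwR (by tauto)
        · rcases hc' with hc' | rfl | hc'
          · exact noNear c (hZ c hc) (nYu' c hc') (nYv' c hc') (nZ c hc)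
          · exact hZ c hc (by simp)
          · exact hcon c hc hc'
    have := hmax _ q
    simp at this hPN hRN lX lX'
    omega
  obtain ⟨c, hcZ, hcZ'⟩ := hmeet
  have cZ := Conn.of_chain p4.1.tail hZ
  have cZ' := Conn.of_chain r4.1.tail hZ'
  have nZv : ∀ d ∈ Z, Near v d := by
    intro d hd
    obtain ⟨y, hy, hyv⟩ := nZ' c hcZ'
    exact ⟨y, (cZ d hd c hcZ).trans hy, hyv⟩
  have nZw' : ∀ d ∈ Z', Near w d := by
    intro d hd
    obtain ⟨y, hy, hyv⟩ := nZ c hcZ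
    exact ⟨y, (cZ' d hd c hcZ').trans hy, hyv⟩
  have f1 : LPath G ((X ++ u :: Y) ++ w :: v :: Z') := by
    refine LPath.glue_edge (by simpa using p6) r4 hvw.symm ?_ ?_ ?_
    · intro d hd hd'
      simp only [List.mem_append, List.mem_cons] at hd
      rcases hd with hd | rfl | hd
      · exact noNear d (hX d hd) (nX d hd) (nZ' d hd') (nZw' d hd')
      · exact hZ' d hd' (by simp)
      · exact noNear d (hY d hd) (nYu d hd) (nZ' d hd') (nZw' d hd')
    · intro hd; exact hvP (by simp at hd ⊢; tauto)
    · intro hd; exact hZ' w hd (by simp)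
  have f2 : LPath G ((X' ++ u :: Y') ++ v :: w :: Z) := by
    refine LPath.glue_edge (by simpa using r6) p4 hvw ?_ ?_ ?_
    · intro d hd hd'
      simp only [List.mem_append, List.mem_cons] at hd
      rcases hd with hd | rfl | hd
      · exact noNear d (hX' d hd) (nX' d hd) (nZv d hd') (nZ d hd')
      · exact hZ d hd' (by simp)
      · exact noNear d (hY' d hd) (nYu' d hd) (nZv d hd') (nZ d hd')
    · intro hd; exact hwR (by simp at hd ⊢; tauto)
    · intro hd; exact hZ v hd (by simp)
  have g1 := hmax _ f1
  have g2 := hmax _ f2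
  simp at g1 g2 hPN hRN
  omega

end main

theorem lpath_of_walk {V : Type*} {G : SimpleGraph V} {a b : V} (p : G.Walk a b) (hp : p.IsPath) :
    LPath G p.support := ⟨p.isChain_adj_support, hp.support_nodup⟩

theorem walk_of_lpath {V : Type*} {G : SimpleGraph V} (l : List V) (x : V)
    (h : LPath G (x :: l)) : ∃ (b : V) (p : G.Walk x b), p.IsPath ∧ p.support = x :: l := by
  induction l generalizing x with
  | nil => exact ⟨x, .nil, by simp, by simp⟩
  | cons y l ih =>
    obtain ⟨b, p, hp, hs⟩ := ih y (LPath.right (l := [x]) h)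
    have hxy : G.Adj x y := by
      have := h.1
      simp at this
      exact this.1
    refine ⟨b, .cons hxy p, ?_, by simp [hs]⟩
    rw [SimpleGraph.Walk.isPath_def]
    simpa [hs] using h.2

theorem LPath.mapIso {V W : Type*} {G : SimpleGraph V} {H : SimpleGraph W} (e : G ≃g H)
    {l : List V} (h : LPath G l) : LPath H (l.map e) := by
  refine ⟨?_, h.2.map e.injective⟩
  rw [List.isChain_map]
  exact h.1.imp (fun _ _ h => e.map_adj_iff.2 h)

/-- Every 2-tree has a vertex contained in all of its longest paths. -/
theorem gallai_twoTree {V : Type} [Fintype V] (T : SimpleGraph V) (hT : IsTwoTree T) :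
    ∃ v : V, ∀ (a b : V) (p : T.Walk a b), IsLongestPath T p → v ∈ p.support := by
  obtain ⟨W, H, hH, ⟨e⟩⟩ := hT
  by_contra hcon
  push Not at hcon
  have hV : Nonempty V := by
    have : Nonempty W := by
      cases hH with
      | base => exact ⟨⟨0⟩⟩
      | extend _ _ => exact ⟨none⟩
    exact this.map e.symm
  obtain ⟨v0⟩ := hV
  obtain ⟨a0, b0, p0, hp0, -⟩ := hcon v0
  refine list_main (N := p0.length + 1) hH ?_ ?_
  · intro l hl
    have hl' := hl.mapIso e.symm
    rcases hm : l.map e.symm with _ | ⟨x, m⟩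
    · have : l = [] := by simpa using hm
      simp [this]
    · rw [hm] at hl'
      obtain ⟨b, p, hp, hs⟩ := walk_of_lpath m x hl'
      have h1 := hp0.2 _ _ p hp
      have h2 := p.length_support
      rw [hs, ← hm, List.length_map] at h2
      omega
  · intro v
    obtain ⟨a, b, p, hp, hv⟩ := hcon (e.symm v)
    refine ⟨p.support.map e, (lpath_of_walk p hp.1).mapIso e, ?_, ?_⟩
    · have h1 := hp0.2 _ _ p hp.1
      have h2 := hp.2 _ _ p0 hp0.1
      simp
      omega
    · intro h
      obtain ⟨x, hx, rfl⟩ := List.mem_map.1 h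
      exact hv (by simpa using hx)
end
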